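/- Let k ≥ 17 and let S be a k-vertex tree with a vertex v_S satisfying one of the following: (i) S is not a caterpillar and v_S is a hub of S that is the root of at least one fork and is adjacent to at least two leaves; (ii) S is a caterpillar with at least four internal vertices and v_S is the root of a fork of order at least two and is adjacent to a leaf; (iii) S is a caterpillar with exactly three internal vertices and v_S is the root of a fork and is adjacent to a leaf. If T is a tree with radius at least 4k, then d(S,T) ≤ 1 - 10^{-4}. -/

import Mathlib

open SimpleGraph Filter

/-- The degree of a vertex, as the cardinality of its neighbour set. -/
noncomputable def ndeg {V : Type*} (G : SimpleGraph V) (v : V) : ℕ :=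
  (G.neighborSet v).ncard

/-- `Z_k(G)`: the number of `k`-vertex subtrees (connected subgraphs) of `G`. -/
noncomputable def subtreeCount {V : Type*} [Fintype V] (G : SimpleGraph V) (k : ℕ) : ℕ :=
  {s : Finset V | s.card = k ∧ (G.induce (s : Set V)).Connected}.ncard

/-- The number of embeddings (subtrees isomorphic to `S`) of a tree `S` in `G`,
counted among `k`-vertex subtrees. -/
noncomputable def embCount {V W : Type*} [Fintype V] (G : SimpleGraph V)
    (S : SimpleGraph W) (k : ℕ) : ℕ :=
  {s : Finset V | s.card = k ∧ Nonempty ((G.induce (s : Set V)) ≃g S)}.ncard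

/-- The density `d(S,T)`: the number of embeddings of the `|S|`-vertex tree `S` in `T`
divided by the number of `|S|`-vertex subtrees of `T` (`0` if `T` has fewer vertices). -/
noncomputable def density {V W : Type*} [Fintype V] [Fintype W]
    (S : SimpleGraph W) (T : SimpleGraph V) : ℝ :=
  (embCount T S (Fintype.card W) : ℝ) / (subtreeCount T (Fintype.card W) : ℝ)

/-- `max { d(S,T) : T an n-vertex tree }`. -/
noncomputable def maxDensity {W : Type*} [Fintype W] (S : SimpleGraph W) (n : ℕ) : ℝ :=
  sSup {x : ℝ | ∃ T : SimpleGraph (Fin n), T.IsTree ∧ x = density S T}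

/-- The inducibility of `S`: `limsup_{n → ∞} max { d(S,T) : T an n-vertex tree }`. -/
noncomputable def inducibility {W : Type*} [Fintype W] (S : SimpleGraph W) : ℝ :=
  Filter.limsup (maxDensity S) Filter.atTop

/-- A graph is starlike if it has at most one non-leaf vertex. -/
def IsStarlike {V : Type*} (G : SimpleGraph V) : Prop :=
  {v | ndeg G v ≠ 1}.Subsingleton

/-- A graph is pathlike if its maximum degree is at most 2. -/
def IsPathlike {V : Type*} (G : SimpleGraph V) : Prop :=
  ∀ v, ndeg G v ≤ 2

/-- The vertex set of the component of `u` in `G - v`; together with the edge `uv`, this is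
the branch of `G` rooted at `v` through its neighbour `u`. -/
def branchSet {V : Type*} (G : SimpleGraph V) (v u : V) : Set V :=
  {w | ∃ p : G.Walk u w, v ∉ p.support}

/-- The branch of `G` rooted at `v` through `u` is non-trivial if it is not a single edge. -/
def NontrivialBranch {V : Type*} (G : SimpleGraph V) (v u : V) : Prop :=
  G.Adj v u ∧ branchSet G v u ≠ {u}

/-- The branch rooted at `v` through `u` is a fork: non-trivial and isomorphic to a star in
which `v` is a leaf (all vertices of the branch other than `u` and `v` are leaves of `G`). -/
def IsFork {V : Type*} (G : SimpleGraph V) (v u : V) : Prop :=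
  NontrivialBranch G v u ∧ ∀ w ∈ branchSet G v u, w ≠ u → ndeg G w = 1

/-- The order of a fork: its number of leaves other than the root. -/
noncomputable def forkOrder {V : Type*} (G : SimpleGraph V) (v u : V) : ℕ :=
  (branchSet G v u).ncard - 1

/-- A branch is major if it is non-trivial and not a fork. -/
def IsMajor {V : Type*} (G : SimpleGraph V) (v u : V) : Prop :=
  NontrivialBranch G v u ∧ ¬ IsFork G v u

/-- A caterpillar is a tree in which every vertex is the root of at most two
non-trivial branches. -/
def IsCaterpillar {V : Type*} (G : SimpleGraph V) : Prop :=
  G.IsTree ∧ ∀ v, {u | NontrivialBranch G v u}.ncard ≤ 2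

/-- A center of `G`: each branch rooted at `v` has at most `|G|/2` edges (the branch through
a neighbour `u` has `(branchSet G v u).ncard` edges). -/
def IsCenter {V : Type*} [Fintype V] (G : SimpleGraph V) (v : V) : Prop :=
  ∀ u, G.Adj v u → 2 * (branchSet G v u).ncard ≤ Fintype.card V

/-- `v` is the root of at least three non-trivial branches. -/
def RootsThreeNontrivial {V : Type*} (G : SimpleGraph V) (v : V) : Prop :=
  3 ≤ {u | NontrivialBranch G v u}.ncard

/-- A hub of `G`: a vertex `v` that is the only vertex on the path from `v` to the nearest
center of `G` that is the root of at least three non-trivial branches.  (A vertex `w` lies on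
the path from `v` to `c` iff `dist v w + dist w c = dist v c`.) -/
def IsHub {V : Type*} [Fintype V] (G : SimpleGraph V) (v : V) : Prop :=
  RootsThreeNontrivial G v ∧
  ∃ c, IsCenter G c ∧ (∀ c', IsCenter G c' → G.dist v c ≤ G.dist v c') ∧
    ∀ w, G.dist v w + G.dist w c = G.dist v c → w ≠ v → ¬ RootsThreeNontrivial G w

namespace TreeStat

/-- `x` lies on the geodesic from `a` to `b`. -/
def Geod {V : Type*} (T : SimpleGraph V) (a x b : V) : Prop :=
  T.dist a x + T.dist x b = T.dist a b

section TreeMetric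

variable {V : Type*} {T : SimpleGraph V}

lemma Geod.symm {a x b : V} (h : Geod T a x b) : Geod T b x a := by
  unfold Geod at *
  rw [T.dist_comm (u := b) (v := x), T.dist_comm (u := x) (v := a), T.dist_comm (u := b) (v := a)]
  omega

lemma geod_comm {a x b : V} : Geod T a x b ↔ Geod T b x a := ⟨Geod.symm, Geod.symm⟩

lemma geod_left (a b : V) : Geod T a a b := by simp [Geod]

lemma geod_right (a b : V) : Geod T a b b := by simp [Geod]

lemma exists_adj_dist_succ (hT : T.IsTree) {m x : V} (h : m ≠ x) :
    ∃ n, T.Adj m n ∧ T.dist n x + 1 = T.dist m x := by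
  obtain ⟨p, hp⟩ := hT.1.exists_walk_length_eq_dist m x
  cases p with
  | nil => exact absurd rfl h
  | cons hadj q =>
    rename_i n
    refine ⟨n, hadj, ?_⟩
    have h1 := T.dist_le q
    have h2 := hT.1.dist_triangle (u := m) (v := n) (w := x)
    rw [dist_eq_one_iff_adj.2 hadj] at h2
    simp only [Walk.length_cons] at hp
    omega

lemma dist_adj_cases (hT : T.IsTree) {m n : V} (h : T.Adj m n) (x : V) :
    T.dist n x + 1 = T.dist m x ∨ T.dist m x + 1 = T.dist n x := by
  have h1 := hT.dist_ne_of_adj x h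
  have h2 := hT.1.dist_triangle (u := m) (v := n) (w := x)
  have h3 := hT.1.dist_triangle (u := n) (v := m) (w := x)
  rw [dist_eq_one_iff_adj.2 h] at h2
  rw [dist_eq_one_iff_adj.2 h.symm] at h3
  rw [T.dist_comm (u := x), T.dist_comm (u := x) (v := n)] at h1
  omega

lemma adj_dist_succ_unique (hT : T.IsTree) {m n n' x : V} (h : T.Adj m n) (h' : T.Adj m n')
    (hd : T.dist n x + 1 = T.dist m x) (hd' : T.dist n' x + 1 = T.dist m x) : n = n' := by
  obtain ⟨p, hp⟩ := hT.1.exists_walk_length_eq_dist n x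
  obtain ⟨p', hp'⟩ := hT.1.exists_walk_length_eq_dist n' x
  have h1 : (Walk.cons h p).IsPath := Walk.isPath_of_length_eq_dist _ (by simp; omega)
  have h2 : (Walk.cons h' p').IsPath := Walk.isPath_of_length_eq_dist _ (by simp; omega)
  have := (hT.existsUnique_path m x).unique h1 h2
  simp only [Walk.cons.injEq] at this
  exact this.1

lemma dist_eq_of_separating_edge (hT : T.IsTree) {n m b : V} (h : T.Adj n m)
    (hb : T.dist m b + 1 = T.dist n b) :
    ∀ (d : ℕ) (a : V), T.dist a n = d → T.dist a m = T.dist a n + 1 →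
      T.dist a b = T.dist a n + 1 + T.dist m b := by
  intro d
  induction d using Nat.strong_induction_on with
  | _ d ih =>
    intro a had ham
    by_cases han : a = n
    · subst han; simp; omega
    obtain ⟨a', haa', hd'⟩ := exists_adj_dist_succ hT han
    have hd1 : T.dist a m ≤ T.dist a a' + T.dist a' m := hT.1.dist_triangle
    have hd2 : T.dist a' m ≤ T.dist a' n + T.dist n m := hT.1.dist_triangle
    rw [dist_eq_one_iff_adj.2 haa'] at hd1
    rw [dist_eq_one_iff_adj.2 h] at hd2
    have h1 := ih (T.dist a' n) (by omega) a' rfl (by omega)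
    rcases dist_adj_cases hT haa' b with h2 | h2
    · omega
    exfalso
    by_cases han' : a' = n
    · subst han'
      have : a = m := adj_dist_succ_unique hT haa'.symm h h2 hb
      subst this
      simp at ham
    · obtain ⟨a'', haa'', hd''⟩ := exists_adj_dist_succ hT han'
      have hd3 : T.dist a' m ≤ T.dist a' a'' + T.dist a'' m := hT.1.dist_triangle
      have hd4 : T.dist a'' m ≤ T.dist a'' n + T.dist n m := hT.1.dist_triangle
      rw [dist_eq_one_iff_adj.2 haa''] at hd3
      rw [dist_eq_one_iff_adj.2 h] at hd4
      have h3 := ih (T.dist a'' n) (by omega) a'' rfl (by omega)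
      have : a = a'' := adj_dist_succ_unique hT haa'.symm haa'' h2 (by omega)
      subst this
      omega

lemma exists_adj_of_not_geod (hT : T.IsTree) {a m b : V} (h : ¬ Geod T a m b) :
    ∃ n, T.Adj m n ∧ T.dist n a + 1 = T.dist m a ∧ T.dist n b + 1 = T.dist m b := by
  have hma : m ≠ a := by rintro rfl; exact h (geod_left _ _)
  obtain ⟨n, hn, hd⟩ := exists_adj_dist_succ hT hma
  refine ⟨n, hn, hd, ?_⟩
  rcases dist_adj_cases hT hn b with h2 | h2
  · exact h2
  · exfalso
    apply h
    have := dist_eq_of_separating_edge hT hn.symm h2 _ a rfl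
      (by rw [T.dist_comm, ← hd, T.dist_comm])
    unfold Geod
    rw [T.dist_comm (u := n)] at hd
    rw [T.dist_comm (u := m) (v := a)] at hd
    omega

lemma not_geod_of_adj (hT : T.IsTree) {a m b n : V}
    (ha : T.dist n a + 1 = T.dist m a) (hb : T.dist n b + 1 = T.dist m b) : ¬ Geod T a m b := by
  unfold Geod
  have := hT.1.dist_triangle (u := a) (v := n) (w := b)
  rw [T.dist_comm (u := a) (v := n)] at this
  rw [T.dist_comm (u := a) (v := m)]
  omega

lemma not_geod_trans (hT : T.IsTree) {a b c m : V} (h : ¬ Geod T a m b) (h' : ¬ Geod T b m c) :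
    ¬ Geod T a m c := by
  obtain ⟨n, hn, h1, h2⟩ := exists_adj_of_not_geod hT h
  obtain ⟨n', hn', h3, h4⟩ := exists_adj_of_not_geod hT h'
  have := adj_dist_succ_unique hT hn hn' h2 h3
  subst this
  exact not_geod_of_adj hT h1 h4

lemma geod_of_adj_iff {m n b : V} (h : T.Adj m n) :
    Geod T m n b ↔ T.dist n b + 1 = T.dist m b := by
  unfold Geod
  rw [dist_eq_one_iff_adj.2 h, add_comm]

/-- The neighbours `n ≠ n'` of `m`, seen from targets on both sides. -/
lemma geod_of_adj_ne (hT : T.IsTree) {a m b n n' : V} (hn : T.Adj m n) (hn' : T.Adj m n')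
    (hne : n ≠ n') (ha : T.dist n a + 1 = T.dist m a) (hb : T.dist n' b + 1 = T.dist m b) :
    Geod T a m b := by
  by_contra h
  obtain ⟨z, hz, h1, h2⟩ := exists_adj_of_not_geod hT h
  exact hne ((adj_dist_succ_unique hT hn hz ha h1).trans
    (adj_dist_succ_unique hT hn' hz hb h2).symm)

lemma eq_or_eq_of_geod_adj (hT : T.IsTree) {a x b : V} (h : T.Adj a b) (hx : Geod T a x b) :
    x = a ∨ x = b := by
  unfold Geod at hx
  rw [dist_eq_one_iff_adj.2 h] at hx
  rcases Nat.eq_zero_or_pos (T.dist a x) with h0 | h0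
  · exact Or.inl (hT.1.dist_eq_zero_iff.1 h0).symm
  · exact Or.inr (hT.1.dist_eq_zero_iff.1 (by omega))

lemma geod_adj_iff (hT : T.IsTree) {v m w l : V} (h : T.Adj w l) (hm : m ≠ w) (hml : m ≠ l) :
    Geod T v m l ↔ Geod T v m w := by
  have key : ¬ Geod T w m l := by
    intro h'
    rcases eq_or_eq_of_geod_adj hT h h' with h1 | h1
    · exact hm h1
    · exact hml h1
  constructor
  · intro h1
    by_contra h2
    exact not_geod_trans hT h2 key h1
  · intro h1
    by_contra h2
    exact not_geod_trans hT h2 (fun h3 => key h3.symm) h1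

lemma dist_adj_adj (hT : T.IsTree) {a b c : V} (h : T.Adj a b) (h' : T.Adj b c) (hne : a ≠ c) :
    T.dist a c = 2 := by
  have h1 := dist_adj_cases hT h.symm c
  rw [dist_eq_one_iff_adj.2 h'] at h1
  have : 0 < T.dist a c := hT.1.pos_dist_of_ne hne
  omega

end TreeMetric

section Stats

open scoped Classical

variable {V : Type*} {T : SimpleGraph V}

/-- A nonempty set of vertices that is closed under taking geodesics. -/
def Conv (T : SimpleGraph V) (s : Finset V) : Prop :=
  s.Nonempty ∧ ∀ a ∈ s, ∀ b ∈ s, ∀ x, Geod T a x b → x ∈ s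

lemma not_geod_of_walk (hT : T.IsTree) {s : Set V} {x : V} (hx : x ∉ s) {a b : s}
    (p : (T.induce s).Walk a b) : ¬ Geod T (a : V) x b := by
  induction p with
  | nil =>
    intro h
    unfold Geod at h
    rw [T.dist_self] at h
    rename_i u
    have := hT.1.dist_eq_zero_iff.1 (show T.dist (u : V) x = 0 by omega)
    exact hx (this ▸ u.2)
  | cons h q ih =>
    rename_i u u' w
    have h1 : ¬ Geod T (u : V) x u' := by
      intro h2
      rcases eq_or_eq_of_geod_adj hT h h2 with h3 | h3
      · exact hx (h3 ▸ u.2)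
      · exact hx (h3 ▸ u'.2)
    exact not_geod_trans hT h1 ih

lemma conv_iff_connected (hT : T.IsTree) (s : Finset V) :
    Conv T s ↔ (T.induce (s : Set V)).Connected := by
  constructor
  · rintro ⟨⟨a0, ha0⟩, hs⟩
    have : Nonempty (s : Set V) := ⟨⟨a0, ha0⟩⟩
    refine ⟨?_⟩
    have key : ∀ (d : ℕ) (a b : (s : Set V)), T.dist (a : V) b = d →
        (T.induce (s : Set V)).Reachable a b := by
      intro d
      induction d with
      | zero =>
        intro a b h
        have := Subtype.ext (hT.1.dist_eq_zero_iff.1 h)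
        rw [this]
      | succ d ih =>
        intro a b h
        have hne : (a : V) ≠ b := by
          intro h'; rw [h', T.dist_self] at h; omega
        obtain ⟨n, hn, hd⟩ := exists_adj_dist_succ hT hne
        have hns : n ∈ s := hs a a.2 b b.2 n ((geod_of_adj_iff hn).2 hd)
        have h1 : (T.induce (s : Set V)).Adj a ⟨n, hns⟩ := hn
        exact h1.reachable.trans (ih ⟨n, hns⟩ b (by simp only; omega))
    exact fun a b => key _ a b rfl
  · intro h
    have := h.nonempty
    refine ⟨?_, ?_⟩
    · obtain ⟨a⟩ := h.nonempty
      exact ⟨a, a.2⟩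
    · intro a ha b hb x hx
      by_contra hxs
      obtain ⟨p⟩ := h.preconnected ⟨a, ha⟩ ⟨b, hb⟩
      exact not_geod_of_walk hT (s := (s : Set V)) hxs p hx

/-- The neighbours of `x` in `s`. -/
noncomputable def nb (T : SimpleGraph V) (s : Finset V) (x : V) : Finset V :=
  {y ∈ s | T.Adj x y}

/-- The neighbours of `x` in `s` that are leaves of `s`. -/
noncomputable def Lf (T : SimpleGraph V) (s : Finset V) (x : V) : Finset V :=
  {y ∈ nb T s x | (nb T s y).card = 1}

/-- The neighbours of `x` in `s` that are not leaves of `s`. -/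
noncomputable def Nl (T : SimpleGraph V) (s : Finset V) (x : V) : Finset V :=
  {y ∈ nb T s x | (nb T s y).card ≠ 1}

/-- The internal vertices of `s`. -/
noncomputable def Intr (T : SimpleGraph V) (s : Finset V) : Finset V :=
  {y ∈ s | (nb T s y).card ≠ 1}

/-- The vertices of `s` that `m` separates from `v`, together with `m`. -/
noncomputable def beh (T : SimpleGraph V) (s : Finset V) (v m : V) : Finset V :=
  {b ∈ s | Geod T v m b}

/-- The sizes of the non-trivial branches of `s` rooted at `v`. -/
noncomputable def Sz (T : SimpleGraph V) (s : Finset V) (v : V) : Multiset ℕ :=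
  (Nl T s v).val.map fun n => (beh T s v n).card

/-- The roots of the forks of order `q` at `v`. -/
noncomputable def Fk (T : SimpleGraph V) (s : Finset V) (v : V) (q : ℕ) : Finset V :=
  {u ∈ Nl T s v | (Lf T s u).card = q ∧ (Nl T s u).card = 1}

/-- The vertices of `s` with at least two non-leaf neighbours. -/
noncomputable def Jn (T : SimpleGraph V) (s : Finset V) : Finset V :=
  {y ∈ s | 2 ≤ (Nl T s y).card}

/-- The sum of the degrees of the vertices with at least two non-leaf neighbours. -/
noncomputable def Om (T : SimpleGraph V) (s : Finset V) : ℕ :=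
  ∑ y ∈ Jn T s, (nb T s y).card

lemma mem_nb {s : Finset V} {x y : V} : y ∈ nb T s x ↔ y ∈ s ∧ T.Adj x y := by simp [nb]

lemma mem_Lf {s : Finset V} {x y : V} :
    y ∈ Lf T s x ↔ (y ∈ s ∧ T.Adj x y) ∧ (nb T s y).card = 1 := by
  rw [Lf, Finset.mem_filter, mem_nb]

lemma mem_Nl {s : Finset V} {x y : V} :
    y ∈ Nl T s x ↔ (y ∈ s ∧ T.Adj x y) ∧ (nb T s y).card ≠ 1 := by
  rw [Nl, Finset.mem_filter, mem_nb]

lemma mem_beh {s : Finset V} {v m b : V} : b ∈ beh T s v m ↔ b ∈ s ∧ Geod T v m b := by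
  simp [beh]

lemma card_Lf_add_card_Nl (s : Finset V) (x : V) :
    (Lf T s x).card + (Nl T s x).card = (nb T s x).card :=
  Finset.card_filter_add_card_filter_not _

lemma not_geod_of_adj_ne (hT : T.IsTree) {a m b : V} (h : T.Adj a b) (h1 : m ≠ a) (h2 : m ≠ b) :
    ¬ Geod T a m b := by
  intro h'
  rcases eq_or_eq_of_geod_adj hT h h' with h3 | h3
  · exact h1 h3
  · exact h2 h3

lemma not_geod_self (hT : T.IsTree) {a m : V} (h : m ≠ a) : ¬ Geod T a m a := by
  intro h'
  unfold Geod at h'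
  rw [T.dist_self] at h'
  exact h (hT.1.dist_eq_zero_iff.1 (by omega)).symm

lemma Conv.eq_of_adj (hT : T.IsTree) {g : Finset V} (hg : Conv T g) {w y l : V} (hw : w ∈ g)
    (hy : y ∈ g) (hl : l ∉ g) (h : T.Adj w l) (h' : T.Adj y l) : y = w := by
  by_contra hne
  apply hl
  refine hg.2 w hw y hy l ?_
  unfold Geod
  rw [dist_adj_adj hT h h'.symm (fun h => hne h.symm), dist_eq_one_iff_adj.2 h,
    dist_eq_one_iff_adj.2 h'.symm]

/-- The vertex `l` can be attached to the subtree `g` as a leaf at `w`. -/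
structure Pend (T : SimpleGraph V) (g : Finset V) (w l : V) : Prop where
  conv : Conv T g
  mem : w ∈ g
  nmem : l ∉ g
  adj : T.Adj w l

namespace Pend

variable {g : Finset V} {w l : V}

lemma ne (h : Pend T g w l) : l ≠ w := fun h' => h.nmem (h' ▸ h.mem)

lemma conv_insert (hT : T.IsTree) (h : Pend T g w l) : Conv T (insert l g) := by
  refine ⟨⟨l, by simp⟩, ?_⟩
  have key : ∀ b ∈ g, ∀ x, Geod T l x b → x ∈ insert l g := by
    intro b hb x hx
    by_cases hxl : x = l
    · simp [hxl]
    by_cases hxw : x = w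
    · simp [hxw, h.mem]
    · rw [geod_comm, geod_adj_iff hT h.adj hxw hxl] at hx
      exact Finset.mem_insert_of_mem (h.conv.2 b hb w h.mem x hx)
  intro a ha b hb x hx
  rcases Finset.mem_insert.1 ha with rfl | ha' <;> rcases Finset.mem_insert.1 hb with rfl | hb'
  · by_contra hne
    exact not_geod_self hT (fun h' => hne (by simp [h'])) hx
  · exact key b hb' x hx
  · exact key a ha' x hx.symm
  · exact Finset.mem_insert_of_mem (h.conv.2 a ha' b hb' x hx)

lemma nb_new (hT : T.IsTree) (h : Pend T g w l) : nb T (insert l g) l = {w} := by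
  ext y
  simp only [mem_nb, Finset.mem_insert, Finset.mem_singleton]
  constructor
  · rintro ⟨rfl | hy, h'⟩
    · exact absurd h' (T.irrefl)
    · exact h.conv.eq_of_adj hT h.mem hy h.nmem h.adj h'.symm
  · rintro rfl
    exact ⟨Or.inr h.mem, h.adj.symm⟩

lemma nb_base (h : Pend T g w l) : nb T (insert l g) w = insert l (nb T g w) := by
  ext y
  simp only [mem_nb, Finset.mem_insert]
  constructor
  · rintro ⟨rfl | hy, h'⟩
    · exact Or.inl rfl
    · exact Or.inr ⟨hy, h'⟩
  · rintro (rfl | ⟨hy, h'⟩)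
    · exact ⟨Or.inl rfl, h.adj⟩
    · exact ⟨Or.inr hy, h'⟩

lemma card_nb_base (h : Pend T g w l) :
    (nb T (insert l g) w).card = (nb T g w).card + 1 := by
  rw [h.nb_base, Finset.card_insert_of_notMem]
  exact fun h' => h.nmem (mem_nb.1 h').1

lemma nb_other (hT : T.IsTree) (h : Pend T g w l) {y : V} (hy : y ∈ g) (hyw : y ≠ w) :
    nb T (insert l g) y = nb T g y := by
  ext z
  simp only [mem_nb, Finset.mem_insert]
  constructor
  · rintro ⟨rfl | hz, h'⟩
    · exact absurd (h.conv.eq_of_adj hT h.mem hy h.nmem h.adj h') hyw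
    · exact ⟨hz, h'⟩
  · rintro ⟨hz, h'⟩
    exact ⟨Or.inr hz, h'⟩

lemma card_nb_eq_one_iff (hT : T.IsTree) (h : Pend T g w l) (h2 : 2 ≤ (nb T g w).card) {y : V}
    (hy : y ∈ g) : (nb T (insert l g) y).card = 1 ↔ (nb T g y).card = 1 := by
  by_cases hyw : y = w
  · subst hyw
    rw [h.card_nb_base]
    omega
  · rw [h.nb_other hT hy hyw]

lemma Lf_base (hT : T.IsTree) (h : Pend T g w l) (h2 : 2 ≤ (nb T g w).card) :
    Lf T (insert l g) w = insert l (Lf T g w) := by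
  ext y
  simp only [mem_Lf, Finset.mem_insert]
  by_cases hyl : y = l
  · subst hyl
    simp [h.nb_new hT, h.adj]
  · simp only [hyl, false_or]
    refine and_congr_right fun h' => ?_
    exact h.card_nb_eq_one_iff hT h2 h'.1

lemma card_Lf_base (hT : T.IsTree) (h : Pend T g w l) (h2 : 2 ≤ (nb T g w).card) :
    (Lf T (insert l g) w).card = (Lf T g w).card + 1 := by
  rw [h.Lf_base hT h2, Finset.card_insert_of_notMem]
  exact fun h' => h.nmem (mem_Lf.1 h').1.1

lemma Lf_other (hT : T.IsTree) (h : Pend T g w l) (h2 : 2 ≤ (nb T g w).card) {y : V}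
    (hy : y ∈ g) (hyw : y ≠ w) : Lf T (insert l g) y = Lf T g y := by
  unfold Lf
  rw [h.nb_other hT hy hyw]
  refine Finset.filter_congr fun z hz => ?_
  exact h.card_nb_eq_one_iff hT h2 (mem_nb.1 hz).1

lemma Nl_old (hT : T.IsTree) (h : Pend T g w l) (h2 : 2 ≤ (nb T g w).card) {y : V} :
    Nl T (insert l g) y = Nl T g y := by
  ext z
  simp only [mem_Nl, Finset.mem_insert]
  by_cases hzl : z = l
  · subst hzl
    simp [h.nb_new hT, h.nmem]
  · simp only [hzl, false_or]
    refine and_congr_right fun h' => not_congr ?_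
    exact h.card_nb_eq_one_iff hT h2 h'.1

lemma card_Nl_new (hT : T.IsTree) (h : Pend T g w l) : (Nl T (insert l g) l).card ≤ 1 := by
  have := card_Lf_add_card_Nl (T := T) (insert l g) l
  rw [h.nb_new hT, Finset.card_singleton] at this
  omega

lemma Intr_eq (hT : T.IsTree) (h : Pend T g w l) (h2 : 2 ≤ (nb T g w).card) :
    Intr T (insert l g) = Intr T g := by
  ext y
  simp only [Intr, Finset.mem_filter, Finset.mem_insert]
  by_cases hyl : y = l
  · subst hyl
    simp [h.nb_new hT, h.nmem]
  · simp only [hyl, false_or]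
    exact and_congr_right fun h' => not_congr (h.card_nb_eq_one_iff hT h2 h')

lemma Jn_eq (hT : T.IsTree) (h : Pend T g w l) (h2 : 2 ≤ (nb T g w).card) :
    Jn T (insert l g) = Jn T g := by
  ext y
  simp only [Jn, Finset.mem_filter, Finset.mem_insert]
  by_cases hyl : y = l
  · subst hyl
    have := h.card_Nl_new hT
    simp only [true_or, true_and, h.nmem, false_and, iff_false]
    omega
  · simp only [hyl, false_or]
    refine and_congr_right fun h' => ?_
    rw [h.Nl_old hT h2]

lemma Om_eq (hT : T.IsTree) (h : Pend T g w l) (h2 : 2 ≤ (nb T g w).card) :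
    Om T (insert l g) = Om T g + if 2 ≤ (Nl T g w).card then 1 else 0 := by
  have hmem : w ∈ Jn T g ↔ 2 ≤ (Nl T g w).card := by simp [Jn, h.mem]
  unfold Om
  rw [h.Jn_eq hT h2]
  have : ∀ y ∈ Jn T g, (nb T (insert l g) y).card
      = (nb T g y).card + if y = w then 1 else 0 := by
    intro y hy
    by_cases hyw : y = w
    · subst hyw; simp [h.card_nb_base]
    · simp [hyw, h.nb_other hT (Finset.mem_filter.1 hy).1 hyw]
  rw [Finset.sum_congr rfl this, Finset.sum_add_distrib, Finset.sum_ite_eq', ]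
  simp only [hmem]

lemma beh_eq (hT : T.IsTree) (h : Pend T g w l) {v m : V} (hm : m ∈ g) (hmw : m ≠ w)
    (hv : ¬ Geod T v m w) : beh T (insert l g) v m = beh T g v m := by
  ext b
  simp only [mem_beh, Finset.mem_insert]
  by_cases hbl : b = l
  · subst hbl
    have hml : m ≠ b := fun h' => h.nmem (h' ▸ hm)
    simp [h.nmem, geod_adj_iff hT h.adj hmw hml, hv]
  · simp [hbl]

lemma card_beh_base (h : Pend T g w l) {v : V} (hv : Geod T v w l) :
    (beh T (insert l g) v w).card = (beh T g v w).card + 1 := by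
  have : beh T (insert l g) v w = insert l (beh T g v w) := by
    ext b
    simp only [mem_beh, Finset.mem_insert]
    by_cases hbl : b = l
    · subst hbl; simp [hv]
    · simp [hbl]
  rw [this, Finset.card_insert_of_notMem]
  exact fun h' => h.nmem (mem_beh.1 h').1

end Pend

/-- Removing a leaf from a subtree gives a subtree. -/
lemma pend_erase (hT : T.IsTree) {s : Finset V} (hs : Conv T s) {w l : V} (hw : w ∈ s)
    (hl : l ∈ Lf T s w) : Pend T (s.erase l) w l := by
  obtain ⟨⟨hls, hadj⟩, hc⟩ := mem_Lf.1 hl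
  have hwl : w ≠ l := hadj.ne
  refine ⟨⟨⟨w, by simp [hw, hwl]⟩, ?_⟩, by simp [hw, hwl], by simp, hadj⟩
  intro a ha b hb x hx
  obtain ⟨hal, has⟩ := Finset.mem_erase.1 ha
  obtain ⟨hbl, hbs⟩ := Finset.mem_erase.1 hb
  refine Finset.mem_erase.2 ⟨?_, hs.2 a has b hbs x hx⟩
  rintro rfl
  obtain ⟨n, hn, hna⟩ := exists_adj_dist_succ hT (Ne.symm hal)
  obtain ⟨n', hn', hnb⟩ := exists_adj_dist_succ hT (Ne.symm hbl)
  have h1 : n ∈ nb T s x :=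
    mem_nb.2 ⟨hs.2 x hls a has n ((geod_of_adj_iff hn).2 hna), hn⟩
  have h2 : n' ∈ nb T s x :=
    mem_nb.2 ⟨hs.2 x hls b hbs n' ((geod_of_adj_iff hn').2 hnb), hn'⟩
  have : n = n' := Finset.card_le_one.1 hc.le _ h1 _ h2
  subst this
  exact not_geod_of_adj hT hna hnb hx

end Stats

section Mult

open scoped Classical

variable {V : Type*} {T : SimpleGraph V}

/-- The internal vertex `v` of the subtree `g` has non-trivial branches of the sizes in `X`, and
from `v` every vertex with three non-trivial branches has at most `k / 2` vertices behind it. -/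
structure Cfg (T : SimpleGraph V) (k : ℕ) (X : Multiset ℕ) (g : Finset V) (v : V) : Prop where
  conv : Conv T g
  mem : v ∈ g
  int : 2 ≤ (nb T g v).card
  sz : Sz T g v = X
  hub : ∀ m ∈ g, m ≠ v → 3 ≤ (Nl T g m).card → 2 * (beh T g v m).card ≤ k

lemma exists_mem_Nl_toward (hT : T.IsTree) {g : Finset V} (hg : Conv T g) {m v : V}
    (hm : m ∈ g) (hv : v ∈ g) (hne : m ≠ v) (h2 : 2 ≤ (nb T g v).card) :
    ∃ n ∈ Nl T g m, T.dist n v + 1 = T.dist m v := by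
  obtain ⟨n, hn, hd⟩ := exists_adj_dist_succ hT hne
  have hng : n ∈ g := hg.2 m hm v hv n ((geod_of_adj_iff hn).2 hd)
  refine ⟨n, mem_Nl.2 ⟨⟨hng, hn⟩, ?_⟩, hd⟩
  by_cases hnv : n = v
  · rw [hnv]; omega
  obtain ⟨n', hn', hd'⟩ := exists_adj_dist_succ hT hnv
  have hng' : n' ∈ g := hg.2 n hng v hv n' ((geod_of_adj_iff hn').2 hd')
  have hmn' : m ≠ n' := by rintro rfl; omega
  have h3 : ({m, n'} : Finset V) ⊆ nb T g n := by
    intro z hz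
    simp only [Finset.mem_insert, Finset.mem_singleton] at hz
    rcases hz with rfl | rfl
    · exact mem_nb.2 ⟨hm, hn.symm⟩
    · exact mem_nb.2 ⟨hng', hn'⟩
  have := Finset.card_le_card h3
  rw [Finset.card_pair hmn'] at this
  omega

/-- The vertices of `g` that `m` does not separate from `v`. -/
noncomputable def side (T : SimpleGraph V) (g : Finset V) (v m : V) : Finset V :=
  {b ∈ g | ¬ Geod T v m b}

lemma card_beh_add_card_side (g : Finset V) (v m : V) :
    (beh T g v m).card + (side T g v m).card = g.card :=
  Finset.card_filter_add_card_filter_not _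

lemma mem_side {g : Finset V} {v m b : V} : b ∈ side T g v m ↔ b ∈ g ∧ ¬ Geod T v m b := by
  simp [side]

lemma disjoint_side (hT : T.IsTree) {g : Finset V} {v v' m : V} (h : Geod T v m v') :
    Disjoint (side T g v m) (side T g v' m) := by
  rw [Finset.disjoint_left]
  intro b hb hb'
  exact not_geod_trans hT (mem_side.1 hb).2 (fun h' => (mem_side.1 hb').2 h'.symm) h

lemma card_beh_lt (hT : T.IsTree) {g : Finset V} {v₁ v₂ v₃ n' n₃ : V}
    (h₂ : v₂ ∈ g) (hbt : Geod T v₁ v₂ v₃) (hn₃ : T.Adj v₂ n₃)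
    (hd₃ : T.dist n₃ v₃ + 1 = T.dist v₂ v₃) (hn' : T.Adj v₁ n')
    (hd' : T.dist n' v₂ + 1 = T.dist v₁ v₂) :
    (beh T g v₂ n₃).card < (beh T g v₁ n').card := by
  have hn'2 : Geod T v₁ n' v₂ := (geod_of_adj_iff hn').2 hd'
  have hmem : v₂ ∉ beh T g v₂ n₃ := fun h =>
    not_geod_self hT hn₃.ne' (mem_beh.1 h).2
  have hsub : insert v₂ (beh T g v₂ n₃) ⊆ beh T g v₁ n' := by
    intro b hb
    rcases Finset.mem_insert.1 hb with rfl | hb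
    · exact mem_beh.2 ⟨h₂, hn'2⟩
    obtain ⟨hbg, hb⟩ := mem_beh.1 hb
    refine mem_beh.2 ⟨hbg, ?_⟩
    have hb' := (geod_of_adj_iff hn₃).1 hb
    have h3 : Geod T v₁ v₂ b := by
      by_contra hcon
      obtain ⟨z, hz, hz1, hz2⟩ := exists_adj_of_not_geod hT hcon
      have : z = n₃ := adj_dist_succ_unique hT hz hn₃ hz2 hb'
      subst this
      exact not_geod_of_adj hT hz1 hd₃ hbt
    have h4 := hT.1.dist_triangle (u := n') (v := v₂) (w := b)
    have h5 := hT.1.dist_triangle (u := v₁) (v := n') (w := b)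
    unfold Geod at *
    omega
  have := Finset.card_le_card hsub
  rw [Finset.card_insert_of_notMem hmem] at this
  omega

lemma Cfg.false_of_geod (hT : T.IsTree) {k : ℕ} {X : Multiset ℕ} {g : Finset V}
    (hk : k ≤ g.card + 2) {v₁ v₂ v₃ : V} (h₁ : Cfg T k X g v₁) (h₂ : Cfg T k X g v₂)
    (h₃ : Cfg T k X g v₃) (h12 : v₂ ≠ v₁) (h23 : v₂ ≠ v₃) (hbt : Geod T v₁ v₂ v₃) : False := by
  obtain ⟨n₁, hn₁, hd₁⟩ := exists_mem_Nl_toward hT h₁.conv h₂.mem h₁.mem h12 h₁.int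
  obtain ⟨n₃, hn₃, hd₃⟩ := exists_mem_Nl_toward hT h₁.conv h₂.mem h₃.mem h23 h₃.int
  have hne : n₁ ≠ n₃ := by
    rintro rfl
    exact not_geod_of_adj hT hd₁ hd₃ hbt
  obtain ⟨⟨hn₁g, hn₁a⟩, hn₁c⟩ := mem_Nl.1 hn₁
  obtain ⟨⟨hn₃g, hn₃a⟩, hn₃c⟩ := mem_Nl.1 hn₃
  have hsub : ({n₁, n₃} : Finset V) ⊆ Nl T g v₂ := by
    intro z hz
    simp only [Finset.mem_insert, Finset.mem_singleton] at hz
    rcases hz with rfl | rfl <;> assumption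
  by_cases hc : 3 ≤ (Nl T g v₂).card
  · have a1 := h₁.hub v₂ h₂.mem h12 hc
    have a3 := h₃.hub v₂ h₂.mem h23 hc
    have b1 := card_beh_add_card_side (T := T) g v₁ v₂
    have b3 := card_beh_add_card_side (T := T) g v₃ v₂
    obtain ⟨n, hn, hnn⟩ : ∃ n ∈ Nl T g v₂, n ∉ ({n₁, n₃} : Finset V) := by
      by_contra! hcon
      have := Finset.card_le_card (show Nl T g v₂ ⊆ {n₁, n₃} from hcon)
      rw [Finset.card_pair hne] at this
      omega
    simp only [Finset.mem_insert, Finset.mem_singleton, not_or] at hnn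
    obtain ⟨⟨hng, hna⟩, hnc⟩ := mem_Nl.1 hn
    have hv2n : v₂ ∈ nb T g n := mem_nb.2 ⟨h₂.mem, hna.symm⟩
    obtain ⟨z, hz, hzv⟩ : ∃ z ∈ nb T g n, z ≠ v₂ := by
      by_contra! hcon
      apply hnc
      rw [Finset.card_eq_one]
      exact ⟨v₂, Finset.eq_singleton_iff_unique_mem.2 ⟨hv2n, hcon⟩⟩
    obtain ⟨hzg, hza⟩ := mem_nb.1 hz
    have hdn : T.dist n n + 1 = T.dist v₂ n := by
      rw [dist_self, dist_eq_one_iff_adj.2 hna]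
    have hdz : T.dist n z + 1 = T.dist v₂ z := by
      rw [dist_adj_adj hT hna hza (Ne.symm hzv), dist_eq_one_iff_adj.2 hza]
    have key : ∀ v n' : V, T.Adj v₂ n' → T.dist n' v + 1 = T.dist v₂ v → n' ≠ n →
        v₂ ∉ side T g v v₂ ∧ n ∉ side T g v v₂ ∧ z ∉ side T g v v₂ := by
      intro v n' hn' hd' hne'
      refine ⟨fun h => (mem_side.1 h).2 (geod_right _ _), fun h => ?_, fun h => ?_⟩
      · exact (mem_side.1 h).2 (geod_of_adj_ne hT hn' hna hne' hd' hdn)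
      · exact (mem_side.1 h).2 (geod_of_adj_ne hT hn' hna hne' hd' hdz)
    obtain ⟨p1, p2, p3⟩ := key v₁ n₁ hn₁a hd₁ (Ne.symm hnn.1)
    obtain ⟨q1, q2, q3⟩ := key v₃ n₃ hn₃a hd₃ (Ne.symm hnn.2)
    have hdisj := disjoint_side hT (g := g) hbt
    have hsub2 : side T g v₁ v₂ ∪ side T g v₃ v₂ ∪ {v₂, n, z} ⊆ g := by
      intro x hx
      simp only [Finset.mem_union, Finset.mem_insert, Finset.mem_singleton] at hx
      rcases hx with (hx | hx) | rfl | rfl | rfl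
      · exact (mem_side.1 hx).1
      · exact (mem_side.1 hx).1
      · exact h₂.mem
      · exact hng
      · exact hzg
    have hcard := Finset.card_le_card hsub2
    rw [Finset.card_union_of_disjoint, Finset.card_union_of_disjoint hdisj,
      Finset.card_eq_three.2 ⟨v₂, n, z, hna.ne, hzv.symm, hza.ne, rfl⟩] at hcard
    · omega
    · rw [Finset.disjoint_right]
      intro x hx
      simp only [Finset.mem_insert, Finset.mem_singleton] at hx
      rw [Finset.mem_union]
      rcases hx with rfl | rfl | rfl <;> tauto
  · have heq : Nl T g v₂ = {n₁, n₃} := by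
      refine (Finset.eq_of_subset_of_card_le hsub ?_).symm
      rw [Finset.card_pair hne]
      omega
    have hX : X = {(beh T g v₂ n₁).card, (beh T g v₂ n₃).card} := by
      rw [← h₂.sz, Sz, heq, Finset.insert_val_of_notMem (by simpa using hne)]
      simp
    obtain ⟨m₁, hm₁, hl₁⟩ :=
      exists_mem_Nl_toward hT h₁.conv h₁.mem h₂.mem (Ne.symm h12) h₂.int
    obtain ⟨m₃, hm₃, hl₃⟩ :=
      exists_mem_Nl_toward hT h₁.conv h₃.mem h₂.mem (Ne.symm h23) h₂.int
    have c1 := card_beh_lt hT h₂.mem hbt hn₃a hd₃ (mem_Nl.1 hm₁).1.2 hl₁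
    have c3 := card_beh_lt hT h₂.mem hbt.symm hn₁a hd₁ (mem_Nl.1 hm₃).1.2 hl₃
    have e1 : (beh T g v₁ m₁).card ∈ X := by
      rw [← h₁.sz, Sz]
      exact Multiset.mem_map_of_mem _ hm₁
    have e3 : (beh T g v₃ m₃).card ∈ X := by
      rw [← h₃.sz, Sz]
      exact Multiset.mem_map_of_mem _ hm₃
    rw [hX] at e1 e3
    simp only [Multiset.insert_eq_cons, Multiset.mem_cons, Multiset.mem_singleton] at e1 e3
    omega

lemma Cfg.false_of_three (hT : T.IsTree) {k : ℕ} {X : Multiset ℕ} {g : Finset V}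
    (hk : k ≤ g.card + 2) (hg5 : 5 ≤ g.card) {v₁ v₂ v₃ : V} (h₁ : Cfg T k X g v₁)
    (h₂ : Cfg T k X g v₂) (h₃ : Cfg T k X g v₃) (h12 : v₁ ≠ v₂) (h13 : v₁ ≠ v₃) (h23 : v₂ ≠ v₃) :
    False := by
  obtain ⟨m, hm, hmin⟩ := Finset.exists_min_image g
    (fun m => T.dist m v₁ + T.dist m v₂ + T.dist m v₃) ⟨v₁, h₁.mem⟩
  have hg := h₁.conv
  have hclose : ∀ n v, T.Adj m n → v ∈ g → T.dist n v + 1 = T.dist m v → n ∈ g :=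
    fun n v hn hv hd => hg.2 m hm v hv n ((geod_of_adj_iff hn).2 hd)
  have g12 : Geod T v₁ m v₂ := by
    by_contra hcon
    obtain ⟨n, hn, ha, hb⟩ := exists_adj_of_not_geod hT hcon
    have := hmin n (hclose n v₁ hn h₁.mem ha)
    have := dist_adj_cases hT hn v₃
    omega
  have g13 : Geod T v₁ m v₃ := by
    by_contra hcon
    obtain ⟨n, hn, ha, hb⟩ := exists_adj_of_not_geod hT hcon
    have := hmin n (hclose n v₁ hn h₁.mem ha)
    have := dist_adj_cases hT hn v₂
    omega
  have g23 : Geod T v₂ m v₃ := by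
    by_contra hcon
    obtain ⟨n, hn, ha, hb⟩ := exists_adj_of_not_geod hT hcon
    have := hmin n (hclose n v₂ hn h₂.mem ha)
    have := dist_adj_cases hT hn v₁
    omega
  by_cases e1 : m = v₁
  · subst e1
    exact Cfg.false_of_geod hT hk h₂ h₁ h₃ h12 h13 g23
  by_cases e2 : m = v₂
  · subst e2
    exact Cfg.false_of_geod hT hk h₁ h₂ h₃ e1 h23 g13
  by_cases e3 : m = v₃
  · subst e3
    exact Cfg.false_of_geod hT hk h₁ h₃ h₂ e1 e2 g12
  obtain ⟨n₁, hn₁, hd₁⟩ := exists_mem_Nl_toward hT hg hm h₁.mem e1 h₁.int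
  obtain ⟨n₂, hn₂, hd₂⟩ := exists_mem_Nl_toward hT hg hm h₂.mem e2 h₂.int
  obtain ⟨n₃, hn₃, hd₃⟩ := exists_mem_Nl_toward hT hg hm h₃.mem e3 h₃.int
  have ne12 : n₁ ≠ n₂ := by rintro rfl; exact not_geod_of_adj hT hd₁ hd₂ g12
  have ne13 : n₁ ≠ n₃ := by rintro rfl; exact not_geod_of_adj hT hd₁ hd₃ g13
  have ne23 : n₂ ≠ n₃ := by rintro rfl; exact not_geod_of_adj hT hd₂ hd₃ g23
  have hc : 3 ≤ (Nl T g m).card := by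
    rw [← Finset.card_eq_three.2 ⟨n₁, n₂, n₃, ne12, ne13, ne23, rfl⟩]
    refine Finset.card_le_card fun z hz => ?_
    simp only [Finset.mem_insert, Finset.mem_singleton] at hz
    rcases hz with rfl | rfl | rfl <;> assumption
  have a1 := h₁.hub m hm e1 hc
  have a2 := h₂.hub m hm e2 hc
  have a3 := h₃.hub m hm e3 hc
  have b1 := card_beh_add_card_side (T := T) g v₁ m
  have b2 := card_beh_add_card_side (T := T) g v₂ m
  have b3 := card_beh_add_card_side (T := T) g v₃ m
  have hsub : side T g v₁ m ∪ side T g v₂ m ∪ side T g v₃ m ⊆ g.erase m := by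
    intro x hx
    have : ∀ v, x ∈ side T g v m → x ∈ g.erase m := by
      intro v hv
      obtain ⟨hx, hv⟩ := mem_side.1 hv
      refine Finset.mem_erase.2 ⟨?_, hx⟩
      rintro rfl
      exact hv (geod_right _ _)
    simp only [Finset.mem_union] at hx
    rcases hx with (hx | hx) | hx <;> exact this _ hx
  have hcard := Finset.card_le_card hsub
  rw [Finset.card_union_of_disjoint, Finset.card_union_of_disjoint (disjoint_side hT g12),
    Finset.card_erase_of_mem hm] at hcard
  · omega
  · rw [Finset.disjoint_union_left]
    exact ⟨disjoint_side hT g13, disjoint_side hT g23⟩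

lemma card_filter_cfg_le_two [Fintype V] (hT : T.IsTree) {k : ℕ} {X : Multiset ℕ} {g : Finset V}
    (hk : k ≤ g.card + 2) (hg5 : 5 ≤ g.card) :
    (Finset.univ.filter fun v => Cfg T k X g v).card ≤ 2 := by
  by_contra hcon
  obtain ⟨v₁, v₂, v₃, h1, h2, h3, h12, h13, h23⟩ :=
    Finset.two_lt_card_iff.1 (not_le.1 hcon)
  simp only [Finset.mem_filter, Finset.mem_univ, true_and] at h1 h2 h3
  exact Cfg.false_of_three hT hk hg5 h1 h2 h3 h12 h13 h23

end Mult

section States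

open scoped Classical

variable {V : Type*} {T : SimpleGraph V}

lemma mem_Fk {s : Finset V} {v u : V} {q : ℕ} :
    u ∈ Fk T s v q ↔ u ∈ Nl T s v ∧ (Lf T s u).card = q ∧ (Nl T s u).card = 1 := by
  simp [Fk]

lemma notMem_Nl_self {s : Finset V} {v : V} : v ∉ Nl T s v := fun h =>
  T.irrefl (mem_Nl.1 h).1.2

lemma Pend.beh_same (hT : T.IsTree) {g : Finset V} {w l v m : V} (h : Pend T g w l)
    (hw : w = v ∨ T.Adj v w) (hm : m ∈ g) (hmv : m ≠ v) (hmw : m ≠ w) :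
    beh T (insert l g) v m = beh T g v m := by
  refine h.beh_eq hT hm hmw ?_
  rcases hw with rfl | hw
  · exact not_geod_self hT hmv
  · exact not_geod_of_adj_ne hT hw hmv hmw

lemma Pend.mem_Fk_iff (hT : T.IsTree) {g : Finset V} {w l v z : V} {j : ℕ} (h : Pend T g w l)
    (h2 : 2 ≤ (nb T g w).card) (hz : z ≠ w) :
    z ∈ Fk T (insert l g) v j ↔ z ∈ Fk T g v j := by
  rw [mem_Fk, mem_Fk, h.Nl_old hT h2]
  refine and_congr_right fun h' => ?_
  rw [h.Lf_other hT h2 (mem_Nl.1 h').1.1 hz, h.Nl_old hT h2]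

lemma Pend.hub_iff (hT : T.IsTree) {k : ℕ} {g : Finset V} {w l v : V} (h : Pend T g w l)
    (h2 : 2 ≤ (nb T g w).card) (hw : w = v ∨ T.Adj v w)
    (hw' : w = v ∨ (Nl T g w).card < 3) :
    (∀ m ∈ insert l g, m ≠ v → 3 ≤ (Nl T (insert l g) m).card →
      2 * (beh T (insert l g) v m).card ≤ k) ↔
    ∀ m ∈ g, m ≠ v → 3 ≤ (Nl T g m).card → 2 * (beh T g v m).card ≤ k := by
  constructor
  · intro H m hm hmv hm3
    have hmw : m ≠ w := by
      rintro rfl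
      rcases hw' with h' | h'
      · exact hmv h'
      · omega
    have := H m (Finset.mem_insert_of_mem hm) hmv (by rwa [h.Nl_old hT h2])
    rwa [h.beh_same hT hw hm hmv hmw] at this
  · intro H m hm hmv hm3
    rcases Finset.mem_insert.1 hm with rfl | hm
    · have := h.card_Nl_new hT
      omega
    rw [h.Nl_old hT h2] at hm3
    have hmw : m ≠ w := by
      rintro rfl
      rcases hw' with h' | h'
      · exact hmv h'
      · omega
    rw [h.beh_same hT hw hm hmv hmw]
    exact H m hm hmv hm3

lemma Pend.cfg_iff (hT : T.IsTree) {k : ℕ} {X : Multiset ℕ} {g : Finset V} {l v : V}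
    (h : Pend T g v l) (h2 : 2 ≤ (nb T g v).card) :
    Cfg T k X (insert l g) v ↔ Cfg T k X g v := by
  have hsz : Sz T (insert l g) v = Sz T g v := by
    unfold Sz
    rw [h.Nl_old hT h2]
    refine Multiset.map_congr rfl fun n hn => ?_
    have hn := mem_Nl.1 hn
    rw [h.beh_same hT (Or.inl rfl) hn.1.1 hn.1.2.ne' hn.1.2.ne']
  have hhub := h.hub_iff hT (k := k) h2 (Or.inl rfl) (Or.inl rfl)
  constructor
  · rintro ⟨-, -, -, h3, h4⟩
    exact ⟨h.conv, h.mem, h2, by rw [← hsz, h3], hhub.1 h4⟩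
  · rintro ⟨-, -, -, h3, h4⟩
    exact ⟨h.conv_insert hT, Finset.mem_insert_of_mem h.mem, by rw [h.card_nb_base]; omega,
      by rw [hsz, h3], hhub.2 h4⟩

/-- The part of the state of a fork `u` at `v` that does not depend on the leaves at `u`, `v`. -/
structure Frame (T : SimpleGraph V) (k : ℕ) (X : Multiset ℕ) (F ι : ℕ) (g : Finset V)
    (v u : V) : Prop where
  memu : u ∈ Nl T g v
  nlu : (Nl T g u).card = 1
  rest : ((Nl T g v).erase u).val.map (fun n => (beh T g v n).card) = X
  hub : ∀ m ∈ g, m ≠ v → 3 ≤ (Nl T g m).card → 2 * (beh T g v m).card ≤ k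
  fk : ∀ j, ((Fk T g v j).erase u).card ≤ F
  intr : (Intr T g).card = ι

lemma Pend.frame_iff (hT : T.IsTree) {k : ℕ} {X : Multiset ℕ} {F ι : ℕ} {g : Finset V}
    {w l v u : V} (h : Pend T g w l) (h2 : 2 ≤ (nb T g w).card) (hw : w = v ∨ w = u)  :
    Frame T k X F ι (insert l g) v u ↔ Frame T k X F ι g v u := by
  have hnl : ∀ y, Nl T (insert l g) y = Nl T g y := fun y => h.Nl_old hT h2
  by_cases hvu : u ∈ Nl T g v
  swap
  · exact iff_of_false (fun h' => hvu (by rw [← hnl]; exact h'.memu)) (fun h' => hvu h'.memu)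
  have hadj := (mem_Nl.1 hvu).1.2
  have hw1 : w = v ∨ T.Adj v w := by
    rcases hw with rfl | rfl
    · exact Or.inl rfl
    · exact Or.inr hadj
  have hrest : ((Nl T (insert l g) v).erase u).val.map (fun n => (beh T (insert l g) v n).card)
      = ((Nl T g v).erase u).val.map (fun n => (beh T g v n).card) := by
    rw [hnl]
    refine Multiset.map_congr rfl fun n hn => ?_
    obtain ⟨hnu, hn⟩ := Finset.mem_erase.1 hn
    have hn := mem_Nl.1 hn
    rw [h.beh_same hT hw1 hn.1.1 hn.1.2.ne' ?_]
    rcases hw with rfl | rfl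
    · exact hn.1.2.ne'
    · exact hnu
  have hfk : ∀ j, (Fk T (insert l g) v j).erase u = (Fk T g v j).erase u := by
    intro j
    ext z
    simp only [Finset.mem_erase]
    refine and_congr_right fun hzu => ?_
    by_cases hzw : z = w
    · rcases hw with rfl | rfl
      · subst hzw
        simp [mem_Fk, notMem_Nl_self]
      · exact absurd hzw hzu
    · exact h.mem_Fk_iff hT h2 hzw
  have hhub : (Nl T g u).card = 1 → _ := fun h1 => h.hub_iff hT (k := k) h2 hw1
    (hw.imp id (fun h' => by rw [h']; omega))
  constructor
  · rintro ⟨-, a2, a3, a4, a5, a6⟩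
    rw [hnl] at a2
    exact ⟨hvu, a2, hrest ▸ a3, (hhub a2).1 a4, fun j => hfk j ▸ a5 j, h.Intr_eq hT h2 ▸ a6⟩
  · rintro ⟨-, a2, a3, a4, a5, a6⟩
    exact ⟨hnl v ▸ hvu, hnl u ▸ a2, hrest ▸ a3, (hhub a2).2 a4, fun j => hfk j ▸ a5 j,
      h.Intr_eq hT h2 ▸ a6⟩

lemma Frame.card_Nl {k : ℕ} {X : Multiset ℕ} {F ι : ℕ} {g : Finset V} {v u : V}
    (h : Frame T k X F ι g v u) : (Nl T g v).card = X.card + 1 := by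
  rw [← h.rest, Multiset.card_map, ← Finset.card_def, Finset.card_erase_add_one h.memu]

lemma Frame.sz {k : ℕ} {X : Multiset ℕ} {F ι : ℕ} {g : Finset V} {v u : V}
    (h : Frame T k X F ι g v u) : Sz T g v = (beh T g v u).card ::ₘ X := by
  conv_lhs => rw [Sz, ← Finset.insert_erase h.memu]
  rw [Finset.insert_val_of_notMem (Finset.notMem_erase _ _), Multiset.map_cons, h.rest]

/-- The state of a fork `u` of order `q` at a vertex `v` adjacent to `p` leaves. -/
structure St (T : SimpleGraph V) (k : ℕ) (X : Multiset ℕ) (F ι n ω p q : ℕ) (g : Finset V)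
    (v u : V) : Prop where
  conv : Conv T g
  mem : v ∈ g
  frame : Frame T k X F ι g v u
  lf : (Lf T g v).card = p
  lfu : (Lf T g u).card = q
  behu : (beh T g v u).card = q + 1
  card : g.card = n + p + q
  om : Om T g = ω + p

variable {k : ℕ} {X : Multiset ℕ} {F ι n ω p q : ℕ} {g s : Finset V} {v u l : V}

lemma St.nb_v (h : St T k X F ι n ω p q g v u) : (nb T g v).card = p + (X.card + 1) := by
  rw [← card_Lf_add_card_Nl, h.lf, h.frame.card_Nl]

lemma St.nb_u (h : St T k X F ι n ω p q g v u) : (nb T g u).card = q + 1 := by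
  rw [← card_Lf_add_card_Nl, h.lfu, h.frame.nlu]

lemma St.memu (h : St T k X F ι n ω p q g v u) : u ∈ g := (mem_Nl.1 h.frame.memu).1.1

lemma St.cfg (hX : X ≠ 0) (h : St T k X F ι n ω p q g v u) : Cfg T k ((q + 1) ::ₘ X) g v := by
  refine ⟨h.conv, h.mem, ?_, by rw [h.frame.sz, h.behu], h.frame.hub⟩
  have := Multiset.card_pos.2 hX
  rw [h.nb_v]
  omega

lemma Pend.st_v_iff (hT : T.IsTree) (hX : X ≠ 0) (hP : Pend T g v l)
    (h2 : 2 ≤ (nb T g v).card) :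
    St T k X F ι n ω (p + 1) q (insert l g) v u ↔ St T k X F ι n ω p q g v u := by
  have hXc := Multiset.card_pos.2 hX
  have hfr := hP.frame_iff hT h2 (k := k) (X := X) (F := F) (ι := ι) (u := u) (Or.inl rfl)
  have hom := hP.Om_eq hT h2
  have hc := Finset.card_insert_of_notMem hP.nmem
  have hb : u ∈ Nl T g v → beh T (insert l g) v u = beh T g v u := fun hu =>
    hP.beh_same hT (Or.inl rfl) (mem_Nl.1 hu).1.1 (mem_Nl.1 hu).1.2.ne' (mem_Nl.1 hu).1.2.ne'
  have hl : u ∈ Nl T g v → Lf T (insert l g) u = Lf T g u := fun hu =>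
    hP.Lf_other hT h2 (mem_Nl.1 hu).1.1 (mem_Nl.1 hu).1.2.ne'
  have hlv := hP.card_Lf_base hT h2
  constructor
  · rintro ⟨-, -, h3, h4, h5, h6, h7, h8⟩
    have h3 := hfr.1 h3
    have hn := h3.card_Nl
    rw [if_pos (by omega)] at hom
    refine ⟨hP.conv, hP.mem, h3, by omega, by rw [← hl h3.memu, h5], by rw [← hb h3.memu, h6],
      by omega, by omega⟩
  · rintro ⟨-, -, h3, h4, h5, h6, h7, h8⟩
    have hn := h3.card_Nl
    rw [if_pos (by omega)] at hom
    refine ⟨hP.conv_insert hT, Finset.mem_insert_of_mem hP.mem, hfr.2 h3, by omega,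
      by rw [hl h3.memu, h5], by rw [hb h3.memu, h6], by omega, by omega⟩

lemma Pend.st_u_iff (hT : T.IsTree) (hP : Pend T g u l) (hv : v ∈ g)
    (h2 : 2 ≤ (nb T g u).card) :
    St T k X F ι n ω p (q + 1) (insert l g) v u ↔ St T k X F ι n ω p q g v u := by
  have hfr := hP.frame_iff hT h2 (k := k) (X := X) (F := F) (ι := ι) (v := v) (Or.inr rfl)
  have hom := hP.Om_eq hT h2
  have hc := Finset.card_insert_of_notMem hP.nmem
  have hb : u ∈ Nl T g v → (beh T (insert l g) v u).card = (beh T g v u).card + 1 := by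
    intro hu
    have hadj := (mem_Nl.1 hu).1.2
    refine hP.card_beh_base ((geod_of_adj_iff hadj).2 ?_)
    have hvl : v ≠ l := fun h => hP.nmem (h ▸ hv)
    rw [dist_adj_adj hT hadj hP.adj hvl, dist_eq_one_iff_adj.2 hP.adj]
  have hl : u ∈ Nl T g v → Lf T (insert l g) v = Lf T g v := fun hu =>
    hP.Lf_other hT h2 hv (mem_Nl.1 hu).1.2.ne
  have hlu := hP.card_Lf_base hT h2
  constructor
  · rintro ⟨-, -, h3, h4, h5, h6, h7, h8⟩
    have h3 := hfr.1 h3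
    have hb := hb h3.memu
    rw [if_neg (by have := h3.nlu; omega)] at hom
    refine ⟨hP.conv, hv, h3, by rw [← hl h3.memu, h4], by omega, by omega,
      by omega, by omega⟩
  · rintro ⟨-, -, h3, h4, h5, h6, h7, h8⟩
    have hb := hb h3.memu
    rw [if_neg (by have := h3.nlu; omega)] at hom
    refine ⟨hP.conv_insert hT, Finset.mem_insert_of_mem hv, hfr.2 h3, by rw [hl h3.memu, h4],
      by omega, by omega, by omega, by omega⟩

lemma card_nb_erase (hT : T.IsTree) (hs : Conv T s) (hv : v ∈ s) (hl : l ∈ Lf T s v) :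
    (nb T (s.erase l) v).card + 1 = (nb T s v).card := by
  have hP := pend_erase hT hs hv hl
  rw [← hP.card_nb_base, Finset.insert_erase (mem_Lf.1 hl).1.1]

lemma St.insert_v (hT : T.IsTree) (hX : X ≠ 0) (h : St T k X F ι n ω p q g v u)
    (hl : T.Adj v l) (hlg : l ∉ g) : St T k X F ι n ω (p + 1) q (insert l g) v u := by
  have := Multiset.card_pos.2 hX
  exact (Pend.st_v_iff hT hX ⟨h.conv, h.mem, hlg, hl⟩ (by rw [h.nb_v]; omega)).2 h

lemma St.insert_u (hT : T.IsTree) (hq : 1 ≤ q) (h : St T k X F ι n ω p q g v u)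
    (hl : T.Adj u l) (hlg : l ∉ g) : St T k X F ι n ω p (q + 1) (insert l g) v u :=
  (Pend.st_u_iff hT ⟨h.conv, h.memu, hlg, hl⟩ h.mem (by rw [h.nb_u]; omega)).2 h

lemma St.erase_v (hT : T.IsTree) (hX : X ≠ 0) (h : St T k X F ι n ω (p + 1) q s v u)
    (hl : l ∈ Lf T s v) : St T k X F ι n ω p q (s.erase l) v u := by
  have := Multiset.card_pos.2 hX
  have h1 := card_nb_erase hT h.conv h.mem hl
  rw [h.nb_v] at h1
  refine (Pend.st_v_iff hT hX (pend_erase hT h.conv h.mem hl) (by omega)).1 ?_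
  rwa [Finset.insert_erase (mem_Lf.1 hl).1.1]

lemma St.erase_u (hT : T.IsTree) (hX : X ≠ 0) (hq : 1 ≤ q)
    (h : St T k X F ι n ω p (q + 1) s v u)
    (hl : l ∈ Lf T s u) : St T k X F ι n ω p q (s.erase l) v u := by
  have := Multiset.card_pos.2 hX
  have h1 := card_nb_erase hT h.conv h.memu hl
  rw [h.nb_u] at h1
  have hvl : v ≠ l := by
    rintro rfl
    have := (mem_Lf.1 hl).2
    rw [h.nb_v] at this
    omega
  refine (Pend.st_u_iff hT (pend_erase hT h.conv h.memu hl)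
    (Finset.mem_erase.2 ⟨hvl, h.mem⟩) (by omega)).1 ?_
  rwa [Finset.insert_erase (mem_Lf.1 hl).1.1]

end States

section Counting

open scoped Classical

variable {V : Type*} [Fintype V] {T : SimpleGraph V}

/-- The neighbours of `w` outside `g`. -/
noncomputable def free (T : SimpleGraph V) (g : Finset V) (w : V) : Finset V :=
  {z | T.Adj w z ∧ z ∉ g}

lemma mem_free {g : Finset V} {w z : V} : z ∈ free T g w ↔ T.Adj w z ∧ z ∉ g := by
  simp [free]

lemma card_free_add (g : Finset V) (w : V) :
    (free T g w).card + (nb T g w).card = (nb T Finset.univ w).card := by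
  rw [← Finset.card_union_of_disjoint]
  · congr 1
    ext z
    simp only [Finset.mem_union, mem_free, mem_nb, Finset.mem_univ, true_and]
    tauto
  · rw [Finset.disjoint_left]
    intro z hz hz'
    exact (mem_free.1 hz).2 (mem_nb.1 hz').1

lemma card_mul_le_of_erase {𝓢 𝓖 : Finset (Finset V)} {w : V} {c d : ℕ}
    (D : Finset V → Finset V)
    (hD : ∀ s ∈ 𝓢, D s ⊆ Lf T s w ∧ c ≤ (D s).card ∧ ∀ l ∈ D s, s.erase l ∈ 𝓖)
    (hd : ∀ g ∈ 𝓖, (free T g w).card ≤ d) : c * 𝓢.card ≤ d * 𝓖.card := by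
  rw [mul_comm c, mul_comm d]
  refine Finset.card_mul_le_card_mul (fun s g => ∃ l ∈ D s, s.erase l = g) ?_ ?_
  · intro s hs
    obtain ⟨h1, h2, h3⟩ := hD s hs
    refine h2.trans ?_
    have hinj : Set.InjOn (fun l => s.erase l) (D s : Set V) := by
      intro l hl l' hl' hll
      have hls := (mem_Lf.1 (h1 hl)).1.1
      have hls' := (mem_Lf.1 (h1 hl')).1.1
      exact Finset.erase_injOn s hls hls' hll
    rw [← Finset.card_image_of_injOn hinj]
    refine Finset.card_le_card fun g hg => ?_
    obtain ⟨l, hl, rfl⟩ := Finset.mem_image.1 hg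
    exact (Finset.mem_bipartiteAbove _).2 ⟨h3 l hl, l, hl, rfl⟩
  · intro g hg
    refine le_trans ?_ (hd g hg)
    refine le_trans (Finset.card_le_card ?_) (Finset.card_image_le (f := fun z => insert z g))
    intro s hs
    obtain ⟨hs', l, hl, rfl⟩ := (Finset.mem_bipartiteBelow _).1 hs
    have := mem_Lf.1 ((hD s hs').1 hl)
    exact Finset.mem_image.2 ⟨l, mem_free.2 ⟨this.1.2, by simp⟩, Finset.insert_erase this.1.1⟩

lemma card_mul_le_of_insert (hT : T.IsTree) {𝓢 𝓖 : Finset (Finset V)} {w : V} {c d : ℕ}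
    (hg : ∀ g ∈ 𝓖, Conv T g ∧ w ∈ g ∧ c ≤ (free T g w).card ∧
      ∀ l ∈ free T g w, insert l g ∈ 𝓢)
    (hd : ∀ s ∈ 𝓢, (Lf T s w).card ≤ d) : c * 𝓖.card ≤ d * 𝓢.card := by
  rw [mul_comm c, mul_comm d]
  refine Finset.card_mul_le_card_mul (fun g s => ∃ l ∈ free T g w, insert l g = s) ?_ ?_
  · intro g hg'
    obtain ⟨-, -, h2, h3⟩ := hg g hg'
    refine h2.trans ?_
    have hinj : Set.InjOn (fun l => insert l g) (free T g w : Set V) := by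
      intro l hl l' hl' hll
      by_contra hne
      have : l ∈ insert l' g := by rw [← show insert l g = insert l' g from hll]; simp
      rcases Finset.mem_insert.1 this with h | h
      · exact hne h
      · exact (mem_free.1 hl).2 h
    rw [← Finset.card_image_of_injOn hinj]
    refine Finset.card_le_card fun s hs => ?_
    obtain ⟨l, hl, rfl⟩ := Finset.mem_image.1 hs
    exact (Finset.mem_bipartiteAbove _).2 ⟨h3 l hl, l, hl, rfl⟩
  · intro s hs
    refine le_trans ?_ (hd s hs)
    refine le_trans (Finset.card_le_card ?_) (Finset.card_image_le (f := fun z => s.erase z))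
    intro g hg'
    obtain ⟨hg'', l, hl, rfl⟩ := (Finset.mem_bipartiteBelow _).1 hg'
    obtain ⟨hc, hw, -, -⟩ := hg g hg''
    obtain ⟨hl1, hl2⟩ := mem_free.1 hl
    have hP : Pend T g w l := ⟨hc, hw, hl2, hl1⟩
    refine Finset.mem_image.2 ⟨l, mem_Lf.2 ⟨⟨by simp, hl1⟩, ?_⟩, Finset.erase_insert hl2⟩
    rw [hP.nb_new hT, Finset.card_singleton]

lemma le_mul_of_two_steps {N G B c₁ d₁ c₂ d₂ K : ℕ} (h1 : c₁ * N ≤ d₁ * G)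
    (h2 : c₂ * G ≤ d₂ * B) (h3 : d₁ * d₂ ≤ K * (c₁ * c₂)) (h4 : 0 < c₁ * c₂) : N ≤ K * B := by
  refine Nat.le_of_mul_le_mul_left ?_ h4
  calc c₁ * c₂ * N = c₂ * (c₁ * N) := by ring
    _ ≤ c₂ * (d₁ * G) := Nat.mul_le_mul_left _ h1
    _ = d₁ * (c₂ * G) := by ring
    _ ≤ d₁ * (d₂ * B) := Nat.mul_le_mul_left _ h2
    _ = (d₁ * d₂) * B := by ring
    _ ≤ (K * (c₁ * c₂)) * B := Nat.mul_le_mul_right _ h3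
    _ = c₁ * c₂ * (K * B) := by ring

lemma le_mul_of_step {N G c d K : ℕ} (h1 : c * N ≤ d * G) (h3 : d ≤ K * c) (h4 : 0 < c) :
    N ≤ K * G := by
  refine Nat.le_of_mul_le_mul_left ?_ h4
  calc c * N ≤ d * G := h1
    _ ≤ (K * c) * G := Nat.mul_le_mul_right _ h3
    _ = c * (K * G) := by ring

lemma sum_card_filter_le {ι' α : Type*} [Fintype ι'] (𝓖 : Finset α) (P : ι' → α → Prop)
    (A : ι' → Finset α) (hA : ∀ i, ∀ g ∈ A i, g ∈ 𝓖 ∧ P i g) {m : ℕ}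
    (hm : ∀ g ∈ 𝓖, (Finset.univ.filter fun i => P i g).card ≤ m) :
    ∑ i, (A i).card ≤ m * 𝓖.card := by
  calc ∑ i, (A i).card ≤ ∑ i, (𝓖.filter fun g => P i g).card := by
        refine Finset.sum_le_sum fun i _ => Finset.card_le_card fun g hg => ?_
        exact Finset.mem_filter.2 (hA i g hg)
    _ = ∑ i, ∑ g ∈ 𝓖, if P i g then 1 else 0 := by simp only [Finset.card_filter]
    _ = ∑ g ∈ 𝓖, ∑ i, if P i g then 1 else 0 := Finset.sum_comm
    _ = ∑ g ∈ 𝓖, (Finset.univ.filter fun i => P i g).card := by simp only [Finset.card_filter]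
    _ ≤ ∑ g ∈ 𝓖, m := Finset.sum_le_sum hm
    _ = m * 𝓖.card := by simp [mul_comm]

end Counting

section Gates

open scoped Classical

variable {V : Type*} {T : SimpleGraph V}

/-- `y` is the vertex of `s` closest to `r`. -/
def Gate (T : SimpleGraph V) (s : Finset V) (r y : V) : Prop :=
  y ∈ s ∧ ∀ z ∈ s, T.dist y r ≤ T.dist z r

lemma exists_gate {s : Finset V} (hs : s.Nonempty) (r : V) : ∃ y, Gate T s r y :=
  Finset.exists_min_image s (fun z => T.dist z r) hs

lemma Gate.erase {s : Finset V} {r y l : V} (h : Gate T s r y) (hl : y ≠ l) :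
    Gate T (s.erase l) r y :=
  ⟨Finset.mem_erase.2 ⟨hl, h.1⟩, fun z hz => h.2 z (Finset.mem_erase.1 hz).2⟩

/-- `s'` arises from `s` by adding the next vertex on the path from `s` to `r`. -/
def Ext (T : SimpleGraph V) (r : V) (s s' : Finset V) : Prop :=
  ∃ y w, Gate T s r y ∧ T.Adj y w ∧ T.dist w r + 1 = T.dist y r ∧ s' = insert w s

lemma Ext.injective {r : V} {s₁ s₂ s' : Finset V} (h₁ : Ext T r s₁ s') (h₂ : Ext T r s₂ s') :
    s₁ = s₂ := by
  obtain ⟨y₁, w₁, g₁, a₁, d₁, e₁⟩ := h₁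
  obtain ⟨y₂, w₂, g₂, a₂, d₂, e₂⟩ := h₂
  have n₁ : w₁ ∉ s₁ := fun h => by have := g₁.2 _ h; omega
  have n₂ : w₂ ∉ s₂ := fun h => by have := g₂.2 _ h; omega
  have hw : w₁ = w₂ := by
    by_contra hne
    have m₁ : w₁ ∈ s₂ := by
      have : w₁ ∈ insert w₂ s₂ := by rw [← e₂, e₁]; simp
      exact (Finset.mem_insert.1 this).resolve_left hne
    have m₂ : w₂ ∈ s₁ := by
      have : w₂ ∈ insert w₁ s₁ := by rw [← e₁, e₂]; simp
      exact (Finset.mem_insert.1 this).resolve_left (Ne.symm hne)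
    have := g₁.2 _ m₂
    have := g₂.2 _ m₁
    omega
  subst hw
  rw [← Finset.erase_insert n₁, ← e₁, e₂, Finset.erase_insert n₂]

lemma card_le_of_relation {𝓖 𝓑 : Finset (Finset V)} (R : Finset V → Finset V → Prop)
    (hR : ∀ s₁ s₂ s', R s₁ s' → R s₂ s' → s₁ = s₂) (h : ∀ g ∈ 𝓖, ∃ s' ∈ 𝓑, R g s') :
    𝓖.card ≤ 𝓑.card := by
  refine Finset.card_le_card_of_forall_subsingleton R h ?_
  intro b _ x hx y hy
  exact hR _ _ _ hx.2 hy.2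

lemma card_nb_pos (hT : T.IsTree) {g : Finset V} (hg : Conv T g) (h2 : 2 ≤ g.card) {y : V}
    (hy : y ∈ g) : 1 ≤ (nb T g y).card := by
  obtain ⟨z, hz, hzy⟩ := Finset.exists_mem_ne (s := g) (by omega) y
  obtain ⟨n, hn, hd⟩ := exists_adj_dist_succ hT (Ne.symm hzy)
  exact Finset.card_pos.2 ⟨n, mem_nb.2 ⟨hg.2 y hy z hz n ((geod_of_adj_iff hn).2 hd), hn⟩⟩

lemma card_le_of_leaf_gate (hT : T.IsTree) {k ι : ℕ} {r : V} {𝓖 𝓑 : Finset (Finset V)}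
    (h𝓑 : ∀ s, Conv T s → s.card = k → (Intr T s).card ≠ ι → s ∈ 𝓑)
    (h𝓖 : ∀ g ∈ 𝓖, Conv T g ∧ g.card + 1 = k ∧ (Intr T g).card = ι ∧
      ∃ y, Gate T g r y ∧ 1 ≤ T.dist y r ∧ (nb T g y).card = 1) : 𝓖.card ≤ 𝓑.card := by
  refine card_le_of_relation (Ext T r) (fun _ _ _ => Ext.injective) fun g hg => ?_
  obtain ⟨hc, hk, hi, y, hy, hyr, hy1⟩ := h𝓖 g hg
  have hne : y ≠ r := by rintro rfl; rw [T.dist_self] at hyr; omega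
  obtain ⟨w, hw, hd⟩ := exists_adj_dist_succ hT hne
  have hwg : w ∉ g := fun h => by have := hy.2 _ h; omega
  have hP : Pend T g y w := ⟨hc, hy.1, hwg, hw⟩
  refine ⟨insert w g, h𝓑 _ (hP.conv_insert hT) ?_ ?_, y, w, hy, hw, hd, rfl⟩
  · rw [Finset.card_insert_of_notMem hwg, hk]
  · have hyi : y ∉ Intr T g := by simp [Intr, hy1]
    have hsub : insert y (Intr T g) ⊆ Intr T (insert w g) := by
      intro z hz
      rcases Finset.mem_insert.1 hz with rfl | hz
      · simp [Intr, hy.1, hP.card_nb_base, hy1]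
      · have hzy : z ≠ y := fun h => hyi (h ▸ hz)
        obtain ⟨hz1, hz2⟩ := Finset.mem_filter.1 hz
        exact Finset.mem_filter.2 ⟨Finset.mem_insert_of_mem hz1, by rwa [hP.nb_other hT hz1 hzy]⟩
    have := Finset.card_le_card hsub
    rw [Finset.card_insert_of_notMem hyi] at this
    omega

lemma card_le_of_far_gate (hT : T.IsTree) {k ι : ℕ} {r : V} {𝓖 𝓑 : Finset (Finset V)}
    (hk4 : 4 ≤ k) (h𝓑 : ∀ s, Conv T s → s.card = k → (Intr T s).card ≠ ι → s ∈ 𝓑)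
    (h𝓖 : ∀ g ∈ 𝓖, Conv T g ∧ g.card + 2 = k ∧ (Intr T g).card = ι ∧
      ∃ y, Gate T g r y ∧ 2 ≤ T.dist y r) : 𝓖.card ≤ 𝓑.card := by
  refine card_le_of_relation (fun s s' => ∃ s₁, Ext T r s s₁ ∧ Ext T r s₁ s') ?_ fun g hg => ?_
  · rintro s₁ s₂ s' ⟨t₁, h1, h2⟩ ⟨t₂, h3, h4⟩
    have := h2.injective h4
    subst this
    exact h1.injective h3
  obtain ⟨hc, hk, hi, y, hy, hyr⟩ := h𝓖 g hg
  have hne : y ≠ r := by rintro rfl; rw [T.dist_self] at hyr; omega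
  obtain ⟨w, hw, hd⟩ := exists_adj_dist_succ hT hne
  have hne' : w ≠ r := by rintro rfl; rw [T.dist_self] at hd; omega
  obtain ⟨x, hx, hd'⟩ := exists_adj_dist_succ hT hne'
  have hwg : w ∉ g := fun h => by have := hy.2 _ h; omega
  have hP : Pend T g y w := ⟨hc, hy.1, hwg, hw⟩
  have hxw : x ∉ insert w g := by
    intro h
    rcases Finset.mem_insert.1 h with rfl | h
    · omega
    · have := hy.2 _ h; omega
  have hP' : Pend T (insert w g) w x := ⟨hP.conv_insert hT, by simp, hxw, hx⟩
  have hgate : Gate T (insert w g) r w := by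
    refine ⟨by simp, fun z hz => ?_⟩
    rcases Finset.mem_insert.1 hz with rfl | hz
    · exact le_rfl
    · have := hy.2 _ hz; omega
  refine ⟨insert x (insert w g), h𝓑 _ (hP'.conv_insert hT) ?_ ?_, insert w g,
    ⟨y, w, hy, hw, hd, rfl⟩, w, x, hgate, hx, hd', rfl⟩
  · rw [Finset.card_insert_of_notMem hxw, Finset.card_insert_of_notMem hwg, ← hk]
  · have hwi : w ∉ Intr T g := fun h => hwg (Finset.mem_filter.1 h).1
    have hsub : insert w (Intr T g) ⊆ Intr T (insert x (insert w g)) := by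
      intro z hz
      rcases Finset.mem_insert.1 hz with rfl | hz
      · simp [Intr, hP'.card_nb_base, hP.nb_new hT]
      · have hzw : z ≠ w := fun h => hwi (h ▸ hz)
        obtain ⟨hz1, hz2⟩ := Finset.mem_filter.1 hz
        refine Finset.mem_filter.2 ⟨by simp [hz1], ?_⟩
        rw [hP'.nb_other hT (Finset.mem_insert_of_mem hz1) hzw]
        by_cases hzy : z = y
        · subst hzy
          have := card_nb_pos hT hc (by omega) hz1
          rw [hP.card_nb_base]
          omega
        · rwa [hP.nb_other hT hz1 hzy]
    have := Finset.card_le_card hsub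
    rw [Finset.card_insert_of_notMem hwi] at this
    omega

lemma dist_lt_card (hT : T.IsTree) {s : Finset V} (hs : Conv T s) :
    ∀ (d : ℕ) (a b : V), a ∈ s → b ∈ s → T.dist a b = d →
      d + 1 ≤ (s.filter fun x => Geod T a x b).card := by
  intro d
  induction d with
  | zero =>
    intro a b ha _ _
    exact Finset.card_pos.2 ⟨a, Finset.mem_filter.2 ⟨ha, geod_left _ _⟩⟩
  | succ d ih =>
    intro a b ha hb hab
    have hne : a ≠ b := by rintro rfl; rw [T.dist_self] at hab; omega
    obtain ⟨n, hn, hd⟩ := exists_adj_dist_succ hT hne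
    have hns := hs.2 a ha b hb n ((geod_of_adj_iff hn).2 hd)
    have h1 := ih n b hns hb (by omega)
    have hsub : insert a (s.filter fun x => Geod T n x b) ⊆ s.filter fun x => Geod T a x b := by
      intro z hz
      rcases Finset.mem_insert.1 hz with rfl | hz
      · exact Finset.mem_filter.2 ⟨ha, geod_left _ _⟩
      · obtain ⟨hz1, hz2⟩ := Finset.mem_filter.1 hz
        refine Finset.mem_filter.2 ⟨hz1, ?_⟩
        have h2 := hT.1.dist_triangle (u := a) (v := n) (w := z)
        have h3 := hT.1.dist_triangle (u := a) (v := z) (w := b)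
        rw [dist_eq_one_iff_adj.2 hn] at h2
        unfold Geod at *
        omega
    have hna : a ∉ s.filter fun x => Geod T n x b := by
      intro h
      have h2 := (Finset.mem_filter.1 h).2
      unfold Geod at h2
      omega
    have := Finset.card_le_card hsub
    rw [Finset.card_insert_of_notMem hna] at this
    omega

lemma exists_far_gate (hT : T.IsTree) {s : Finset V} (hs : Conv T s) {r₁ r₂ : V}
    (hr : s.card + 2 ≤ T.dist r₁ r₂) :
    (∃ y, Gate T s r₁ y ∧ 2 ≤ T.dist y r₁) ∨ ∃ y, Gate T s r₂ y ∧ 2 ≤ T.dist y r₂ := by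
  obtain ⟨y₁, h₁⟩ := exists_gate hs.1 r₁
  obtain ⟨y₂, h₂⟩ := exists_gate hs.1 r₂
  by_contra! hcon
  have a1 := hcon.1 y₁ h₁
  have a2 := hcon.2 y₂ h₂
  have := (dist_lt_card hT hs _ y₁ y₂ h₁.1 h₂.1 rfl).trans (Finset.card_filter_le _ _)
  have h3 := hT.1.dist_triangle (u := r₁) (v := y₁) (w := r₂)
  have h4 := hT.1.dist_triangle (u := y₁) (v := y₂) (w := r₂)
  rw [T.dist_comm (u := r₁) (v := y₁)] at h3
  omega

variable {s : Finset V} {l : V}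

/-- The vertex of `s` nearest to `r` is a leaf of `s`. -/
def LeafGate (T : SimpleGraph V) (r : V) (s : Finset V) : Prop :=
  ∃ y, Gate T s r y ∧ 1 ≤ T.dist y r ∧ (nb T s y).card = 1

/-- The vertex of `s` nearest to `r` is at distance at least two from `r`. -/
def FarGate (T : SimpleGraph V) (r : V) (s : Finset V) : Prop :=
  ∃ y, Gate T s r y ∧ 2 ≤ T.dist y r

/-- The vertex of `s` nearest to `r` is internal and at distance at least two from `r`. -/
def InnerGate (T : SimpleGraph V) (r : V) (s : Finset V) : Prop :=
  ∃ y, Gate T s r y ∧ 2 ≤ T.dist y r ∧ (nb T s y).card ≠ 1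

lemma InnerGate.farGate {r : V} (h : InnerGate T r s) : FarGate T r s := by
  obtain ⟨y, h1, h2, -⟩ := h
  exact ⟨y, h1, h2⟩

lemma exists_leafGate_or_innerGate (hT : T.IsTree) (hs : Conv T s) {r₁ r₂ : V}
    (hr : s.card + 2 ≤ T.dist r₁ r₂) :
    (LeafGate T r₁ s ∨ InnerGate T r₁ s) ∨ LeafGate T r₂ s ∨ InnerGate T r₂ s := by
  refine (exists_far_gate hT hs hr).imp ?_ ?_ <;>
  · rintro ⟨y, h1, h2⟩
    by_cases h : (nb T s y).card = 1
    · exact Or.inl ⟨y, h1, by omega, h⟩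
    · exact Or.inr ⟨y, h1, h2, h⟩

lemma InnerGate.erase (hT : T.IsTree) {r w : V} (h : InnerGate T r s) (hs : Conv T s) (hw : w ∈ s)
    (hl : l ∈ Lf T s w) (h3 : 3 ≤ (nb T s w).card) : InnerGate T r (s.erase l) := by
  obtain ⟨y, h1, h2, h4⟩ := h
  have hyl : y ≠ l := by
    rintro rfl
    exact h4 (mem_Lf.1 hl).2
  have hP := pend_erase hT hs hw hl
  have hc := card_nb_erase hT hs hw hl
  refine ⟨y, h1.erase hyl, h2, fun h' => h4 ?_⟩
  have := (hP.card_nb_eq_one_iff hT (by omega) (Finset.mem_erase.2 ⟨hyl, h1.1⟩)).2 h'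
  rwa [Finset.insert_erase (mem_Lf.1 hl).1.1] at this

lemma LeafGate.exists_erase (hT : T.IsTree) {r w : V} (h : LeafGate T r s) (hs : Conv T s)
    (hw : w ∈ s) (h3 : 3 ≤ (nb T s w).card) :
    ∃ y, ∀ l ∈ Lf T s w, l ≠ y → LeafGate T r (s.erase l) := by
  obtain ⟨y, h1, h2, h4⟩ := h
  refine ⟨y, fun l hl hne => ⟨y, h1.erase hne.symm, h2, ?_⟩⟩
  have hP := pend_erase hT hs hw hl
  have hc := card_nb_erase hT hs hw hl
  have := (hP.card_nb_eq_one_iff hT (by omega) (Finset.mem_erase.2 ⟨hne.symm, h1.1⟩)).1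
  rw [Finset.insert_erase (mem_Lf.1 hl).1.1] at this
  exact this h4

end Gates

section ForkMoves

open scoped Classical

variable {V : Type*} [Fintype V] {T : SimpleGraph V}

/-- The subtrees in which `v` and the fork at `u` have a given state. -/
noncomputable def stSet (T : SimpleGraph V) (k : ℕ) (X : Multiset ℕ) (F ι n ω p q : ℕ)
    (v u : V) : Finset (Finset V) :=
  {s | St T k X F ι n ω p q s v u}

variable {k : ℕ} {X : Multiset ℕ} {F ι n ω p q : ℕ} {g s : Finset V} {v u l : V}

lemma mem_stSet : s ∈ stSet T k X F ι n ω p q v u ↔ St T k X F ι n ω p q s v u := by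
  simp [stSet]

lemma card_filter_st_le (hT : T.IsTree) (hX : X ≠ 0) (hk : k ≤ g.card + 2) (hg5 : 5 ≤ g.card) :
    (Finset.univ.filter fun z : V × V => St T k X F ι n ω p q g z.1 z.2).card
      ≤ 2 * (F + 1) := by
  have h1 := card_filter_cfg_le_two hT (X := (q + 1) ::ₘ X) hk hg5
  have h2 : (Finset.univ.filter fun z : V × V => St T k X F ι n ω p q g z.1 z.2).card ≤
      (F + 1) * ((Finset.univ.filter fun z : V × V =>
        St T k X F ι n ω p q g z.1 z.2).image Prod.fst).card := by
    refine Finset.card_le_mul_card_image _ _ fun v hv => ?_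
    obtain ⟨⟨v', u⟩, hu, rfl⟩ := Finset.mem_image.1 hv
    have hu : St T k X F ι n ω p q g v' u := (Finset.mem_filter.1 hu).2
    refine le_trans (Finset.card_le_card (t := (Fk T g v' q).image fun z => (v', z)) ?_) ?_
    · rintro ⟨a, z⟩ hz
      simp only [Finset.mem_filter, Finset.mem_univ, true_and] at hz
      obtain ⟨hz, rfl⟩ := hz
      exact Finset.mem_image.2 ⟨z, mem_Fk.2 ⟨hz.frame.memu, hz.lfu, hz.frame.nlu⟩, rfl⟩
    · refine Finset.card_image_le.trans ?_
      have := hu.frame.fk q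
      rw [Finset.card_erase_of_mem (mem_Fk.2 ⟨hu.frame.memu, hu.lfu, hu.frame.nlu⟩)] at this
      omega
  refine h2.trans ?_
  rw [mul_comm]
  refine Nat.mul_le_mul_right _ (le_trans (Finset.card_le_card fun v hv => ?_) h1)
  obtain ⟨⟨v', u⟩, hu, rfl⟩ := Finset.mem_image.1 hv
  exact Finset.mem_filter.2 ⟨Finset.mem_univ _, (Finset.mem_filter.1 hu).2.cfg hX⟩

lemma St.card_free_v (h : St T k X F ι n ω p q g v u) :
    (free T g v).card = (nb T Finset.univ v).card - (X.card + 1) - p := by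
  have := card_free_add (T := T) g v
  rw [h.nb_v] at this
  omega

lemma St.card_free_u (h : St T k X F ι n ω p q g v u) :
    (free T g u).card = (nb T Finset.univ u).card - 1 - q := by
  have := card_free_add (T := T) g u
  rw [h.nb_u] at this
  omega

lemma stSet_add_v (hT : T.IsTree) (hX : X ≠ 0) :
    ((nb T Finset.univ v).card - (X.card + 1) - p) * (stSet T k X F ι n ω p q v u).card ≤
      (p + 1) * (stSet T k X F ι n ω (p + 1) q v u).card := by
  refine card_mul_le_of_insert hT (w := v) (fun g hg => ?_) fun s hs => (mem_stSet.1 hs).lf.le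
  have hg := mem_stSet.1 hg
  refine ⟨hg.conv, hg.mem, hg.card_free_v.ge, fun l hl => mem_stSet.2 ?_⟩
  exact hg.insert_v hT hX (mem_free.1 hl).1 (mem_free.1 hl).2

lemma stSet_add_u (hT : T.IsTree) (hq : 1 ≤ q) :
    ((nb T Finset.univ u).card - 1 - q) * (stSet T k X F ι n ω p q v u).card ≤
      (q + 1) * (stSet T k X F ι n ω p (q + 1) v u).card := by
  refine card_mul_le_of_insert hT (w := u) (fun g hg => ?_) fun s hs => (mem_stSet.1 hs).lfu.le
  have hg := mem_stSet.1 hg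
  refine ⟨hg.conv, hg.memu, hg.card_free_u.ge, fun l hl => mem_stSet.2 ?_⟩
  exact hg.insert_u hT hq (mem_free.1 hl).1 (mem_free.1 hl).2

lemma stSet_rem_v (hT : T.IsTree) (hX : X ≠ 0) :
    (p + 1) * (stSet T k X F ι n ω (p + 1) q v u).card ≤
      ((nb T Finset.univ v).card - (X.card + 1) - p) * (stSet T k X F ι n ω p q v u).card := by
  refine card_mul_le_of_erase (w := v) (fun s => Lf T s v) (fun s hs => ?_)
    fun g hg => (mem_stSet.1 hg).card_free_v.le
  have hs := mem_stSet.1 hs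
  exact ⟨subset_rfl, hs.lf.ge, fun l hl => mem_stSet.2 (hs.erase_v hT hX hl)⟩

lemma stSet_rem_u (hT : T.IsTree) (hX : X ≠ 0) (hq : 1 ≤ q) :
    (q + 1) * (stSet T k X F ι n ω p (q + 1) v u).card ≤
      ((nb T Finset.univ u).card - 1 - q) * (stSet T k X F ι n ω p q v u).card := by
  refine card_mul_le_of_erase (w := u) (fun s => Lf T s u) (fun s hs => ?_)
    fun g hg => (mem_stSet.1 hg).card_free_u.le
  have hs := mem_stSet.1 hs
  exact ⟨subset_rfl, hs.lfu.ge, fun l hl => mem_stSet.2 (hs.erase_u hT hX hq hl)⟩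

lemma stSet_leaf_le (hT : T.IsTree) (hX : X ≠ 0) (hq : 1 ≤ q) (r : V)
    (hb : (nb T Finset.univ u).card - 1 ≤ 2 * (q + 1)) :
    ((stSet T k X F ι n ω p (q + 1) v u).filter (LeafGate T r)).card ≤
      3 * ((stSet T k X F ι n ω p q v u).filter (LeafGate T r)).card := by
  refine le_mul_of_step (c := q) (d := q + 2) (card_mul_le_of_erase (T := T) (w := u)
    (fun s => (Lf T s u).filter fun l => LeafGate T r (s.erase l)) (fun s hs => ?_)
    fun g hg => ?_) (by omega) hq
  · obtain ⟨hs, hg⟩ := Finset.mem_filter.1 hs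
    have hs := mem_stSet.1 hs
    refine ⟨Finset.filter_subset _ _, ?_, fun l hl => ?_⟩
    · obtain ⟨y, hy⟩ := hg.exists_erase hT hs.conv hs.memu (by rw [hs.nb_u]; omega)
      refine le_trans ?_ (Finset.card_le_card (s := (Lf T s u).erase y) fun l hl => ?_)
      · have := Finset.pred_card_le_card_erase (s := Lf T s u) (a := y)
        rw [hs.lfu] at this
        exact this
      · obtain ⟨h1, h2⟩ := Finset.mem_erase.1 hl
        exact Finset.mem_filter.2 ⟨h2, hy l h2 h1⟩
    · obtain ⟨h1, h2⟩ := Finset.mem_filter.1 hl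
      exact Finset.mem_filter.2 ⟨mem_stSet.2 (hs.erase_u hT hX hq h1), h2⟩
  · rw [(mem_stSet.1 (Finset.mem_filter.1 hg).1).card_free_u]
    omega

lemma stSet_inner_le (hT : T.IsTree) (hX : X ≠ 0) (hq : 1 ≤ q) (r : V)
    (ha : (nb T Finset.univ v).card - (X.card + 1) ≤ 2 * (p + 1))
    (hb : (nb T Finset.univ u).card - 1 ≤ 2 * (q + 1)) :
    ((stSet T k X F ι n ω (p + 1) (q + 1) v u).filter (InnerGate T r)).card ≤
      4 * ((stSet T k X F ι n ω p q v u).filter (FarGate T r)).card := by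
  have h0 := Multiset.card_pos.2 hX
  have h1 : (p + 1) * ((stSet T k X F ι n ω (p + 1) (q + 1) v u).filter (InnerGate T r)).card ≤
      (p + 2) * ((stSet T k X F ι n ω p (q + 1) v u).filter (InnerGate T r)).card := by
    refine card_mul_le_of_erase (T := T) (w := v) (fun s => Lf T s v) (fun s hs => ?_)
      fun g hg => ?_
    · obtain ⟨hs, hg⟩ := Finset.mem_filter.1 hs
      have hs := mem_stSet.1 hs
      refine ⟨subset_rfl, hs.lf.ge, fun l hl => Finset.mem_filter.2
        ⟨mem_stSet.2 (hs.erase_v hT hX hl), hg.erase hT hs.conv hs.mem hl ?_⟩⟩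
      rw [hs.nb_v]
      omega
    · rw [(mem_stSet.1 (Finset.mem_filter.1 hg).1).card_free_v]
      omega
  have h2 : (q + 1) * ((stSet T k X F ι n ω p (q + 1) v u).filter (InnerGate T r)).card ≤
      (q + 2) * ((stSet T k X F ι n ω p q v u).filter (FarGate T r)).card := by
    refine card_mul_le_of_erase (T := T) (w := u) (fun s => Lf T s u) (fun s hs => ?_)
      fun g hg => ?_
    · obtain ⟨hs, hg⟩ := Finset.mem_filter.1 hs
      have hs := mem_stSet.1 hs
      refine ⟨subset_rfl, hs.lfu.ge, fun l hl => Finset.mem_filter.2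
        ⟨mem_stSet.2 (hs.erase_u hT hX hq hl), (hg.erase hT hs.conv hs.memu hl ?_).farGate⟩⟩
      rw [hs.nb_u]
      omega
    · rw [(mem_stSet.1 (Finset.mem_filter.1 hg).1).card_free_u]
      omega
  exact le_mul_of_two_steps h1 h2 (by nlinarith) (by positivity)

lemma stSet_le (hT : T.IsTree) (hX : X ≠ 0) (hq : 1 ≤ q) {r₁ r₂ : V}
    (hr : n + (p + 1) + (q + 1) + 2 ≤ T.dist r₁ r₂) :
    (stSet T k X F ι n ω (p + 1) (q + 1) v u).card ≤
      2 * (stSet T k X F ι n ω (p + 2) q v u).card +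
      3 * (stSet T k X F ι n ω p (q + 2) v u).card +
      (3 * ((stSet T k X F ι n ω (p + 1) q v u).filter (LeafGate T r₁)).card +
        4 * ((stSet T k X F ι n ω p q v u).filter (FarGate T r₁)).card) +
      (3 * ((stSet T k X F ι n ω (p + 1) q v u).filter (LeafGate T r₂)).card +
        4 * ((stSet T k X F ι n ω p q v u).filter (FarGate T r₂)).card) := by
  obtain ⟨a, ha⟩ : ∃ a, a = (nb T Finset.univ v).card - (X.card + 1) := ⟨_, rfl⟩
  obtain ⟨b, hb⟩ : ∃ b, b = (nb T Finset.univ u).card - 1 := ⟨_, rfl⟩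
  by_cases hab : a ≤ 2 * (p + 1) ∧ b ≤ 2 * (q + 1)
  · have l1 := stSet_leaf_le hT hX (k := k) (F := F) (ι := ι) (n := n) (ω := ω) (p := p + 1)
      (v := v) hq r₁ (hb ▸ hab.2)
    have l2 := stSet_leaf_le hT hX (k := k) (F := F) (ι := ι) (n := n) (ω := ω) (p := p + 1)
      (v := v) hq r₂ (hb ▸ hab.2)
    have i1 := stSet_inner_le hT hX (k := k) (F := F) (ι := ι) (n := n) (ω := ω) hq r₁
      (ha ▸ hab.1) (hb ▸ hab.2)
    have i2 := stSet_inner_le hT hX (k := k) (F := F) (ι := ι) (n := n) (ω := ω) hq r₂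
      (ha ▸ hab.1) (hb ▸ hab.2)
    have hsub : stSet T k X F ι n ω (p + 1) (q + 1) v u ⊆
        ((stSet T k X F ι n ω (p + 1) (q + 1) v u).filter (LeafGate T r₁) ∪
          (stSet T k X F ι n ω (p + 1) (q + 1) v u).filter (InnerGate T r₁)) ∪
        ((stSet T k X F ι n ω (p + 1) (q + 1) v u).filter (LeafGate T r₂) ∪
          (stSet T k X F ι n ω (p + 1) (q + 1) v u).filter (InnerGate T r₂)) := by
      intro s hs
      have hs' := mem_stSet.1 hs
      simp only [Finset.mem_union, Finset.mem_filter, hs, true_and]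
      exact exists_leafGate_or_innerGate hT hs'.conv (by rw [hs'.card]; exact hr)
    have h1 := (Finset.card_le_card hsub).trans (Finset.card_union_le _ _)
    have h2 := Finset.card_union_le
      ((stSet T k X F ι n ω (p + 1) (q + 1) v u).filter (LeafGate T r₁))
      ((stSet T k X F ι n ω (p + 1) (q + 1) v u).filter (InnerGate T r₁))
    have h3 := Finset.card_union_le
      ((stSet T k X F ι n ω (p + 1) (q + 1) v u).filter (LeafGate T r₂))
      ((stSet T k X F ι n ω (p + 1) (q + 1) v u).filter (InnerGate T r₂))
    omega
  have r1 := stSet_rem_u hT hX (k := k) (F := F) (ι := ι) (n := n) (ω := ω) (p := p + 1)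
    (v := v) (u := u) hq
  have r2 := stSet_add_v hT hX (k := k) (F := F) (ι := ι) (n := n) (ω := ω) (p := p + 1) (q := q)
    (v := v) (u := u)
  have r3 := stSet_rem_v hT hX (k := k) (F := F) (ι := ι) (n := n) (ω := ω) (p := p) (q := q + 1)
    (v := v) (u := u)
  have r4 := stSet_add_u hT (X := X) (k := k) (F := F) (ι := ι) (n := n) (ω := ω) (p := p)
    (q := q + 1) (v := v) (u := u) (by omega)
  rw [← ha] at r2 r3
  rw [← hb] at r1 r4
  obtain ⟨a', ha'⟩ : ∃ a', a' = a - (p + 1) := ⟨_, rfl⟩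
  obtain ⟨b', hb'⟩ : ∃ b', b' = b - (q + 1) := ⟨_, rfl⟩
  rw [← ha'] at r2
  rw [← hb'] at r4
  by_cases h1 : b' * (p + 2) ≤ a' * (q + 2)
  · have ha2 : p + 2 ≤ a' := by
      by_contra hcon
      apply hab
      refine ⟨by omega, ?_⟩
      by_contra hcon2
      have : q + 2 ≤ b' := by omega
      have : (q + 2) * (p + 2) ≤ b' * (p + 2) := Nat.mul_le_mul_right _ this
      have : a' * (q + 2) ≤ (p + 1) * (q + 2) := Nat.mul_le_mul_right _ (by omega)
      nlinarith
    have hbq : b - q ≤ b' + 1 := by omega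
    have : _ ≤ 2 * (stSet T k X F ι n ω (p + 2) q v u).card := le_mul_of_two_steps (K := 2) r1 r2
      (by have := Nat.mul_le_mul_right (p + 2) hbq; nlinarith) (Nat.mul_pos (by omega) (by omega))
    omega
  · have hb2 : q + 2 ≤ b' := by
      by_contra hcon
      apply hab
      refine ⟨?_, by omega⟩
      by_contra hcon2
      have : p + 2 ≤ a' := by omega
      have : (p + 2) * (q + 2) ≤ a' * (q + 2) := Nat.mul_le_mul_right _ this
      have : b' * (p + 2) ≤ (q + 1) * (p + 2) := Nat.mul_le_mul_right _ (by omega)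
      nlinarith
    have hap : a - p ≤ a' + 1 := by omega
    have : _ ≤ 3 * (stSet T k X F ι n ω p (q + 2) v u).card := le_mul_of_two_steps (K := 3) r3 r4
      (by have := Nat.mul_le_mul_right (q + 2) hap; nlinarith) (Nat.mul_pos (by omega) (by omega))
    omega

lemma mul_card_le_sum_card_filter {ι' α : Type*} [Fintype ι'] [Fintype α] (𝓢 : Finset α)
    (P : ι' → α → Prop) {c : ℕ}
    (h : ∀ s ∈ 𝓢, c ≤ (Finset.univ.filter fun i => P i s).card) :
    c * 𝓢.card ≤ ∑ i, (Finset.univ.filter fun s => P i s).card := by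
  calc c * 𝓢.card = ∑ s ∈ 𝓢, c := by simp [mul_comm]
    _ ≤ ∑ s ∈ 𝓢, (Finset.univ.filter fun i => P i s).card := Finset.sum_le_sum h
    _ = ∑ s ∈ 𝓢, ∑ i, if P i s then 1 else 0 := by simp only [Finset.card_filter]
    _ = ∑ i, ∑ s ∈ 𝓢, if P i s then 1 else 0 := Finset.sum_comm
    _ = ∑ i, (𝓢.filter fun s => P i s).card := by simp only [Finset.card_filter]
    _ ≤ _ := Finset.sum_le_sum fun i _ =>
      Finset.card_le_card (Finset.filter_subset_filter _ (Finset.subset_univ _))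

/-- The `k`-vertex subtrees with a prescribed deviation in the statistics `Intr` or `Om`. -/
noncomputable def devSet (T : SimpleGraph V) (k ι ω : ℕ) : Finset (Finset V) :=
  {s | Conv T s ∧ s.card = k ∧ ((Intr T s).card ≠ ι ∨ Om T s ≠ ω)}

lemma mem_devSet {ω : ℕ} : s ∈ devSet T k ι ω ↔
    Conv T s ∧ s.card = k ∧ ((Intr T s).card ≠ ι ∨ Om T s ≠ ω) := by
  simp [devSet]

lemma sum_card_stSet_filter_le (hT : T.IsTree) (hX : X ≠ 0) (hk : 17 ≤ k)
    (hn : k ≤ n + p + q + 2) (Q : Finset V → Prop) {𝓑 : Finset (Finset V)}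
    (h : ∀ 𝓖 : Finset (Finset V), (∀ g ∈ 𝓖, ∃ v u, St T k X F ι n ω p q g v u ∧ Q g) →
      𝓖.card ≤ 𝓑.card) :
    ∑ z : V × V, ((stSet T k X F ι n ω p q z.1 z.2).filter Q).card ≤
      2 * (F + 1) * 𝓑.card := by
  have h1 := sum_card_filter_le
    (Finset.univ.filter fun g => ∃ v u, St T k X F ι n ω p q g v u ∧ Q g)
    (fun (z : V × V) g => St T k X F ι n ω p q g z.1 z.2)
    (fun z => (stSet T k X F ι n ω p q z.1 z.2).filter Q) (fun z g hg => by
      obtain ⟨h1, h2⟩ := Finset.mem_filter.1 hg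
      exact ⟨Finset.mem_filter.2 ⟨Finset.mem_univ _, z.1, z.2, mem_stSet.1 h1, h2⟩,
        mem_stSet.1 h1⟩) (m := 2 * (F + 1)) (fun g hg => by
      obtain ⟨v, u, h1, -⟩ := (Finset.mem_filter.1 hg).2
      have := h1.card
      exact card_filter_st_le hT hX (by omega) (by omega))
  exact h1.trans (Nat.mul_le_mul_left _ (h _ fun g hg => (Finset.mem_filter.1 hg).2))

theorem card_le_of_large_fork (hT : T.IsTree) (hX : X ≠ 0) (hk : 17 ≤ k) {r₁ r₂ : V}
    (hr : k + 2 ≤ T.dist r₁ r₂) (hn : n + (p + 1) + (q + 1) = k) (hq : 1 ≤ q) (hF : 1 ≤ F)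
    {𝓢 : Finset (Finset V)}
    (h𝓢 : ∀ s ∈ 𝓢, ∃ v, F ≤ (Finset.univ.filter fun u =>
      St T k X (F + 1) ι n ω (p + 1) (q + 1) s v u).card) :
    𝓢.card ≤ 114 * (devSet T k ι (ω + (p + 1))).card := by
  have h1 := mul_card_le_sum_card_filter 𝓢
    (fun (z : V × V) s => St T k X (F + 1) ι n ω (p + 1) (q + 1) s z.1 z.2) (c := F) (by
      intro s hs
      obtain ⟨v, hv⟩ := h𝓢 s hs
      rw [← Finset.card_image_of_injective _ (Prod.mk_right_injective v)] at hv
      refine hv.trans (Finset.card_le_card fun z hz => ?_)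
      obtain ⟨u, hu, rfl⟩ := Finset.mem_image.1 hz
      simpa using hu)
  have h2 := Finset.sum_le_sum fun (z : V × V) (_ : z ∈ Finset.univ) =>
    stSet_le hT hX (k := k) (F := F + 1) (ι := ι) (n := n) (ω := ω) (p := p) (v := z.1)
      (u := z.2) hq (r₁ := r₁) (r₂ := r₂) (by omega)
  simp only [Finset.sum_add_distrib, ← Finset.mul_sum] at h2
  have hdev : ∀ {p' q' : ℕ}, n + p' + q' = k → p' ≠ p + 1 → ∀ 𝓖 : Finset (Finset V),
      (∀ g ∈ 𝓖, ∃ v u, St T k X (F + 1) ι n ω p' q' g v u ∧ True) →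
      𝓖.card ≤ (devSet T k ι (ω + (p + 1))).card := by
    intro p' q' hn' hp' 𝓖 h
    refine Finset.card_le_card fun g hg => ?_
    obtain ⟨v, u, h, -⟩ := h g hg
    have hom := h.om
    exact mem_devSet.2 ⟨h.conv, by rw [h.card, hn'], Or.inr (by omega)⟩
  have b1 := sum_card_stSet_filter_le hT hX hk (by omega) _
    (hdev (p' := p + 2) (q' := q) (by omega) (by omega))
  have b2 := sum_card_stSet_filter_le hT hX hk (by omega) _
    (hdev (p' := p) (q' := q + 2) (by omega) (by omega))
  simp only [Finset.filter_true] at b1 b2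
  have hleaf : ∀ r, ∑ z : V × V, ((stSet T k X (F + 1) ι n ω (p + 1) q z.1 z.2).filter
      (LeafGate T r)).card ≤ 2 * (F + 1 + 1) * (devSet T k ι (ω + (p + 1))).card := by
    refine fun r => sum_card_stSet_filter_le hT hX hk (by omega) _ fun 𝓖 h𝓖 => ?_
    refine card_le_of_leaf_gate hT (k := k) (ι := ι) (r := r)
      (fun s h1 h2 h3 => mem_devSet.2 ⟨h1, h2, Or.inl h3⟩) fun g hg => ?_
    obtain ⟨v, u, h, hQ⟩ := h𝓖 g hg
    have := h.card
    exact ⟨h.conv, by omega, h.frame.intr, hQ⟩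
  have hfar : ∀ r, ∑ z : V × V, ((stSet T k X (F + 1) ι n ω p q z.1 z.2).filter
      (FarGate T r)).card ≤ 2 * (F + 1 + 1) * (devSet T k ι (ω + (p + 1))).card := by
    refine fun r => sum_card_stSet_filter_le hT hX hk (by omega) _ fun 𝓖 h𝓖 => ?_
    refine card_le_of_far_gate hT (k := k) (ι := ι) (r := r) (by omega)
      (fun s h1 h2 h3 => mem_devSet.2 ⟨h1, h2, Or.inl h3⟩) fun g hg => ?_
    obtain ⟨v, u, h, hQ⟩ := h𝓖 g hg
    have := h.card
    exact ⟨h.conv, by omega, h.frame.intr, hQ⟩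
  have l1 := hleaf r₁
  have l2 := hleaf r₂
  have f1 := hfar r₁
  have f2 := hfar r₂
  set B := (devSet T k ι (ω + (p + 1))).card
  have h3 : F * 𝓢.card ≤ 19 * (2 * (F + 1 + 1) * B) :=
    h1.trans (le_trans h2 (by omega))
  refine Nat.le_of_mul_le_mul_left ?_ hF
  have h4 : (F + 1 + 1) * B ≤ 3 * F * B := Nat.mul_le_mul_right _ (by omega)
  nlinarith

end ForkMoves

section Prongs

open scoped Classical

variable {V : Type*} {T : SimpleGraph V}

/-- A fork of order one with middle vertex `u` and end `x` can be attached to the subtree `g` at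
the internal vertex `v`. -/
structure Prong (T : SimpleGraph V) (g : Finset V) (v u x : V) : Prop where
  conv : Conv T g
  int : 2 ≤ (nb T g v).card
  base : Pend T g v u
  tip : Pend T (insert u g) u x

namespace Prong

variable {g : Finset V} {v u x : V} {k : ℕ} {X : Multiset ℕ}

lemma nb_mid (hT : T.IsTree) (h : Prong T g v u x) :
    nb T (insert x (insert u g)) u = {x, v} := by
  rw [h.tip.nb_base, h.base.nb_new hT]

lemma ne (h : Prong T g v u x) : x ≠ v := by
  rintro rfl
  exact h.tip.nmem (Finset.mem_insert_of_mem h.base.mem)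

lemma card_nb_mid (hT : T.IsTree) (h : Prong T g v u x) :
    (nb T (insert x (insert u g)) u).card = 2 := by
  rw [h.nb_mid hT, Finset.card_pair h.ne]

lemma nb_base (hT : T.IsTree) (h : Prong T g v u x) :
    nb T (insert x (insert u g)) v = insert u (nb T g v) := by
  rw [h.tip.nb_other hT (Finset.mem_insert_of_mem h.base.mem) h.base.ne.symm, h.base.nb_base]

lemma card_nb_base (hT : T.IsTree) (h : Prong T g v u x) :
    (nb T (insert x (insert u g)) v).card = (nb T g v).card + 1 := by
  rw [h.tip.nb_other hT (Finset.mem_insert_of_mem h.base.mem) h.base.ne.symm,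
    h.base.card_nb_base]

lemma nb_other (hT : T.IsTree) (h : Prong T g v u x) {y : V} (hy : y ∈ g) (hyv : y ≠ v) :
    nb T (insert x (insert u g)) y = nb T g y := by
  rw [h.tip.nb_other hT (Finset.mem_insert_of_mem hy) (fun h' => h.base.nmem (h' ▸ hy)),
    h.base.nb_other hT hy hyv]

lemma card_nb_eq_one_iff (hT : T.IsTree) (h : Prong T g v u x) {y : V} (hy : y ∈ g) :
    (nb T (insert x (insert u g)) y).card = 1 ↔ (nb T g y).card = 1 := by
  by_cases hyv : y = v
  · subst hyv
    have := h.int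
    rw [h.card_nb_base hT]
    omega
  · rw [h.nb_other hT hy hyv]

lemma Nl_base (hT : T.IsTree) (h : Prong T g v u x) :
    Nl T (insert x (insert u g)) v = insert u (Nl T g v) := by
  unfold Nl
  rw [h.nb_base hT, Finset.filter_insert, if_pos (by rw [h.card_nb_mid hT]; omega)]
  congr 1
  refine Finset.filter_congr fun y hy => ?_
  rw [ne_eq, h.card_nb_eq_one_iff hT (mem_nb.1 hy).1]

lemma Lf_base (hT : T.IsTree) (h : Prong T g v u x) :
    Lf T (insert x (insert u g)) v = Lf T g v := by
  unfold Lf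
  rw [h.nb_base hT, Finset.filter_insert, if_neg (by rw [h.card_nb_mid hT]; omega)]
  exact Finset.filter_congr fun y hy => h.card_nb_eq_one_iff hT (mem_nb.1 hy).1

lemma Nl_other (hT : T.IsTree) (h : Prong T g v u x) {y : V} (hy : y ∈ g) (hyv : y ≠ v) :
    Nl T (insert x (insert u g)) y = Nl T g y := by
  unfold Nl
  rw [h.nb_other hT hy hyv]
  refine Finset.filter_congr fun z hz => ?_
  rw [ne_eq, h.card_nb_eq_one_iff hT (mem_nb.1 hz).1]

lemma Lf_other (hT : T.IsTree) (h : Prong T g v u x) {y : V} (hy : y ∈ g) (hyv : y ≠ v) :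
    Lf T (insert x (insert u g)) y = Lf T g y := by
  unfold Lf
  rw [h.nb_other hT hy hyv]
  exact Finset.filter_congr fun z hz => h.card_nb_eq_one_iff hT (mem_nb.1 hz).1

lemma Nl_mid (hT : T.IsTree) (h : Prong T g v u x) :
    Nl T (insert x (insert u g)) u = {v} := by
  unfold Nl
  have hx : (nb T (insert x (insert u g)) x).card = 1 := by
    rw [h.tip.nb_new hT, Finset.card_singleton]
  have hv := h.card_nb_base hT
  have := h.int
  rw [h.nb_mid hT, Finset.filter_insert, if_neg (by simp [hx]), Finset.filter_singleton,
    if_pos (by omega)]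

lemma Lf_mid (hT : T.IsTree) (h : Prong T g v u x) :
    Lf T (insert x (insert u g)) u = {x} := by
  unfold Lf
  have hx : (nb T (insert x (insert u g)) x).card = 1 := by
    rw [h.tip.nb_new hT, Finset.card_singleton]
  have hv := h.card_nb_base hT
  have := h.int
  rw [h.nb_mid hT, Finset.filter_insert, if_pos hx, Finset.filter_singleton,
    if_neg (by omega), insert_empty_eq]

lemma card_Intr (hT : T.IsTree) (h : Prong T g v u x) :
    (Intr T (insert x (insert u g))).card = (Intr T g).card + 1 := by
  have hx : (nb T (insert x (insert u g)) x).card = 1 := by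
    rw [h.tip.nb_new hT, Finset.card_singleton]
  have : Intr T (insert x (insert u g)) = insert u (Intr T g) := by
    unfold Intr
    rw [Finset.filter_insert, if_neg (by simp [hx]), Finset.filter_insert,
      if_pos (by rw [h.card_nb_mid hT]; omega)]
    congr 1
    refine Finset.filter_congr fun z hz => ?_
    rw [ne_eq, h.card_nb_eq_one_iff hT hz]
  have hu : u ∉ Intr T g := fun h' => h.base.nmem (Finset.mem_filter.1 h').1
  rw [this, Finset.card_insert_of_notMem hu]

lemma notMem_Nl (h : Prong T g v u x) : u ∉ Nl T g v := fun h' =>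
  h.base.nmem (mem_Nl.1 h').1.1

lemma beh_other (hT : T.IsTree) (h : Prong T g v u x) {m : V} (hm : m ∈ g) (hmv : m ≠ v) :
    beh T (insert x (insert u g)) v m = beh T g v m := by
  have hmu : m ≠ u := fun h' => h.base.nmem (h' ▸ hm)
  rw [h.tip.beh_same hT (Or.inr h.base.adj) (Finset.mem_insert_of_mem hm) hmv hmu,
    h.base.beh_same hT (Or.inl rfl) hm hmv hmv]

lemma card_beh_mid (hT : T.IsTree) (h : Prong T g v u x) :
    (beh T (insert x (insert u g)) v u).card = 2 := by
  rw [h.tip.card_beh_base ((geod_of_adj_iff h.base.adj).2 ?_)]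
  · have : beh T (insert u g) v u = {u} := by
      ext b
      simp only [mem_beh, Finset.mem_insert, Finset.mem_singleton]
      constructor
      · rintro ⟨rfl | hb, h'⟩
        · rfl
        · exact absurd (h.conv.2 v h.base.mem b hb u h') h.base.nmem
      · rintro rfl
        exact ⟨Or.inl rfl, by unfold Geod; simp⟩
    rw [this, Finset.card_singleton]
  · rw [dist_adj_adj hT h.base.adj h.tip.adj h.ne.symm, dist_eq_one_iff_adj.2 h.tip.adj]

lemma sz (hT : T.IsTree) (h : Prong T g v u x) :
    Sz T (insert x (insert u g)) v = 2 ::ₘ Sz T g v := by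
  unfold Sz
  rw [h.Nl_base hT, Finset.insert_val_of_notMem h.notMem_Nl, Multiset.map_cons,
    h.card_beh_mid hT]
  congr 1
  refine Multiset.map_congr rfl fun n hn => ?_
  have hn := mem_Nl.1 hn
  rw [h.beh_other hT hn.1.1 hn.1.2.ne']

lemma cfg_iff (hT : T.IsTree) (h : Prong T g v u x) :
    Cfg T k (2 ::ₘ X) (insert x (insert u g)) v ↔ Cfg T k X g v := by
  constructor
  · rintro ⟨-, -, -, h3, h4⟩
    refine ⟨h.conv, h.base.mem, h.int, ?_, fun m hm hmv hm3 => ?_⟩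
    · rw [h.sz hT] at h3
      exact (Multiset.cons_inj_right 2).1 h3
    · rw [← h.beh_other hT hm hmv]
      exact h4 m (by simp [hm]) hmv (by rwa [h.Nl_other hT hm hmv])
  · rintro ⟨-, -, h2, h3, h4⟩
    refine ⟨h.tip.conv_insert hT, by simp [h.base.mem], by rw [h.card_nb_base hT]; omega,
      by rw [h.sz hT, h3], fun m hm hmv hm3 => ?_⟩
    rcases Finset.mem_insert.1 hm with rfl | hm
    · have := h.tip.card_Nl_new hT
      omega
    rcases Finset.mem_insert.1 hm with rfl | hm
    · rw [h.Nl_mid hT, Finset.card_singleton] at hm3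
      omega
    rw [h.beh_other hT hm hmv]
    exact h4 m hm hmv (by rwa [h.Nl_other hT hm hmv] at hm3)

lemma Fk_one (hT : T.IsTree) (h : Prong T g v u x) :
    Fk T (insert x (insert u g)) v 1 = insert u (Fk T g v 1) := by
  unfold Fk
  rw [h.Nl_base hT, Finset.filter_insert,
    if_pos (by rw [h.Lf_mid hT, h.Nl_mid hT]; simp)]
  congr 1
  refine Finset.filter_congr fun z hz => ?_
  have hz := mem_Nl.1 hz
  rw [h.Lf_other hT hz.1.1 hz.1.2.ne', h.Nl_other hT hz.1.1 hz.1.2.ne']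

end Prong

lemma exists_prong (hT : T.IsTree) {s : Finset V} {v u : V} (hs : Conv T s) (hv : v ∈ s)
    (h3 : 3 ≤ (nb T s v).card) (hu : u ∈ Fk T s v 1) :
    ∃ g x, Prong T g v u x ∧ s = insert x (insert u g) := by
  obtain ⟨hu1, hu2, hu3⟩ := mem_Fk.1 hu
  obtain ⟨⟨hus, hadj⟩, -⟩ := mem_Nl.1 hu1
  obtain ⟨x, hx⟩ := Finset.card_eq_one.1 hu2
  have hxl : x ∈ Lf T s u := by simp [hx]
  obtain ⟨⟨hxs, hux⟩, hx1⟩ := mem_Lf.1 hxl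
  have hxv : x ≠ v := by rintro rfl; omega
  have hP := pend_erase hT hs hus hxl
  have h2 : (nb T s u).card = 2 := by rw [← card_Lf_add_card_Nl, hu2, hu3]
  have h1 := card_nb_erase hT hs hus hxl
  have hnv : nb T s v = nb T (s.erase x) v := by
    conv_lhs => rw [← Finset.insert_erase hxs]
    exact hP.nb_other hT (by simp [hv, hxv.symm]) hadj.ne
  have hul : u ∈ Lf T (s.erase x) v :=
    mem_Lf.2 ⟨⟨hP.mem, hadj⟩, by omega⟩
  have hvx : v ∈ s.erase x := by simp [hv, hxv.symm]
  have hP' := pend_erase hT hP.conv hvx hul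
  have h1' := card_nb_erase hT hP.conv hvx hul
  rw [← hnv] at h1'
  have hins := Finset.insert_erase hP.mem
  refine ⟨(s.erase x).erase u, x, ⟨hP'.conv, by omega, hP', by rwa [hins]⟩, ?_⟩
  rw [hins, Finset.insert_erase hxs]

end Prongs

section VertexMoves

open scoped Classical

variable {V : Type*} {T : SimpleGraph V}

/-- The state of a vertex `v` adjacent to `p` leaves. -/
structure VSt (T : SimpleGraph V) (k : ℕ) (X : Multiset ℕ) (ι n p : ℕ) (g : Finset V)
    (v : V) : Prop where
  cfg : Cfg T k X g v
  lf : (Lf T g v).card = p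
  card : g.card = n + p
  intr : (Intr T g).card = ι

/-- A property of subtrees that does not depend on the leaves at `v`. -/
def LeafInv (T : SimpleGraph V) (v : V) (R : Finset V → Prop) : Prop :=
  ∀ g l, Pend T g v l → 2 ≤ (nb T g v).card → (R (insert l g) ↔ R g)

variable {k : ℕ} {X : Multiset ℕ} {ι n p : ℕ} {g s : Finset V} {v l : V} {R : Finset V → Prop}

lemma VSt.nb_v (h : VSt T k X ι n p g v) : (nb T g v).card = p + X.card := by
  rw [← card_Lf_add_card_Nl, h.lf, ← h.cfg.sz, Sz, Multiset.card_map, Finset.card_def]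

lemma Pend.vst_iff (hT : T.IsTree) (hP : Pend T g v l) (h2 : 2 ≤ (nb T g v).card) :
    VSt T k X ι n (p + 1) (insert l g) v ↔ VSt T k X ι n p g v := by
  have h1 := hP.card_Lf_base hT h2
  have h3 := Finset.card_insert_of_notMem hP.nmem
  have h4 := hP.Intr_eq hT h2
  constructor
  · rintro ⟨a1, a2, a3, a4⟩
    exact ⟨(hP.cfg_iff hT h2).1 a1, by omega, by omega, by rw [← h4, a4]⟩
  · rintro ⟨a1, a2, a3, a4⟩
    exact ⟨(hP.cfg_iff hT h2).2 a1, by omega, by omega, by rw [h4, a4]⟩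

lemma VSt.insert (hT : T.IsTree) (h : VSt T k X ι n p g v) (hl : T.Adj v l) (hlg : l ∉ g) :
    VSt T k X ι n (p + 1) (insert l g) v :=
  (Pend.vst_iff hT ⟨h.cfg.conv, h.cfg.mem, hlg, hl⟩ h.cfg.int).2 h

lemma VSt.erase (hT : T.IsTree) (h2 : 2 ≤ p + X.card) (h : VSt T k X ι n (p + 1) s v)
    (hl : l ∈ Lf T s v) : VSt T k X ι n p (s.erase l) v := by
  have h1 := card_nb_erase hT h.cfg.conv h.cfg.mem hl
  rw [h.nb_v] at h1
  refine (Pend.vst_iff hT (pend_erase hT h.cfg.conv h.cfg.mem hl) (by omega)).1 ?_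
  rwa [Finset.insert_erase (mem_Lf.1 hl).1.1]

lemma LeafInv.erase (hT : T.IsTree) (hR : LeafInv T v R) (h2 : 2 ≤ p + X.card)
    (h : VSt T k X ι n (p + 1) s v) (hl : l ∈ Lf T s v) (hs : R s) : R (s.erase l) := by
  have h1 := card_nb_erase hT h.cfg.conv h.cfg.mem hl
  rw [h.nb_v] at h1
  refine (hR _ l (pend_erase hT h.cfg.conv h.cfg.mem hl) (by omega)).1 ?_
  rwa [Finset.insert_erase (mem_Lf.1 hl).1.1]

variable [Fintype V]

/-- The subtrees with property `R` in which `v` has a given state. -/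
noncomputable def vSet (T : SimpleGraph V) (k : ℕ) (X : Multiset ℕ) (ι n : ℕ)
    (R : Finset V → Prop) (p : ℕ) (v : V) : Finset (Finset V) :=
  {g | VSt T k X ι n p g v ∧ R g}

lemma mem_vSet : g ∈ vSet T k X ι n R p v ↔ VSt T k X ι n p g v ∧ R g := by
  simp [vSet]

lemma VSt.card_free (h : VSt T k X ι n p g v) :
    (free T g v).card = (nb T Finset.univ v).card - X.card - p := by
  have := card_free_add (T := T) g v
  rw [h.nb_v] at this
  omega

lemma vSet_add (hT : T.IsTree) (hR : LeafInv T v R) :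
    ((nb T Finset.univ v).card - X.card - p) * (vSet T k X ι n R p v).card ≤
      (p + 1) * (vSet T k X ι n R (p + 1) v).card := by
  refine card_mul_le_of_insert hT (w := v) (fun g hg => ?_)
    fun s hs => (mem_vSet.1 hs).1.lf.le
  obtain ⟨hg, hRg⟩ := mem_vSet.1 hg
  refine ⟨hg.cfg.conv, hg.cfg.mem, hg.card_free.ge, fun l hl => mem_vSet.2 ?_⟩
  obtain ⟨h1, h2⟩ := mem_free.1 hl
  exact ⟨hg.insert hT h1 h2, (hR _ _ ⟨hg.cfg.conv, hg.cfg.mem, h2, h1⟩ hg.cfg.int).2 hRg⟩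

lemma vSet_rem (hT : T.IsTree) (hR : LeafInv T v R) (h2 : 2 ≤ p + X.card) :
    (p + 1) * (vSet T k X ι n R (p + 1) v).card ≤
      ((nb T Finset.univ v).card - X.card - p) * (vSet T k X ι n R p v).card := by
  refine card_mul_le_of_erase (T := T) (w := v) (fun s => Lf T s v) (fun s hs => ?_)
    fun g hg => (mem_vSet.1 hg).1.card_free.le
  obtain ⟨hs, hRs⟩ := mem_vSet.1 hs
  exact ⟨subset_rfl, hs.lf.ge, fun l hl =>
    mem_vSet.2 ⟨hs.erase hT h2 hl, hR.erase hT h2 hs hl hRs⟩⟩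

lemma vSet_le_choose (hT : T.IsTree) (hR : LeafInv T v R) (h2 : 2 ≤ X.card) :
    (vSet T k X ι n R p v).card ≤
      ((nb T Finset.univ v).card - X.card).choose p * (vSet T k X ι n R 0 v).card := by
  induction p with
  | zero => simp
  | succ p ih =>
    have h1 := vSet_rem hT hR (k := k) (ι := ι) (n := n) (p := p) (X := X) (by omega)
    have h3 := Nat.choose_succ_right_eq ((nb T Finset.univ v).card - X.card) p
    refine Nat.le_of_mul_le_mul_left ?_ (by omega : 0 < p + 1)
    refine h1.trans ((Nat.mul_le_mul_left _ ih).trans (le_of_eq ?_))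
    linear_combination (vSet T k X ι n R 0 v).card * h3.symm

lemma choose_le_vSet (hT : T.IsTree) (hR : LeafInv T v R) :
    ((nb T Finset.univ v).card - X.card).choose p * (vSet T k X ι n R 0 v).card ≤
      (vSet T k X ι n R p v).card := by
  induction p with
  | zero => simp
  | succ p ih =>
    have h1 := vSet_add hT hR (k := k) (ι := ι) (n := n) (p := p) (X := X)
    have h3 := Nat.choose_succ_right_eq ((nb T Finset.univ v).card - X.card) p
    refine Nat.le_of_mul_le_mul_left ?_ (by omega : 0 < p + 1)
    refine le_trans (le_of_eq ?_) ((Nat.mul_le_mul_left _ ih).trans h1)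
    linear_combination (vSet T k X ι n R 0 v).card * h3

lemma vSet_leaf_le (hT : T.IsTree) (hR : LeafInv T v R) (h2 : 2 ≤ X.card) (r : V)
    (ha : (nb T Finset.univ v).card - X.card ≤ 2 * (p + 2)) :
    ((vSet T k X ι n R (p + 2) v).filter (LeafGate T r)).card ≤
      3 * ((vSet T k X ι n R (p + 1) v).filter (LeafGate T r)).card := by
  refine le_mul_of_step (c := p + 1) (d := p + 3) (card_mul_le_of_erase (T := T) (w := v)
    (fun s => (Lf T s v).filter fun l => LeafGate T r (s.erase l)) (fun s hs => ?_)
    fun g hg => ?_) (by omega) (by omega)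
  · obtain ⟨hs, hg⟩ := Finset.mem_filter.1 hs
    obtain ⟨hs, hRs⟩ := mem_vSet.1 hs
    refine ⟨Finset.filter_subset _ _, ?_, fun l hl => ?_⟩
    · obtain ⟨y, hy⟩ := hg.exists_erase hT hs.cfg.conv hs.cfg.mem (by rw [hs.nb_v]; omega)
      refine le_trans ?_ (Finset.card_le_card (s := (Lf T s v).erase y) fun l hl => ?_)
      · have := Finset.pred_card_le_card_erase (s := Lf T s v) (a := y)
        rw [hs.lf] at this
        exact this
      · obtain ⟨h1, h2⟩ := Finset.mem_erase.1 hl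
        exact Finset.mem_filter.2 ⟨h2, hy l h2 h1⟩
    · obtain ⟨h1, h3⟩ := Finset.mem_filter.1 hl
      exact Finset.mem_filter.2 ⟨mem_vSet.2 ⟨hs.erase hT (by omega) h1,
        hR.erase hT (by omega) hs h1 hRs⟩, h3⟩
  · rw [(mem_vSet.1 (Finset.mem_filter.1 hg).1).1.card_free]
    omega

lemma vSet_inner_le (hT : T.IsTree) (hR : LeafInv T v R) (h2 : 2 ≤ X.card) (r : V)
    (ha : (nb T Finset.univ v).card - X.card ≤ 2 * (p + 2)) :
    ((vSet T k X ι n R (p + 2) v).filter (InnerGate T r)).card ≤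
      6 * ((vSet T k X ι n R p v).filter (FarGate T r)).card := by
  have key : ∀ j, (j + 1) * ((vSet T k X ι n R (j + 1) v).filter (InnerGate T r)).card ≤
      (2 * (p + 2) - j) * ((vSet T k X ι n R j v).filter (InnerGate T r)).card := by
    intro j
    refine card_mul_le_of_erase (T := T) (w := v) (fun s => Lf T s v) (fun s hs => ?_)
      fun g hg => ?_
    · obtain ⟨hs, hg⟩ := Finset.mem_filter.1 hs
      obtain ⟨hs, hRs⟩ := mem_vSet.1 hs
      refine ⟨subset_rfl, hs.lf.ge, fun l hl => Finset.mem_filter.2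
        ⟨mem_vSet.2 ⟨hs.erase hT (by omega) hl, hR.erase hT (by omega) hs hl hRs⟩,
          hg.erase hT hs.cfg.conv hs.cfg.mem hl ?_⟩⟩
      rw [hs.nb_v]
      omega
    · rw [(mem_vSet.1 (Finset.mem_filter.1 hg).1).1.card_free]
      omega
  refine (le_mul_of_two_steps (K := 6) (key (p + 1)) (key p) ?_ (by positivity)).trans
    (Nat.mul_le_mul_left _ (Finset.card_le_card
      (Finset.monotone_filter_right _ fun g _ hg => hg.farGate)))
  have e1 : 2 * (p + 2) - (p + 1) = p + 3 := by omega
  have e2 : 2 * (p + 2) - p = p + 4 := by omega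
  rw [e1, e2]
  nlinarith

lemma vSet_le_of_near (hT : T.IsTree) (hR : LeafInv T v R) (h2 : 2 ≤ X.card) {r₁ r₂ : V}
    (hr : n + (p + 2) + 2 ≤ T.dist r₁ r₂)
    (ha : (nb T Finset.univ v).card - X.card ≤ 2 * (p + 2)) :
    (vSet T k X ι n R (p + 2) v).card ≤
      (3 * ((vSet T k X ι n R (p + 1) v).filter (LeafGate T r₁)).card +
        6 * ((vSet T k X ι n R p v).filter (FarGate T r₁)).card) +
      (3 * ((vSet T k X ι n R (p + 1) v).filter (LeafGate T r₂)).card +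
        6 * ((vSet T k X ι n R p v).filter (FarGate T r₂)).card) := by
  have l1 := vSet_leaf_le hT hR (k := k) (ι := ι) (n := n) h2 r₁ ha
  have l2 := vSet_leaf_le hT hR (k := k) (ι := ι) (n := n) h2 r₂ ha
  have i1 := vSet_inner_le hT hR (k := k) (ι := ι) (n := n) h2 r₁ ha
  have i2 := vSet_inner_le hT hR (k := k) (ι := ι) (n := n) h2 r₂ ha
  have hsub : vSet T k X ι n R (p + 2) v ⊆
      ((vSet T k X ι n R (p + 2) v).filter (LeafGate T r₁) ∪
        (vSet T k X ι n R (p + 2) v).filter (InnerGate T r₁)) ∪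
      ((vSet T k X ι n R (p + 2) v).filter (LeafGate T r₂) ∪
        (vSet T k X ι n R (p + 2) v).filter (InnerGate T r₂)) := by
    intro s hs
    have hs' := (mem_vSet.1 hs).1
    simp only [Finset.mem_union, Finset.mem_filter, hs, true_and]
    exact exists_leafGate_or_innerGate hT hs'.cfg.conv (by rw [hs'.card]; exact hr)
  have h1 := (Finset.card_le_card hsub).trans (Finset.card_union_le _ _)
  have h2 := Finset.card_union_le
    ((vSet T k X ι n R (p + 2) v).filter (LeafGate T r₁))
    ((vSet T k X ι n R (p + 2) v).filter (InnerGate T r₁))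
  have h3 := Finset.card_union_le
    ((vSet T k X ι n R (p + 2) v).filter (LeafGate T r₂))
    ((vSet T k X ι n R (p + 2) v).filter (InnerGate T r₂))
  omega

end VertexMoves

section SmallForks

open scoped Classical

variable {V : Type*} {T : SimpleGraph V}

variable {k : ℕ} {X : Multiset ℕ} {ι n p q F : ℕ} {g s : Finset V} {v u l : V}

lemma Nl_eq_singleton {v u : V} (hv : v ∈ s) (h2 : 2 ≤ (nb T s v).card)
    (hu : u ∈ Fk T s v q) : Nl T s u = {v} := by
  obtain ⟨hu1, -, hu3⟩ := mem_Fk.1 hu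
  obtain ⟨z, hz⟩ := Finset.card_eq_one.1 hu3
  have : v ∈ Nl T s u := mem_Nl.2 ⟨⟨hv, (mem_Nl.1 hu1).1.2.symm⟩, by omega⟩
  rw [hz, Finset.mem_singleton] at this
  rw [hz, this]

lemma card_beh_of_mem_Fk (hT : T.IsTree) (hs : Conv T s) (hv : v ∈ s)
    (h2 : 2 ≤ (nb T s v).card) (hu : u ∈ Fk T s v q) : (beh T s v u).card = q + 1 := by
  have hNl := Nl_eq_singleton hv h2 hu
  obtain ⟨hu1, hu2, -⟩ := mem_Fk.1 hu
  obtain ⟨⟨hus, hadj⟩, -⟩ := mem_Nl.1 hu1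
  have hbeh : beh T s v u = insert u (Lf T s u) := by
    ext z
    simp only [mem_beh, Finset.mem_insert]
    constructor
    · rintro ⟨hz, hg⟩
      by_contra! hcon
      obtain ⟨w, hw, hd⟩ := exists_adj_dist_succ hT (Ne.symm hcon.1)
      have hws : w ∈ s := hs.2 u hus z hz w ((geod_of_adj_iff hw).2 hd)
      have hd' := (geod_of_adj_iff hadj).1 hg
      have hwv : w ≠ v := by rintro rfl; omega
      have hwl : (nb T s w).card = 1 := by
        by_contra h
        have : w ∈ Nl T s u := mem_Nl.2 ⟨⟨hws, hw⟩, h⟩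
        rw [hNl, Finset.mem_singleton] at this
        exact hwv this
      have hwz : w ≠ z := by
        rintro rfl
        exact hcon.2 (mem_Lf.2 ⟨⟨hws, hw⟩, hwl⟩)
      obtain ⟨x, hx, hdx⟩ := exists_adj_dist_succ hT hwz
      have hxs : x ∈ s := hs.2 w hws z hz x ((geod_of_adj_iff hx).2 hdx)
      have hux : u ≠ x := by rintro rfl; omega
      have := Finset.card_le_one.1 hwl.le u (mem_nb.2 ⟨hus, hw.symm⟩) x (mem_nb.2 ⟨hxs, hx⟩)
      exact hux this
    · rintro (rfl | hz)
      · exact ⟨hus, by unfold Geod; simp⟩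
      · obtain ⟨⟨hzs, huz⟩, hz1⟩ := mem_Lf.1 hz
        have hvz : v ≠ z := by rintro rfl; omega
        refine ⟨hzs, (geod_of_adj_iff hadj).2 ?_⟩
        rw [dist_adj_adj hT hadj huz hvz, dist_eq_one_iff_adj.2 huz]
  rw [hbeh, Finset.card_insert_of_notMem (fun h => T.irrefl (mem_Lf.1 h).1.2), hu2]

lemma Sz_eq_cons (hu : u ∈ Nl T s v) :
    Sz T s v = (beh T s v u).card ::ₘ
      ((Nl T s v).erase u).val.map fun n => (beh T s v n).card := by
  conv_lhs => rw [Sz, ← Finset.insert_erase hu]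
  rw [Finset.insert_val_of_notMem (Finset.notMem_erase _ _), Multiset.map_cons]

/-- Adding a leaf to a fork at `v`. -/
lemma Pend.vst_fork (hT : T.IsTree) (hP : Pend T g u l) (hu : u ∈ Fk T g v q) (hq : 1 ≤ q)
    (h : VSt T k ((q + 1) ::ₘ X) ι n p g v) :
    VSt T k ((q + 2) ::ₘ X) ι (n + 1) p (insert l g) v := by
  obtain ⟨hu1, hu2, hu3⟩ := mem_Fk.1 hu
  obtain ⟨⟨hus, hadj⟩, -⟩ := mem_Nl.1 hu1
  have h2 : 2 ≤ (nb T g u).card := by rw [← card_Lf_add_card_Nl]; omega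
  have hb := card_beh_of_mem_Fk hT h.cfg.conv h.cfg.mem h.cfg.int hu
  have hvl : v ≠ l := fun h' => hP.nmem (h' ▸ h.cfg.mem)
  have hb' := hP.card_beh_base (v := v) ((geod_of_adj_iff hadj).2 (by
    rw [dist_adj_adj hT hadj hP.adj hvl, dist_eq_one_iff_adj.2 hP.adj]))
  refine ⟨⟨hP.conv_insert hT, Finset.mem_insert_of_mem h.cfg.mem, ?_, ?_, ?_⟩, ?_, ?_, ?_⟩
  · rw [hP.nb_other hT h.cfg.mem hadj.ne]
    exact h.cfg.int
  · have hsz := h.cfg.sz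
    rw [Sz_eq_cons hu1, hb, Multiset.cons_inj_right] at hsz
    rw [Sz_eq_cons (by rwa [hP.Nl_old hT h2]), hb', hb, ← hsz, hP.Nl_old hT h2]
    congr 1
    refine Multiset.map_congr rfl fun z hz => ?_
    obtain ⟨hzu, hz⟩ := Finset.mem_erase.1 hz
    have hz := mem_Nl.1 hz
    rw [hP.beh_same hT (Or.inr hadj) hz.1.1 hz.1.2.ne' hzu]
  · exact (hP.hub_iff hT h2 (Or.inr hadj) (Or.inr (by omega))).2 h.cfg.hub
  · rw [hP.Lf_other hT h2 h.cfg.mem hadj.ne, h.lf]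
  · rw [Finset.card_insert_of_notMem hP.nmem, h.card]
    omega
  · rw [hP.Intr_eq hT h2, h.intr]

lemma Pend.Fk_fork (hT : T.IsTree) (hP : Pend T g u l) (hu : u ∈ Fk T g v q) (hq : 1 ≤ q) :
    Fk T (insert l g) v (q + 1) = insert u (Fk T g v (q + 1)) := by
  obtain ⟨hu1, hu2, hu3⟩ := mem_Fk.1 hu
  have h2 : 2 ≤ (nb T g u).card := by rw [← card_Lf_add_card_Nl]; omega
  ext z
  rw [Finset.mem_insert]
  by_cases hzu : z = u
  · subst hzu
    have := hP.card_Lf_base hT h2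
    simp only [true_or, iff_true]
    exact mem_Fk.2 ⟨by rwa [hP.Nl_old hT h2], by omega, by rwa [hP.Nl_old hT h2]⟩
  · rw [hP.mem_Fk_iff hT h2 hzu]
    simp [hzu]

lemma Pend.Fk_eq (hT : T.IsTree) (hP : Pend T g v l) (h2 : 2 ≤ (nb T g v).card) (j : ℕ) :
    Fk T (insert l g) v j = Fk T g v j := by
  ext z
  by_cases hz : z = v
  · subst hz
    simp [mem_Fk, notMem_Nl_self]
  · exact hP.mem_Fk_iff hT h2 hz

variable [Fintype V]

/-- The number of vertices beyond `x`. -/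
noncomputable def ahead (T : SimpleGraph V) (x : V) : ℕ := (nb T Finset.univ x).card - 1

/-- The number of ways to choose a fork of order one at `v` that avoids the non-leaf neighbours
of `v` in `g`. -/
noncomputable def outer (T : SimpleGraph V) (v : V) (g : Finset V) : ℕ :=
  ∑ x ∈ nb T Finset.univ v \ Nl T g v, ahead T x

/-- The number of ways to enlarge a fork of order one at `v`. -/
noncomputable def inner (T : SimpleGraph V) (v : V) (g : Finset V) : ℕ :=
  ∑ u ∈ Fk T g v 1, (ahead T u - 1)

lemma mul_card_le_of_remove_prong (hT : T.IsTree) {𝓐 : Finset (Finset V)} {m d : ℕ}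
    (hp : 3 ≤ p + (X.card + 1))
    (h𝓐 : ∀ s ∈ 𝓐, VSt T k (2 ::ₘ X) (ι + 1) (n + 2) p s v ∧ (Fk T s v 1).card = F ∧
      (outer T v s + inner T v s + F) * m ≤ d) :
    F * m * 𝓐.card ≤ d * (vSet T k X ι n (fun _ => True) p v).card := by
  set 𝓒 := (vSet T k X ι n (fun _ => True) p v).filter
    fun g => (∑ u ∈ free T g v, ahead T u) * m ≤ d with h𝓒
  have h1 : (𝓐.sigma fun s => Fk T s v 1).card ≤
      (𝓒.sigma fun g => (free T g v).sigma fun u => (nb T Finset.univ u).erase v).card := by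
    refine (Finset.card_le_card (t := (𝓒.sigma fun g => (free T g v).sigma
      fun u => (nb T Finset.univ u).erase v).image fun z =>
        (⟨insert z.2.2 (insert z.2.1 z.1), z.2.1⟩ : (_ : Finset V) × V)) ?_).trans
          Finset.card_image_le
    rintro ⟨s, u⟩ hsu
    obtain ⟨hs, hu⟩ := Finset.mem_sigma.1 hsu
    simp only at hs hu
    obtain ⟨hst, hF, hd⟩ := h𝓐 s hs
    obtain ⟨g, x, hP, rfl⟩ := exists_prong hT hst.cfg.conv hst.cfg.mem
      (by rw [hst.nb_v, Multiset.card_cons]; omega) hu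
    have hc1 := Finset.card_insert_of_notMem hP.tip.nmem
    have hc2 := Finset.card_insert_of_notMem hP.base.nmem
    have hc3 := hP.card_Intr hT
    have hc4 := hst.card
    have hc5 := hst.intr
    refine Finset.mem_image.2 ⟨⟨g, u, x⟩, ?_, rfl⟩
    refine Finset.mem_sigma.2 ⟨Finset.mem_filter.2 ⟨mem_vSet.2 ⟨⟨(hP.cfg_iff hT).1 hst.cfg,
      by rw [← hP.Lf_base hT, hst.lf], (by omega : g.card = n + p),
        (by omega : (Intr T g).card = ι)⟩, trivial⟩, ?_⟩,
      Finset.mem_sigma.2 ⟨mem_free.2 ⟨hP.base.adj, hP.base.nmem⟩,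
        Finset.mem_erase.2 ⟨hP.ne, mem_nb.2 ⟨Finset.mem_univ _, hP.tip.adj⟩⟩⟩⟩
    refine le_trans (Nat.mul_le_mul_right _ ?_) hd
    have hsub : free T g v ⊆
        insert u (nb T Finset.univ v \ Nl T (insert x (insert u g)) v) := by
      intro z hz
      obtain ⟨hz1, hz2⟩ := mem_free.1 hz
      rw [hP.Nl_base hT]
      by_cases hzu : z = u
      · simp [hzu]
      · refine Finset.mem_insert_of_mem (Finset.mem_sdiff.2 ⟨mem_nb.2 ⟨Finset.mem_univ _, hz1⟩, ?_⟩)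
        simp only [Finset.mem_insert, not_or]
        exact ⟨hzu, fun h => hz2 (mem_Nl.1 h).1.1⟩
    have h2 : ahead T u ≤ inner T v (insert x (insert u g)) + F := by
      have h3 : ∑ z ∈ Fk T (insert x (insert u g)) v 1, ahead T z ≤
          inner T v (insert x (insert u g)) + F := by
        rw [← hF, inner, Finset.card_eq_sum_ones, ← Finset.sum_add_distrib]
        exact Finset.sum_le_sum fun z _ => by omega
      exact le_trans (Finset.single_le_sum (f := ahead T) (fun _ _ => Nat.zero_le _) hu) h3
    have h4 := Finset.sum_le_sum_of_subset (f := ahead T) hsub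
    have h5 : ∑ z ∈ insert u (nb T Finset.univ v \ Nl T (insert x (insert u g)) v), ahead T z ≤
        ahead T u + outer T v (insert x (insert u g)) := by
      rw [Finset.sum_insert]
      · exact le_rfl
      · rw [hP.Nl_base hT]
        simp
    show ∑ z ∈ free T g v, ahead T z ≤ _
    omega
  rw [Finset.card_sigma, Finset.card_sigma, Finset.sum_congr rfl fun s hs => (h𝓐 s hs).2.1,
    Finset.sum_const, smul_eq_mul] at h1
  calc F * m * 𝓐.card = 𝓐.card * F * m := by ring
    _ ≤ (∑ g ∈ 𝓒, ((free T g v).sigma fun u => (nb T Finset.univ u).erase v).card) * m :=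
      Nat.mul_le_mul_right _ h1
    _ = ∑ g ∈ 𝓒, (∑ u ∈ free T g v, ahead T u) * m := by
      rw [Finset.sum_mul]
      refine Finset.sum_congr rfl fun g _ => ?_
      rw [Finset.card_sigma]
      congr 1
      refine Finset.sum_congr rfl fun u hu => ?_
      rw [ahead, Finset.card_erase_of_mem]
      exact mem_nb.2 ⟨Finset.mem_univ _, (mem_free.1 hu).1.symm⟩
    _ ≤ ∑ g ∈ 𝓒, d := Finset.sum_le_sum fun g hg => (Finset.mem_filter.1 hg).2
    _ = d * 𝓒.card := by simp [mul_comm]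
    _ ≤ _ := Nat.mul_le_mul_left _ (Finset.card_le_card (Finset.filter_subset _ _))

end SmallForks

section ProngMoves

open scoped Classical

variable {V : Type*} {T : SimpleGraph V} [Fintype V]

variable {k : ℕ} {X : Multiset ℕ} {ι n p q F ω c m : ℕ} {g s : Finset V} {v u l : V}

lemma prong_of_free (hT : T.IsTree) (hg : Conv T g) (hv : v ∈ g) (h2 : 2 ≤ (nb T g v).card)
    {x y : V} (hx : x ∈ free T g v) (hy : y ∈ (nb T Finset.univ x).erase v) :
    Prong T g v x y := by
  obtain ⟨hx1, hx2⟩ := mem_free.1 hx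
  obtain ⟨hyv, hy⟩ := Finset.mem_erase.1 hy
  have hxy := (mem_nb.1 hy).2
  have hP : Pend T g v x := ⟨hg, hv, hx2, hx1⟩
  refine ⟨hg, h2, hP, hP.conv_insert hT, Finset.mem_insert_self _ _, ?_, hxy⟩
  rw [Finset.mem_insert, not_or]
  refine ⟨hxy.ne', fun hyg => hx2 (hg.2 v hv y hyg x ?_)⟩
  rw [geod_of_adj_iff hx1, dist_adj_adj hT hx1 hxy hyv.symm, dist_eq_one_iff_adj.2 hxy]

lemma VSt.outer_eq (h : VSt T k X ι n 0 g v) :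
    outer T v g = ∑ x ∈ free T g v, ((nb T Finset.univ x).erase v).card := by
  have h0 : Lf T g v = ∅ := Finset.card_eq_zero.1 h.lf
  have : nb T Finset.univ v \ Nl T g v = free T g v := by
    ext z
    rw [Finset.mem_sdiff, mem_nb, mem_free]
    constructor
    · rintro ⟨⟨-, hz⟩, hz'⟩
      refine ⟨hz, fun hzg => ?_⟩
      by_cases h1 : (nb T g z).card = 1
      · have : z ∈ Lf T g v := mem_Lf.2 ⟨⟨hzg, hz⟩, h1⟩
        simp [h0] at this
      · exact hz' (mem_Nl.2 ⟨⟨hzg, hz⟩, h1⟩)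
    · rintro ⟨hz, hzg⟩
      exact ⟨⟨Finset.mem_univ _, hz⟩, fun h => hzg (mem_Nl.1 h).1.1⟩
  rw [outer, this]
  refine Finset.sum_congr rfl fun x hx => ?_
  rw [ahead, Finset.card_erase_of_mem]
  exact mem_nb.2 ⟨Finset.mem_univ _, (mem_free.1 hx).1.symm⟩

lemma mul_card_le_of_attach_prong (hT : T.IsTree) {𝓐 : Finset (Finset V)}
    (h𝓐 : ∀ g ∈ 𝓐, VSt T k X ι n 0 g v ∧ (Fk T g v 1).card = F ∧ c ≤ m * outer T v g) :
    c * 𝓐.card ≤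
      m * ((F + 1) * (vSet T k (2 ::ₘ X) (ι + 1) (n + 2) (fun _ => True) 0 v).card) := by
  set 𝓓 := (vSet T k (2 ::ₘ X) (ι + 1) (n + 2) (fun _ => True) 0 v).filter
    fun s => (Fk T s v 1).card = F + 1 with h𝓓
  have h1 : (𝓐.sigma fun g => (free T g v).sigma fun x => (nb T Finset.univ x).erase v).card ≤
      (𝓓.sigma fun s => Fk T s v 1).card := by
    refine Finset.card_le_card_of_injOn
      (fun z => (⟨insert z.2.2 (insert z.2.1 z.1), z.2.1⟩ : (_ : Finset V) × V)) ?_ ?_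
    · rintro ⟨g, x, y⟩ hz
      obtain ⟨hg, hz⟩ := Finset.mem_sigma.1 hz
      obtain ⟨hx, hy⟩ := Finset.mem_sigma.1 hz
      obtain ⟨hst, hF, -⟩ := h𝓐 g hg
      simp only at hx hy
      have hP := prong_of_free hT hst.cfg.conv hst.cfg.mem hst.cfg.int hx hy
      have hc1 := Finset.card_insert_of_notMem hP.tip.nmem
      have hc2 := Finset.card_insert_of_notMem hP.base.nmem
      have hc3 := hP.card_Intr hT
      have hc4 := hst.card
      have hc5 := hst.intr
      have hF1 : (Fk T (insert y (insert x g)) v 1).card = F + 1 := by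
        rw [hP.Fk_one hT, Finset.card_insert_of_notMem, hF]
        exact fun h => hP.notMem_Nl (mem_Fk.1 h).1
      exact Finset.mem_sigma.2 ⟨Finset.mem_filter.2 ⟨mem_vSet.2 ⟨⟨(hP.cfg_iff hT).2 hst.cfg,
        by rw [hP.Lf_base hT, hst.lf],
        (by omega : (insert y (insert x g)).card = n + 2 + 0),
        (by omega : (Intr T (insert y (insert x g))).card = ι + 1)⟩, trivial⟩, hF1⟩,
        by rw [hP.Fk_one hT]; exact Finset.mem_insert_self _ _⟩
    · rintro ⟨g, x, y⟩ hz ⟨g', x', y'⟩ hz' heq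
      obtain ⟨hg, hz⟩ := Finset.mem_sigma.1 hz
      obtain ⟨hx, hy⟩ := Finset.mem_sigma.1 hz
      obtain ⟨hg', hz'⟩ := Finset.mem_sigma.1 hz'
      obtain ⟨hx', hy'⟩ := Finset.mem_sigma.1 hz'
      have hst := (h𝓐 g hg).1
      have hst' := (h𝓐 g' hg').1
      have hP := prong_of_free hT hst.cfg.conv hst.cfg.mem hst.cfg.int hx hy
      have hP' := prong_of_free hT hst'.cfg.conv hst'.cfg.mem hst'.cfg.int hx' hy'
      simp only [Sigma.mk.injEq, heq_eq_eq] at heq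
      obtain ⟨h1, rfl⟩ := heq
      have h2 := hP.Lf_mid hT
      rw [h1, hP'.Lf_mid hT, Finset.singleton_inj] at h2
      subst h2
      have h3 := congrArg (fun s => (s.erase y').erase x) h1
      simp only [Finset.erase_insert hP.tip.nmem, Finset.erase_insert hP'.tip.nmem,
        Finset.erase_insert hP.base.nmem, Finset.erase_insert hP'.base.nmem] at h3
      rw [h3]
  rw [Finset.card_sigma, Finset.card_sigma,
    Finset.sum_congr rfl fun s hs => (Finset.mem_filter.1 hs).2, Finset.sum_const,
    smul_eq_mul] at h1
  calc c * 𝓐.card = ∑ g ∈ 𝓐, c := by simp [mul_comm]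
    _ ≤ ∑ g ∈ 𝓐, m * ((free T g v).sigma fun x => (nb T Finset.univ x).erase v).card :=
      Finset.sum_le_sum fun g hg => by
        rw [Finset.card_sigma, ← (h𝓐 g hg).1.outer_eq]
        exact (h𝓐 g hg).2.2
    _ ≤ m * (𝓓.card * (F + 1)) := by
      rw [← Finset.mul_sum]
      exact Nat.mul_le_mul_left _ h1
    _ ≤ _ := by
      rw [mul_comm 𝓓.card]
      exact Nat.mul_le_mul_left _ (Nat.mul_le_mul_left _
        (Finset.card_le_card (Finset.filter_subset _ _)))

/-- The part of the statistics of `g` that is sensitive to the order of the forks at `v`. -/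
def OmAt (T : SimpleGraph V) (ω : ℕ) (v : V) (g : Finset V) : Prop :=
  2 ≤ (Nl T g v).card ∧ Om T g = ω + (Lf T g v).card

omit [Fintype V] in
lemma leafInv_omAt (hT : T.IsTree) : LeafInv T v (OmAt T ω v) := by
  intro g l hP h2
  rw [OmAt, OmAt, hP.Nl_old hT h2, hP.Om_eq hT h2, hP.card_Lf_base hT h2]
  refine and_congr_right fun h => ?_
  rw [if_pos h]
  omega

lemma mul_card_le_of_extend_fork (hT : T.IsTree) {𝓐 : Finset (Finset V)}
    (h𝓐 : ∀ g ∈ 𝓐, (VSt T k (2 ::ₘ X) ι n 0 g v ∧ OmAt T ω v g) ∧ (Fk T g v 2).card ≤ F ∧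
      c ≤ m * inner T v g) :
    c * 𝓐.card ≤
      m * ((2 * (F + 1)) * (vSet T k (3 ::ₘ X) ι (n + 1) (OmAt T ω v) 0 v).card) := by
  set 𝓓 := (vSet T k (3 ::ₘ X) ι (n + 1) (OmAt T ω v) 0 v).filter
    fun s => (Fk T s v 2).card ≤ F + 1 with h𝓓
  have hfree : ∀ g ∈ 𝓐, ∀ u ∈ Fk T g v 1, ∀ y ∈ free T g u, Pend T g u y ∧
      2 ≤ (nb T g u).card := by
    intro g hg u hu y hy
    obtain ⟨hu1, hu2, hu3⟩ := mem_Fk.1 hu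
    obtain ⟨hy1, hy2⟩ := mem_free.1 hy
    refine ⟨⟨(h𝓐 g hg).1.1.cfg.conv, (mem_Nl.1 hu1).1.1, hy2, hy1⟩, ?_⟩
    rw [← card_Lf_add_card_Nl]
    omega
  have h1 : (𝓐.sigma fun g => (Fk T g v 1).sigma fun u => free T g u).card ≤
      (𝓓.sigma fun s => (Fk T s v 2).sigma fun u => Lf T s u).card := by
    refine Finset.card_le_card_of_injOn
      (fun z => (⟨insert z.2.2 z.1, z.2⟩ : (_ : Finset V) × (_ : V) × V)) ?_ ?_
    · rintro ⟨g, u, y⟩ hz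
      obtain ⟨hg, hz⟩ := Finset.mem_sigma.1 hz
      obtain ⟨hu, hy⟩ := Finset.mem_sigma.1 hz
      obtain ⟨⟨hst, hN, hOm⟩, hF, -⟩ := h𝓐 g hg
      obtain ⟨hP, h2⟩ := hfree g hg u hu y hy
      simp only at hu
      have hvs := hP.vst_fork hT hu le_rfl hst
      have hu3 := (mem_Fk.1 hu).2.2
      have hF1 := hP.Fk_fork hT hu le_rfl
      have hF2 : (Fk T (insert y g) v 2).card ≤ F + 1 := by
        rw [hF1]
        exact (Finset.card_insert_le _ _).trans (by simpa using hF)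
      have hOm' : OmAt T ω v (insert y g) := by
        refine ⟨by rwa [hP.Nl_old hT h2], ?_⟩
        rw [hP.Om_eq hT h2, if_neg (by omega), hOm, hst.lf, hvs.lf]
      refine Finset.mem_sigma.2 ⟨Finset.mem_filter.2 ⟨mem_vSet.2 ⟨hvs, hOm'⟩, hF2⟩,
        Finset.mem_sigma.2 ⟨by rw [hF1]; exact Finset.mem_insert_self _ _, mem_Lf.2
          ⟨⟨Finset.mem_insert_self _ _, hP.adj⟩, ?_⟩⟩⟩
      show (nb T (insert y g) y).card = 1
      rw [hP.nb_new hT, Finset.card_singleton]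
    · rintro ⟨g, u, y⟩ hz ⟨g', u', y'⟩ hz' heq
      obtain ⟨hg, hz⟩ := Finset.mem_sigma.1 hz
      obtain ⟨hu, hy⟩ := Finset.mem_sigma.1 hz
      obtain ⟨hg', hz'⟩ := Finset.mem_sigma.1 hz'
      obtain ⟨hu', hy'⟩ := Finset.mem_sigma.1 hz'
      have hP := (hfree g hg u hu y hy).1
      have hP' := (hfree g' hg' u' hu' y' hy').1
      simp only [Sigma.mk.injEq, heq_eq_eq] at heq
      obtain ⟨h1, rfl, rfl⟩ := heq
      have h3 := congrArg (fun s => s.erase y) h1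
      simp only [Finset.erase_insert hP.nmem, Finset.erase_insert hP'.nmem] at h3
      rw [h3]
  have h4 : (𝓓.sigma fun s => (Fk T s v 2).sigma fun u => Lf T s u).card ≤
      𝓓.card * (2 * (F + 1)) := by
    rw [Finset.card_sigma, ← smul_eq_mul, ← Finset.sum_const]
    refine Finset.sum_le_sum fun s hs => ?_
    rw [Finset.card_sigma, Finset.sum_congr rfl fun u hu => (mem_Fk.1 hu).2.1,
      Finset.sum_const, smul_eq_mul, mul_comm]
    exact Nat.mul_le_mul_left _ (Finset.mem_filter.1 hs).2
  rw [Finset.card_sigma] at h1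
  calc c * 𝓐.card = ∑ g ∈ 𝓐, c := by simp [mul_comm]
    _ ≤ ∑ g ∈ 𝓐, m * ((Fk T g v 1).sigma fun u => free T g u).card :=
      Finset.sum_le_sum fun g hg => by
        refine (h𝓐 g hg).2.2.trans (Nat.mul_le_mul_left _ ?_)
        rw [Finset.card_sigma]
        refine Finset.sum_le_sum fun u hu => ?_
        obtain ⟨-, hu2, hu3⟩ := mem_Fk.1 hu
        have h5 := card_free_add (T := T) g u
        rw [← card_Lf_add_card_Nl g u] at h5
        rw [ahead]
        omega
    _ ≤ m * (𝓓.card * (2 * (F + 1))) := by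
      rw [← Finset.mul_sum]
      exact Nat.mul_le_mul_left _ (h1.trans h4)
    _ ≤ _ := by
      rw [mul_comm 𝓓.card]
      exact Nat.mul_le_mul_left _ (Nat.mul_le_mul_left _
        (Finset.card_le_card (Finset.filter_subset _ _)))

end ProngMoves

section ProngCounts

lemma le_four_mul {F p b A c₀ c₁ c₂ : ℕ} (hF : 1 ≤ F)
    (h0 : F * ((p + 3) * (p + 4)) * A ≤ 2 * F * ((2 * p + 6 + b) * (p + 3 + b)) * c₀)
    (h1 : (p + 4 + b) * c₀ ≤ (p + 3) * c₁) (h2 : (p + 3 + b) * c₁ ≤ (p + 4) * c₂) :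
    A ≤ 4 * c₂ := by
  refine Nat.le_of_mul_le_mul_left ?_ (by positivity : 0 < F * ((p + 3) * (p + 4)))
  calc F * ((p + 3) * (p + 4)) * A ≤ 2 * F * ((2 * p + 6 + b) * (p + 3 + b)) * c₀ := h0
    _ ≤ 2 * F * ((2 * (p + 4 + b)) * (p + 3 + b)) * c₀ := by gcongr; omega
    _ = 4 * F * (p + 3 + b) * ((p + 4 + b) * c₀) := by ring
    _ ≤ 4 * F * (p + 3 + b) * ((p + 3) * c₁) := by gcongr
    _ = 4 * F * (p + 3) * ((p + 3 + b) * c₁) := by ring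
    _ ≤ 4 * F * (p + 3) * ((p + 4) * c₂) := by gcongr
    _ = _ := by ring

lemma mul_le_of_succ {F P Q A B m : ℕ} (hF : 1 ≤ F)
    (h : 2 * F * Q * A ≤ 3 * P * (m * (F + 1) * B)) : Q * A ≤ 3 * P * (m * B) := by
  refine Nat.le_of_mul_le_mul_left ?_ (by omega : 0 < 2 * F)
  calc 2 * F * (Q * A) = 2 * F * Q * A := by ring
    _ ≤ 3 * P * (m * (F + 1) * B) := h
    _ ≤ 3 * P * (m * (F + F) * B) := by gcongr
    _ = _ := by ring

lemma choose_mul_eq (a p : ℕ) :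
    (a + 1).choose (p + 2) * ((p + 2) * (p + 1)) = a.choose p * ((a + 1) * (a - p)) := by
  have h1 := Nat.add_one_mul_choose_eq a (p + 1)
  have h2 := Nat.choose_succ_right_eq a p
  calc (a + 1).choose (p + 2) * ((p + 2) * (p + 1))
      = ((a + 1).choose (p + 1 + 1) * (p + 1 + 1)) * (p + 1) := by ring
    _ = (a + 1) * (a.choose (p + 1) * (p + 1)) := by rw [← h1]; ring
    _ = _ := by rw [h2]; ring

lemma le_thirty_six_mul {p b A A₀ B B₀ : ℕ}
    (h0 : (2 * p + 6 + b) * (p + 3 + b) * A₀ ≤ 3 * ((p + 3) * (p + 4)) * (1 * B₀))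
    (h1 : A ≤ (2 * p + 5 + b).choose (p + 2) * A₀)
    (h2 : (2 * p + 4 + b).choose p * B₀ ≤ B) : A ≤ 36 * B := by
  have h3 := choose_mul_eq (2 * p + 4 + b) p
  rw [show 2 * p + 4 + b - p = p + 4 + b by omega] at h3
  refine Nat.le_of_mul_le_mul_left ?_
    (by positivity : 0 < (2 * p + 6 + b) * (p + 3 + b) * ((p + 2) * (p + 1)))
  calc (2 * p + 6 + b) * (p + 3 + b) * ((p + 2) * (p + 1)) * A
      ≤ (2 * p + 6 + b) * (p + 3 + b) * ((p + 2) * (p + 1)) *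
        ((2 * p + 5 + b).choose (p + 2) * A₀) := by gcongr
    _ = ((2 * p + 4 + b + 1).choose (p + 2) * ((p + 2) * (p + 1))) *
        ((2 * p + 6 + b) * (p + 3 + b) * A₀) := by
      rw [show 2 * p + 4 + b + 1 = 2 * p + 5 + b by ring]; ring
    _ ≤ ((2 * p + 4 + b + 1).choose (p + 2) * ((p + 2) * (p + 1))) *
        (3 * ((p + 3) * (p + 4)) * (1 * B₀)) := by gcongr
    _ = 3 * ((p + 3) * (p + 4)) * ((2 * p + 5 + b) * (p + 4 + b)) *
        ((2 * p + 4 + b).choose p * B₀) := by rw [h3]; ring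
    _ ≤ 3 * ((p + 3) * (p + 4)) * ((2 * p + 5 + b) * (p + 4 + b)) * B := by gcongr
    _ ≤ 3 * (6 * ((p + 2) * (p + 1))) * ((2 * p + 6 + b) * (2 * (p + 3 + b))) * B := by
      gcongr 3 * ?_ * (?_ * ?_) * B
      · nlinarith
      · omega
      · omega
    _ = _ := by ring

lemma le_twelve_mul {p b A A₀ B B₀ : ℕ}
    (h0 : (2 * p + 6 + b) * (p + 3 + b) * A₀ ≤ 3 * ((p + 3) * (p + 4)) * (2 * B₀))
    (h1 : A ≤ (2 * p + 5 + b).choose (p + 2) * A₀)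
    (h2 : (2 * p + 5 + b).choose (p + 1) * B₀ ≤ B) : A ≤ 12 * B := by
  have h3 := Nat.choose_succ_right_eq (2 * p + 5 + b) (p + 1)
  rw [show 2 * p + 5 + b - (p + 1) = p + 4 + b by omega] at h3
  refine Nat.le_of_mul_le_mul_left ?_
    (by positivity : 0 < (2 * p + 6 + b) * (p + 3 + b) * (p + 2))
  calc (2 * p + 6 + b) * (p + 3 + b) * (p + 2) * A
      ≤ (2 * p + 6 + b) * (p + 3 + b) * (p + 2) *
        ((2 * p + 5 + b).choose (p + 2) * A₀) := by gcongr
    _ = ((2 * p + 5 + b).choose (p + 1 + 1) * (p + 1 + 1)) *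
        ((2 * p + 6 + b) * (p + 3 + b) * A₀) := by ring
    _ ≤ ((2 * p + 5 + b).choose (p + 1 + 1) * (p + 1 + 1)) *
        (3 * ((p + 3) * (p + 4)) * (2 * B₀)) := by gcongr
    _ = 6 * ((p + 3) * (p + 4)) * (p + 4 + b) *
        ((2 * p + 5 + b).choose (p + 1) * B₀) := by rw [h3]; ring
    _ ≤ 6 * ((p + 3) * (p + 4)) * (p + 4 + b) * B := by gcongr
    _ ≤ 6 * ((p + 2) * (2 * p + 6 + b)) * (2 * (p + 3 + b)) * B := by
      gcongr 6 * ?_ * ?_ * B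
      · nlinarith
      · omega
    _ = _ := by ring

end ProngCounts

section SmallForkMoves

open scoped Classical

variable {V : Type*} {T : SimpleGraph V}

variable {k : ℕ} {X : Multiset ℕ} {ι n p q F ω c m : ℕ} {g s : Finset V} {v u l : V}

/-- The statistics of the forks at `v`. -/
def FkAt (T : SimpleGraph V) (ω F : ℕ) (v : V) (g : Finset V) : Prop :=
  OmAt T ω v g ∧ (Fk T g v 1).card = F ∧ (Fk T g v 2).card ≤ F

lemma LeafInv.and {R R' : Finset V → Prop} (h : LeafInv T v R) (h' : LeafInv T v R') :
    LeafInv T v fun g => R g ∧ R' g := fun g l hP h2 =>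
  and_congr (h g l hP h2) (h' g l hP h2)

lemma leafInv_true : LeafInv T v fun _ => True := fun _ _ _ _ => Iff.rfl

lemma leafInv_fkAt (hT : T.IsTree) : LeafInv T v (FkAt T ω F v) := by
  refine (leafInv_omAt hT).and fun g l hP h2 => ?_
  rw [hP.Fk_eq hT h2, hP.Fk_eq hT h2]

variable [Fintype V]

lemma leafInv_outer_inner (hT : T.IsTree) (f : ℕ → ℕ → Prop) :
    LeafInv T v fun g => f (outer T v g) (inner T v g) := by
  intro g l hP h2
  simp only [outer, inner, hP.Nl_old hT h2, hP.Fk_eq hT h2]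

lemma vSet_le_of_far (hT : T.IsTree) (hX : 1 ≤ X.card) (hF : 1 ≤ F)
    (ha : 2 * p + 5 ≤ (nb T Finset.univ v).card - (X.card + 1)) :
    (vSet T k (2 ::ₘ X) (ι + 1) (n + 2) (FkAt T ω F v) (p + 2) v).card ≤
      4 * (vSet T k X ι n (fun _ => True) (p + 4) v).card +
      36 * (vSet T k (2 ::ₘ 2 ::ₘ X) (ι + 2) (n + 4) (fun _ => True) p v).card +
      12 * (vSet T k (3 ::ₘ X) (ι + 1) (n + 3) (OmAt T ω v) (p + 1) v).card := by
  obtain ⟨b, hb⟩ := Nat.exists_eq_add_of_le ha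
  set P := (p + 3) * (p + 4) with hP
  set Q := (2 * p + 6 + b) * (p + 3 + b) with hQ
  have hPQ : 3 * P ≤ 2 * Q := by
    rw [hP, hQ]
    nlinarith
  let f : ℕ → ℕ → ℕ → Prop := fun i o e =>
    ((o + e + F) * P ≤ 2 * F * Q ↔ i = 1) ∧ (i = 2 → o + e + F ≤ 3 * o) ∧
      (i = 3 → o + e + F ≤ 3 * e)
  let R : ℕ → Finset V → Prop := fun i g => FkAt T ω F v g ∧ f i (outer T v g) (inner T v g)
  have hR : ∀ i, LeafInv T v (R i) := fun i =>
    (leafInv_fkAt hT).and (leafInv_outer_inner hT (f i))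
  have hcover : vSet T k (2 ::ₘ X) (ι + 1) (n + 2) (FkAt T ω F v) (p + 2) v ⊆
      vSet T k (2 ::ₘ X) (ι + 1) (n + 2) (R 1) (p + 2) v ∪
      vSet T k (2 ::ₘ X) (ι + 1) (n + 2) (R 2) (p + 2) v ∪
      vSet T k (2 ::ₘ X) (ι + 1) (n + 2) (R 3) (p + 2) v := by
    intro g hg
    obtain ⟨h1, h2⟩ := mem_vSet.1 hg
    simp only [Finset.mem_union, mem_vSet]
    by_cases c1 : (outer T v g + inner T v g + F) * P ≤ 2 * F * Q
    · exact Or.inl (Or.inl ⟨h1, h2, by simp [c1], by simp, by simp⟩)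
    by_cases c2 : outer T v g + inner T v g + F ≤ 3 * outer T v g
    · exact Or.inl (Or.inr ⟨h1, h2, by simp [c1], by simp [c2], by simp⟩)
    by_cases c3 : outer T v g + inner T v g + F ≤ 3 * inner T v g
    · exact Or.inr ⟨h1, h2, by simp [c1], by simp, by simp [c3]⟩
    refine absurd ?_ c1
    calc (outer T v g + inner T v g + F) * P ≤ (3 * F) * P :=
          Nat.mul_le_mul_right _ (by omega)
      _ = F * (3 * P) := by ring
      _ ≤ F * (2 * Q) := Nat.mul_le_mul_left _ hPQ
      _ = _ := by ring
  have hdeep : ∀ i, (vSet T k (2 ::ₘ X) (ι + 1) (n + 2) (R i) (p + 2) v).card ≤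
      (2 * p + 5 + b).choose (p + 2) *
        (vSet T k (2 ::ₘ X) (ι + 1) (n + 2) (R i) 0 v).card := by
    intro i
    have := vSet_le_choose hT (hR i) (k := k) (X := 2 ::ₘ X) (ι := ι + 1) (n := n + 2)
      (p := p + 2) (by rw [Multiset.card_cons]; omega)
    rwa [Multiset.card_cons, hb] at this
  have b1 : (vSet T k (2 ::ₘ X) (ι + 1) (n + 2) (R 1) (p + 2) v).card ≤
      4 * (vSet T k X ι n (fun _ => True) (p + 4) v).card := by
    have h1 := mul_card_le_of_remove_prong hT (v := v) (k := k) (X := X) (ι := ι) (n := n)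
      (p := p + 2) (F := F) (m := P) (d := 2 * F * Q)
      (𝓐 := vSet T k (2 ::ₘ X) (ι + 1) (n + 2) (R 1) (p + 2) v) (by omega) fun s hs => by
        obtain ⟨hs1, hs2, hs3, -⟩ := mem_vSet.1 hs
        exact ⟨hs1, hs2.2.1, hs3.2 rfl⟩
    have h2 := vSet_add hT leafInv_true (v := v) (k := k) (X := X) (ι := ι) (n := n) (p := p + 2)
    have h3 := vSet_add hT leafInv_true (v := v) (k := k) (X := X) (ι := ι) (n := n) (p := p + 3)
    rw [show (nb T Finset.univ v).card - X.card - (p + 2) = p + 4 + b by omega] at h2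
    rw [show (nb T Finset.univ v).card - X.card - (p + 3) = p + 3 + b by omega] at h3
    exact le_four_mul hF h1 h2 h3
  have b2 : (vSet T k (2 ::ₘ X) (ι + 1) (n + 2) (R 2) (p + 2) v).card ≤
      36 * (vSet T k (2 ::ₘ 2 ::ₘ X) (ι + 2) (n + 4) (fun _ => True) p v).card := by
    have h1 := mul_card_le_of_attach_prong hT (v := v) (k := k) (X := 2 ::ₘ X) (ι := ι + 1)
      (n := n + 2) (F := F) (m := 3 * P) (c := 2 * F * Q)
      (𝓐 := vSet T k (2 ::ₘ X) (ι + 1) (n + 2) (R 2) 0 v) fun s hs => by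
        obtain ⟨hs1, hs2, hs3, hs4, -⟩ := mem_vSet.1 hs
        refine ⟨hs1, hs2.2.1, ?_⟩
        have h5 := not_le.1 (hs3.not.2 (by omega))
        calc 2 * F * Q ≤ (outer T v s + inner T v s + F) * P := h5.le
          _ ≤ (3 * outer T v s) * P := Nat.mul_le_mul_right _ (hs4 rfl)
          _ = _ := by ring
    have h2 := choose_le_vSet hT leafInv_true (v := v) (k := k) (X := 2 ::ₘ 2 ::ₘ X)
      (ι := ι + 2) (n := n + 4) (p := p)
    rw [Multiset.card_cons, Multiset.card_cons, show (nb T Finset.univ v).card -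
      (X.card + 1 + 1) = 2 * p + 4 + b by omega] at h2
    refine le_thirty_six_mul (mul_le_of_succ hF (B := _) (m := 1) ?_) (hdeep 2) h2
    rwa [one_mul]
  have b3 : (vSet T k (2 ::ₘ X) (ι + 1) (n + 2) (R 3) (p + 2) v).card ≤
      12 * (vSet T k (3 ::ₘ X) (ι + 1) (n + 3) (OmAt T ω v) (p + 1) v).card := by
    have h1 := mul_card_le_of_extend_fork hT (v := v) (k := k) (X := X) (ι := ι + 1)
      (n := n + 2) (F := F) (m := 3 * P) (c := 2 * F * Q) (ω := ω)
      (𝓐 := vSet T k (2 ::ₘ X) (ι + 1) (n + 2) (R 3) 0 v) fun s hs => by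
        obtain ⟨hs1, hs2, hs3, -, hs4⟩ := mem_vSet.1 hs
        refine ⟨⟨hs1, hs2.1⟩, hs2.2.2, ?_⟩
        have h5 := not_le.1 (hs3.not.2 (by omega))
        calc 2 * F * Q ≤ (outer T v s + inner T v s + F) * P := h5.le
          _ ≤ (3 * inner T v s) * P := Nat.mul_le_mul_right _ (hs4 rfl)
          _ = _ := by ring
    have h2 := choose_le_vSet hT (leafInv_omAt hT (ω := ω)) (v := v) (k := k) (X := 3 ::ₘ X)
      (ι := ι + 1) (n := n + 3) (p := p + 1)
    rw [Multiset.card_cons, hb] at h2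
    exact le_twelve_mul (mul_le_of_succ hF h1) (hdeep 3) h2
  have h1 := Finset.card_le_card hcover
  have h2 := Finset.card_union_le (vSet T k (2 ::ₘ X) (ι + 1) (n + 2) (R 1) (p + 2) v ∪
      vSet T k (2 ::ₘ X) (ι + 1) (n + 2) (R 2) (p + 2) v)
      (vSet T k (2 ::ₘ X) (ι + 1) (n + 2) (R 3) (p + 2) v)
  have h3 := Finset.card_union_le (vSet T k (2 ::ₘ X) (ι + 1) (n + 2) (R 1) (p + 2) v)
    (vSet T k (2 ::ₘ X) (ι + 1) (n + 2) (R 2) (p + 2) v)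
  omega

/-- Bounding a sum over the vertices by the number of subtrees that the summands count. -/
lemma sum_card_vSet_filter_le (hT : T.IsTree) (hk : 17 ≤ k) (hn : k ≤ n + p + 2)
    (R : V → Finset V → Prop) (Q : Finset V → Prop) {𝓑 : Finset (Finset V)}
    (h : ∀ 𝓖 : Finset (Finset V),
      (∀ g ∈ 𝓖, ∃ v, VSt T k X ι n p g v ∧ R v g ∧ Q g) → 𝓖.card ≤ 𝓑.card) :
    ∑ v, ((vSet T k X ι n (R v) p v).filter Q).card ≤ 2 * 𝓑.card := by
  have h1 := sum_card_filter_le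
    (Finset.univ.filter fun g => ∃ v, VSt T k X ι n p g v ∧ R v g ∧ Q g)
    (fun v g => Cfg T k X g v)
    (fun v => (vSet T k X ι n (R v) p v).filter Q) (fun v g hg => by
      obtain ⟨h1, h2⟩ := Finset.mem_filter.1 hg
      obtain ⟨h1, h3⟩ := mem_vSet.1 h1
      exact ⟨Finset.mem_filter.2 ⟨Finset.mem_univ _, v, h1, h3, h2⟩, h1.cfg⟩) (m := 2)
    (fun g hg => by
      obtain ⟨v, h1, -⟩ := (Finset.mem_filter.1 hg).2
      have := h1.card
      exact card_filter_cfg_le_two hT (by omega) (by omega))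
  exact h1.trans (Nat.mul_le_mul_left _ (h _ fun g hg => (Finset.mem_filter.1 hg).2))

theorem card_le_of_small_fork (hT : T.IsTree) (hX : 1 ≤ X.card) (hk : 17 ≤ k) {r₁ r₂ : V}
    (hr : k + 2 ≤ T.dist r₁ r₂) (hn : n + 2 + (p + 2) = k) (hF : 1 ≤ F)
    {𝓢 : Finset (Finset V)}
    (h𝓢 : ∀ s ∈ 𝓢, ∃ v, VSt T k (2 ::ₘ X) (ι + 1) (n + 2) (p + 2) s v ∧ FkAt T ω F v s) :
    𝓢.card ≤ 140 * (devSet T k (ι + 1) (ω + (p + 2))).card := by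
  set B := devSet T k (ι + 1) (ω + (p + 2)) with hB
  have h0 : 𝓢.card ≤
      ∑ v, (vSet T k (2 ::ₘ X) (ι + 1) (n + 2) (FkAt T ω F v) (p + 2) v).card := by
    have := mul_card_le_sum_card_filter 𝓢 (fun (v : V) s =>
      VSt T k (2 ::ₘ X) (ι + 1) (n + 2) (p + 2) s v ∧ FkAt T ω F v s) (c := 1) fun s hs => by
        obtain ⟨v, hv⟩ := h𝓢 s hs
        exact Finset.card_pos.2 ⟨v, by simpa using hv⟩
    rw [one_mul] at this
    refine this.trans (le_of_eq (Finset.sum_congr rfl fun v _ => congrArg Finset.card ?_))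
    ext g
    simp [vSet]
  have hleaf : ∀ r, ∑ v, ((vSet T k (2 ::ₘ X) (ι + 1) (n + 2) (FkAt T ω F v) (p + 1) v).filter
      (LeafGate T r)).card ≤ 2 * B.card := by
    refine fun r => sum_card_vSet_filter_le hT hk (X := 2 ::ₘ X) (ι := ι + 1) (n := n + 2)
      (p := p + 1) (by omega) (fun v => FkAt T ω F v) (LeafGate T r) fun 𝓖 h𝓖 => ?_
    refine card_le_of_leaf_gate hT (k := k) (ι := ι + 1) (r := r)
      (fun s h1 h2 h3 => mem_devSet.2 ⟨h1, h2, Or.inl h3⟩) fun g hg => ?_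
    obtain ⟨v, h, -, hQ⟩ := h𝓖 g hg
    have := h.card
    exact ⟨h.cfg.conv, by omega, h.intr, hQ⟩
  have hfar : ∀ r, ∑ v, ((vSet T k (2 ::ₘ X) (ι + 1) (n + 2) (FkAt T ω F v) p v).filter
      (FarGate T r)).card ≤ 2 * B.card := by
    refine fun r => sum_card_vSet_filter_le hT hk (X := 2 ::ₘ X) (ι := ι + 1) (n := n + 2)
      (p := p) (by omega) (fun v => FkAt T ω F v) (FarGate T r) fun 𝓖 h𝓖 => ?_
    refine card_le_of_far_gate hT (k := k) (ι := ι + 1) (r := r) (by omega)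
      (fun s h1 h2 h3 => mem_devSet.2 ⟨h1, h2, Or.inl h3⟩) fun g hg => ?_
    obtain ⟨v, h, -, hQ⟩ := h𝓖 g hg
    have := h.card
    exact ⟨h.cfg.conv, by omega, h.intr, hQ⟩
  have b1 := sum_card_vSet_filter_le hT hk (𝓑 := B) (X := X) (ι := ι) (n := n) (p := p + 4)
      (by omega) (fun _ _ => True) (fun _ => True) fun 𝓖 h𝓖 => Finset.card_le_card fun g hg => by
    obtain ⟨v, h, -⟩ := h𝓖 g hg
    have h1 := h.card
    have h2 := h.intr
    exact mem_devSet.2 ⟨h.cfg.conv, by omega, Or.inl (by omega)⟩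
  have b2 := sum_card_vSet_filter_le hT hk (𝓑 := B) (X := 2 ::ₘ 2 ::ₘ X) (ι := ι + 2)
      (n := n + 4) (p := p)
      (by omega) (fun _ _ => True) (fun _ => True) fun 𝓖 h𝓖 => Finset.card_le_card fun g hg => by
    obtain ⟨v, h, -⟩ := h𝓖 g hg
    have h1 := h.card
    have h2 := h.intr
    exact mem_devSet.2 ⟨h.cfg.conv, by omega, Or.inl (by omega)⟩
  have b3 := sum_card_vSet_filter_le hT hk (𝓑 := B) (X := 3 ::ₘ X) (ι := ι + 1)
      (n := n + 3) (p := p + 1)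
      (by omega) (fun v => OmAt T ω v) (fun _ => True) fun 𝓖 h𝓖 => Finset.card_le_card fun g hg => by
    obtain ⟨v, h, h3, -⟩ := h𝓖 g hg
    have h1 := h.card
    have h2 := h.lf
    have h4 := h3.2
    exact mem_devSet.2 ⟨h.cfg.conv, by omega, Or.inr (by omega)⟩
  simp only [Finset.filter_true] at b1 b2 b3
  have h1 : ∀ v, (vSet T k (2 ::ₘ X) (ι + 1) (n + 2) (FkAt T ω F v) (p + 2) v).card ≤
      (4 * (vSet T k X ι n (fun _ => True) (p + 4) v).card +
      36 * (vSet T k (2 ::ₘ 2 ::ₘ X) (ι + 2) (n + 4) (fun _ => True) p v).card +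
      12 * (vSet T k (3 ::ₘ X) (ι + 1) (n + 3) (OmAt T ω v) (p + 1) v).card) +
      ((3 * ((vSet T k (2 ::ₘ X) (ι + 1) (n + 2) (FkAt T ω F v) (p + 1) v).filter
          (LeafGate T r₁)).card +
        6 * ((vSet T k (2 ::ₘ X) (ι + 1) (n + 2) (FkAt T ω F v) p v).filter
          (FarGate T r₁)).card) +
      (3 * ((vSet T k (2 ::ₘ X) (ι + 1) (n + 2) (FkAt T ω F v) (p + 1) v).filter
          (LeafGate T r₂)).card +
        6 * ((vSet T k (2 ::ₘ X) (ι + 1) (n + 2) (FkAt T ω F v) p v).filter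
          (FarGate T r₂)).card)) := by
    intro v
    by_cases ha : 2 * p + 5 ≤ (nb T Finset.univ v).card - (X.card + 1)
    · exact (vSet_le_of_far hT hX hF ha).trans (Nat.le_add_right _ _)
    · refine (vSet_le_of_near hT (leafInv_fkAt hT) ?_ (by omega) ?_).trans
        (Nat.le_add_left _ _) <;> rw [Multiset.card_cons] <;> omega
  have h2 := h0.trans (Finset.sum_le_sum fun v _ => h1 v)
  simp only [Finset.sum_add_distrib, ← Finset.mul_sum] at h2
  have l1 := hleaf r₁
  have l2 := hleaf r₂
  have f1 := hfar r₁
  have f2 := hfar r₂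
  omega

end SmallForkMoves

section Transfer

open scoped Classical

variable {V W : Type*} {T : SimpleGraph V} {S : SimpleGraph W} [Fintype W] (f : S ↪g T)

/-- The vertex set of the copy of `S` that is embedded by `f`. -/
def copy (f : S ↪g T) : Finset V := Finset.univ.map f.toEmbedding

lemma mem_copy {x : V} : x ∈ copy f ↔ ∃ a, f a = x := by
  simp [copy]

omit [Fintype W] in
lemma dist_map (hT : T.IsTree) (hS : S.IsTree) (a b : W) : T.dist (f a) (f b) = S.dist a b := by
  obtain ⟨p, hp, hl⟩ := hS.1.exists_path_of_dist a b
  obtain ⟨q, hq, hl'⟩ := hT.1.exists_path_of_dist (f a) (f b)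
  have h : (p.map f.toHom).IsPath := hp.map f.injective
  have := (hT.existsUnique_path (f a) (f b)).unique h hq
  rw [← hl', ← hl, ← this]
  exact Walk.length_map _ _

omit [Fintype W] in
lemma geod_map (hT : T.IsTree) (hS : S.IsTree) {a x b : W} :
    Geod T (f a) (f x) (f b) ↔ Geod S a x b := by
  unfold Geod
  rw [dist_map f hT hS, dist_map f hT hS, dist_map f hT hS]

lemma nb_map (a : W) : nb T (copy f) (f a) = (nb S Finset.univ a).map f.toEmbedding := by
  ext y
  simp only [mem_nb, mem_copy, Finset.mem_map]
  constructor
  · rintro ⟨⟨b, rfl⟩, h⟩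
    exact ⟨b, ⟨Finset.mem_univ _, f.map_adj_iff.1 h⟩, rfl⟩
  · rintro ⟨b, ⟨-, h⟩, rfl⟩
    exact ⟨⟨b, rfl⟩, f.map_adj_iff.2 h⟩

lemma card_nb_map (a : W) : (nb T (copy f) (f a)).card = (nb S Finset.univ a).card := by
  rw [nb_map, Finset.card_map]

lemma Lf_map (a : W) : Lf T (copy f) (f a) = (Lf S Finset.univ a).map f.toEmbedding := by
  rw [Lf, nb_map, Finset.filter_map, Lf]
  congr 1
  exact Finset.filter_congr fun b _ => by
    simp only [Function.comp_apply, RelEmbedding.coe_toEmbedding, card_nb_map]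

lemma Nl_map (a : W) : Nl T (copy f) (f a) = (Nl S Finset.univ a).map f.toEmbedding := by
  rw [Nl, nb_map, Finset.filter_map, Nl]
  congr 1
  exact Finset.filter_congr fun b _ => by
    simp only [Function.comp_apply, RelEmbedding.coe_toEmbedding, card_nb_map]

lemma Intr_map : Intr T (copy f) = (Intr S Finset.univ).map f.toEmbedding := by
  rw [Intr, copy, Finset.filter_map, Intr]
  congr 1
  exact Finset.filter_congr fun b _ => by
    simp only [Function.comp_apply, RelEmbedding.coe_toEmbedding]
    rw [← copy, card_nb_map]

lemma Jn_map : Jn T (copy f) = (Jn S Finset.univ).map f.toEmbedding := by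
  rw [Jn, copy, Finset.filter_map, Jn]
  congr 1
  exact Finset.filter_congr fun b _ => by
    simp only [Function.comp_apply, RelEmbedding.coe_toEmbedding]
    rw [← copy, Nl_map, Finset.card_map]

lemma Om_map : Om T (copy f) = Om S Finset.univ := by
  rw [Om, Jn_map, Finset.sum_map, Om]
  exact Finset.sum_congr rfl fun b _ => card_nb_map f b

lemma Fk_map (v : W) (q : ℕ) :
    Fk T (copy f) (f v) q = (Fk S Finset.univ v q).map f.toEmbedding := by
  rw [Fk, Nl_map, Finset.filter_map, Fk]
  congr 1
  exact Finset.filter_congr fun b _ => by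
    simp only [Function.comp_apply, RelEmbedding.coe_toEmbedding, Nl_map, Lf_map, Finset.card_map]

lemma beh_map (hT : T.IsTree) (hS : S.IsTree) (v m : W) :
    beh T (copy f) (f v) (f m) = (beh S Finset.univ v m).map f.toEmbedding := by
  rw [beh, copy, Finset.filter_map, beh]
  congr 1
  exact Finset.filter_congr fun b _ => geod_map f hT hS

lemma map_card_beh_map (hT : T.IsTree) (hS : S.IsTree) (v : W) (A : Finset W) :
    (A.map f.toEmbedding).val.map (fun n => (beh T (copy f) (f v) n).card) =
      A.val.map fun n => (beh S Finset.univ v n).card := by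
  rw [Finset.map_val, Multiset.map_map]
  exact Multiset.map_congr rfl fun b _ => by
    simp only [Function.comp_apply, RelEmbedding.coe_toEmbedding, beh_map f hT hS, Finset.card_map]

variable {f}

lemma hub_map (hT : T.IsTree) (hS : S.IsTree) {k : ℕ} {v : W}
    (h : ∀ m ∈ Finset.univ, m ≠ v → 3 ≤ (Nl S Finset.univ m).card →
      2 * (beh S Finset.univ v m).card ≤ k) :
    ∀ m ∈ copy f, m ≠ f v → 3 ≤ (Nl T (copy f) m).card →
      2 * (beh T (copy f) (f v) m).card ≤ k := by
  intro m hm hmv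
  obtain ⟨b, rfl⟩ := (mem_copy f).1 hm
  rw [Nl_map, Finset.card_map, beh_map f hT hS, Finset.card_map]
  exact h b (Finset.mem_univ _) fun h' => hmv (h' ▸ rfl)

lemma Cfg.map (hT : T.IsTree) (hS : S.IsTree) {k : ℕ} {X : Multiset ℕ} {v : W}
    (hc : Conv T (copy f)) (h : Cfg S k X Finset.univ v) : Cfg T k X (copy f) (f v) := by
  obtain ⟨-, -, h2, h3, h4⟩ := h
  refine ⟨hc, (mem_copy f).2 ⟨v, rfl⟩, by rwa [card_nb_map], ?_, hub_map hT hS h4⟩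
  rw [Sz, Nl_map, map_card_beh_map f hT hS, ← h3, Sz]

lemma VSt.map (hT : T.IsTree) (hS : S.IsTree) {k : ℕ} {X : Multiset ℕ} {ι n p : ℕ} {v : W}
    (hc : Conv T (copy f)) (h : VSt S k X ι n p Finset.univ v) :
    VSt T k X ι n p (copy f) (f v) :=
  ⟨h.cfg.map hT hS hc, by rw [Lf_map, Finset.card_map, h.lf], by rw [copy, Finset.card_map, h.card],
    by rw [Intr_map, Finset.card_map, h.intr]⟩

lemma FkAt.map {ω F : ℕ} {v : W} (h : FkAt S ω F v Finset.univ) : FkAt T ω F (f v) (copy f) := by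
  unfold FkAt OmAt at h ⊢
  simpa only [Nl_map, Lf_map, Fk_map, Om_map, Finset.card_map] using h

lemma Frame.map (hT : T.IsTree) (hS : S.IsTree) {k : ℕ} {X : Multiset ℕ} {F ι : ℕ} {v u : W}
    (h : Frame S k X F ι Finset.univ v u) : Frame T k X F ι (copy f) (f v) (f u) := by
  obtain ⟨h1, h2, h3, h4, h5, h6⟩ := h
  refine ⟨?_, ?_, ?_, hub_map hT hS h4, fun j => ?_, ?_⟩
  · rw [Nl_map]
    exact Finset.mem_map_of_mem _ h1
  · rw [Nl_map, Finset.card_map, h2]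
  · rw [Nl_map]
    have : ((Nl S Finset.univ v).map f.toEmbedding).erase (f u) =
        ((Nl S Finset.univ v).erase u).map f.toEmbedding := (Finset.map_erase _ _ _).symm
    rw [this, map_card_beh_map f hT hS, h3]
  · rw [Fk_map]
    have : ((Fk S Finset.univ v j).map f.toEmbedding).erase (f u) =
        ((Fk S Finset.univ v j).erase u).map f.toEmbedding := (Finset.map_erase _ _ _).symm
    rw [this, Finset.card_map]
    exact h5 j
  · rw [Intr_map, Finset.card_map, h6]

lemma St.map (hT : T.IsTree) (hS : S.IsTree) {k : ℕ} {X : Multiset ℕ} {F ι n ω p q : ℕ}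
    {v u : W} (hc : Conv T (copy f)) (h : St S k X F ι n ω p q Finset.univ v u) :
    St T k X F ι n ω p q (copy f) (f v) (f u) := by
  obtain ⟨-, -, h3, h4, h5, h6, h7, h8⟩ := h
  refine ⟨hc, (mem_copy f).2 ⟨v, rfl⟩, h3.map hT hS, ?_, ?_, ?_, ?_, ?_⟩
  · rw [Lf_map, Finset.card_map, h4]
  · rw [Lf_map, Finset.card_map, h5]
  · rw [beh_map f hT hS, Finset.card_map, h6]
  · rw [copy, Finset.card_map, h7]
  · rw [Om_map, h8]

/-- An embedding of `S` in `T` in the sense of vertex sets comes from a graph embedding. -/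
lemma exists_eq_copy {s : Finset V} (h : Nonempty (T.induce (s : Set V) ≃g S)) :
    ∃ f : S ↪g T, copy f = s := by
  obtain ⟨φ⟩ := h
  refine ⟨(Embedding.induce (s : Set V)).comp φ.symm.toEmbedding, ?_⟩
  ext x
  rw [mem_copy]
  constructor
  · rintro ⟨a, rfl⟩
    exact (φ.symm a).2
  · intro hx
    exact ⟨φ ⟨x, hx⟩, by simp⟩

end Transfer

section Source

open scoped Classical

variable {W : Type*} [Fintype W] {S : SimpleGraph W}

lemma conv_univ (hS : S.IsTree) : Conv S Finset.univ :=
  ⟨Finset.univ_nonempty_iff.2 hS.1.nonempty, fun _ _ _ _ _ _ => Finset.mem_univ _⟩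

lemma ndeg_eq (v : W) : ndeg S v = (nb S Finset.univ v).card := by
  rw [ndeg, ← Set.ncard_coe_finset]
  congr 1
  ext y
  simp [nb]

omit [Fintype W] in
lemma not_geod_of_notMem_support (hS : S.IsTree) {v a b : W} (p : S.Walk a b)
    (h : v ∉ p.support) : ¬ Geod S a v b := by
  induction p with
  | nil => exact not_geod_self hS (by simpa using h)
  | cons hadj q ih =>
    rw [Walk.support_cons, List.mem_cons, not_or] at h
    exact not_geod_trans hS (not_geod_of_adj_ne hS hadj h.1 fun h' =>
      h.2 (h' ▸ q.start_mem_support)) (ih h.2)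

omit [Fintype W] in
lemma mem_branchSet (hS : S.IsTree) {v u w : W} (h : S.Adj v u) :
    w ∈ branchSet S v u ↔ Geod S v u w := by
  rw [geod_of_adj_iff h]
  constructor
  · rintro ⟨p, hp⟩
    have h1 := not_geod_of_notMem_support hS p hp
    rw [geod_of_adj_iff h.symm] at h1
    rcases dist_adj_cases hS h w with h2 | h2
    · exact h2
    · exact absurd h2 h1
  · intro hd
    obtain ⟨p, hp⟩ := hS.1.exists_walk_length_eq_dist u w
    refine ⟨p, fun hv => ?_⟩
    have h1 := congrArg Walk.length (p.take_spec hv)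
    rw [Walk.length_append] at h1
    have h2 := dist_le (p.dropUntil v hv)
    omega

lemma branchSet_eq_beh (hS : S.IsTree) {v u : W} (h : S.Adj v u) :
    branchSet S v u = (beh S Finset.univ v u : Set W) := by
  ext w
  rw [mem_branchSet hS h, Finset.mem_coe, mem_beh]
  simp

lemma nontrivialBranch_iff (hS : S.IsTree) {v u : W} :
    NontrivialBranch S v u ↔ u ∈ Nl S Finset.univ v := by
  rw [mem_Nl, NontrivialBranch]
  simp only [Finset.mem_univ, true_and]
  refine and_congr_right fun h => not_congr ?_
  have hv : v ∈ nb S Finset.univ u := mem_nb.2 ⟨Finset.mem_univ _, h.symm⟩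
  constructor
  · intro h1
    refine Finset.card_eq_one.2 ⟨v, Finset.eq_singleton_iff_unique_mem.2 ⟨hv, fun x hx => ?_⟩⟩
    by_contra hne
    have hx := (mem_nb.1 hx).2
    have : x ∈ branchSet S v u := by
      rw [mem_branchSet hS h, geod_of_adj_iff h, dist_adj_adj hS h hx (Ne.symm hne),
        dist_eq_one_iff_adj.2 hx]
    rw [h1, Set.mem_singleton_iff] at this
    exact hx.ne' this
  · intro h1
    ext w
    rw [mem_branchSet hS h, Set.mem_singleton_iff]
    constructor
    · intro hg
      by_contra hne
      obtain ⟨x, hx, hd⟩ := exists_adj_dist_succ hS (Ne.symm hne)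
      have := Finset.card_le_one.1 h1.le x (mem_nb.2 ⟨Finset.mem_univ _, hx⟩) v hv
      subst this
      have := (geod_of_adj_iff h).1 hg
      omega
    · rintro rfl
      exact geod_right _ _

lemma ncard_nontrivialBranch (hS : S.IsTree) (v : W) :
    {u | NontrivialBranch S v u}.ncard = (Nl S Finset.univ v).card := by
  rw [← Set.ncard_coe_finset]
  congr 1
  ext u
  simp [nontrivialBranch_iff hS]

lemma _root_.IsFork.mem_Fk (hS : S.IsTree) {v u : W} (h2 : 2 ≤ (nb S Finset.univ v).card)
    (h : IsFork S v u) :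
    u ∈ Fk S Finset.univ v (Lf S Finset.univ u).card ∧ 1 ≤ (Lf S Finset.univ u).card := by
  obtain ⟨h1, h3⟩ := h
  have hu := (nontrivialBranch_iff hS).1 h1
  have hadj := (TreeStat.mem_Nl.1 hu).1.2
  have hv : v ∈ Nl S Finset.univ u :=
    TreeStat.mem_Nl.2 ⟨⟨Finset.mem_univ _, hadj.symm⟩, by omega⟩
  have hNl : Nl S Finset.univ u = {v} := by
    refine Finset.eq_singleton_iff_unique_mem.2 ⟨hv, fun x hx => ?_⟩
    by_contra hne
    have hx' := (TreeStat.mem_Nl.1 hx)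
    have : x ∈ branchSet S v u := by
      rw [mem_branchSet hS hadj, geod_of_adj_iff hadj, dist_adj_adj hS hadj hx'.1.2 (Ne.symm hne),
        dist_eq_one_iff_adj.2 hx'.1.2]
    have := h3 x this hx'.1.2.ne'
    rw [ndeg_eq] at this
    exact hx'.2 this
  have hc := card_Lf_add_card_Nl (T := S) Finset.univ u
  rw [hNl, Finset.card_singleton] at hc
  have hpos : 1 ≤ (nb S Finset.univ u).card :=
    Finset.card_pos.2 ⟨v, mem_nb.2 ⟨Finset.mem_univ _, hadj.symm⟩⟩
  have := (TreeStat.mem_Nl.1 hu).2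
  exact ⟨TreeStat.mem_Fk.2 ⟨hu, rfl, by rw [hNl, Finset.card_singleton]⟩, by omega⟩

lemma forkOrder_eq (hS : S.IsTree) {v u : W} (h2 : 2 ≤ (nb S Finset.univ v).card)
    (h : IsFork S v u) : forkOrder S v u = (Lf S Finset.univ u).card := by
  rw [forkOrder, branchSet_eq_beh hS h.1.1, Set.ncard_coe_finset,
    card_beh_of_mem_Fk hS (conv_univ hS) (Finset.mem_univ _) h2 (h.mem_Fk hS h2).1]
  omega

lemma ncard_leaf_neighbours (v : W) :
    {u | S.Adj v u ∧ ndeg S u = 1}.ncard = (Lf S Finset.univ v).card := by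
  rw [← Set.ncard_coe_finset]
  congr 1
  ext u
  simp [TreeStat.mem_Lf, ndeg_eq]

lemma ncard_internal : {v | ndeg S v ≠ 1}.ncard = (Intr S Finset.univ).card := by
  rw [← Set.ncard_coe_finset]
  congr 1
  ext u
  simp [Intr, ndeg_eq]

/-- Seen from a hub, every vertex with three non-trivial branches has at most half of the
vertices behind it. -/
lemma _root_.IsHub.card_beh_le (hS : S.IsTree) {v : W} (h : IsHub S v) {m : W} (hmv : m ≠ v)
    (hm : 3 ≤ (Nl S Finset.univ m).card) :
    2 * (beh S Finset.univ v m).card ≤ Fintype.card W := by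
  obtain ⟨-, c, hc, -, hpath⟩ := h
  have hg : ¬ Geod S v m c := fun hg => hpath m hg hmv (by
    rwa [RootsThreeNontrivial, ncard_nontrivialBranch hS])
  have hcm : c ≠ m := by
    rintro rfl
    exact hg (geod_right _ _)
  obtain ⟨u, hu, hd⟩ := exists_adj_dist_succ hS hcm
  refine le_trans (Nat.mul_le_mul_left 2 ?_) (hc u hu)
  rw [branchSet_eq_beh hS hu, Set.ncard_coe_finset]
  refine Finset.card_le_card fun b hb => ?_
  have hb := (mem_beh.1 hb).2
  refine mem_beh.2 ⟨Finset.mem_univ _, ?_⟩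
  have h1 : Geod S c m b := by
    by_contra h1
    exact not_geod_trans hS hg h1 hb
  rw [geod_of_adj_iff hu]
  unfold Geod at h1
  rcases dist_adj_cases hS hu b with h2 | h2
  · exact h2
  · have := hS.1.dist_triangle (u := u) (v := m) (w := b)
    omega

/-- The hypothesis of `card_le_of_large_fork` or that of `card_le_of_small_fork` holds for `S`. -/
def Good (S : SimpleGraph W) (k : ℕ) (v : W) : Prop :=
  (∃ X F ι n ω p q, X ≠ 0 ∧ 1 ≤ q ∧ 1 ≤ F ∧ n + (p + 1) + (q + 1) = k ∧
    F ≤ (Finset.univ.filter fun u =>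
      St S k X (F + 1) ι n ω (p + 1) (q + 1) Finset.univ v u).card) ∨
  ∃ (X : Multiset ℕ) (ι n p ω F : ℕ), 1 ≤ X.card ∧ n + 2 + (p + 2) = k ∧ 1 ≤ F ∧
    VSt S k (2 ::ₘ X) (ι + 1) (n + 2) (p + 2) Finset.univ v ∧ FkAt S ω F v Finset.univ

omit [Fintype W] in
lemma card_nb_le_Om {s : Finset W} {v : W} (hv : v ∈ s) (h : 2 ≤ (Nl S s v).card) :
    (nb S s v).card ≤ Om S s :=
  Finset.single_le_sum (f := fun y => (nb S s y).card) (fun _ _ => Nat.zero_le _)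
    (Finset.mem_filter.2 ⟨hv, h⟩)

omit [Fintype W] in
lemma card_Lf_add_card_Lf_le (hS : S.IsTree) {s : Finset W} {v u : W} (h : S.Adj v u) :
    (Lf S s v).card + (Lf S s u).card ≤ s.card := by
  rw [← Finset.card_union_of_disjoint]
  · refine Finset.card_le_card fun x hx => ?_
    rcases Finset.mem_union.1 hx with hx | hx
    · exact (TreeStat.mem_Lf.1 hx).1.1
    · exact (TreeStat.mem_Lf.1 hx).1.1
  · refine Finset.disjoint_left.2 fun x hx hx' => ?_
    have h1 := dist_eq_one_iff_adj.2 (TreeStat.mem_Lf.1 hx).1.2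
    have h2 := dist_eq_one_iff_adj.2 (TreeStat.mem_Lf.1 hx').1.2
    rcases dist_adj_cases hS h x with h3 | h3 <;> omega

lemma good_of_large_fork (hS : S.IsTree) {k : ℕ} (hcard : Fintype.card W = k) {v u₀ : W} {q : ℕ}
    (hNl : 2 ≤ (Nl S Finset.univ v).card) (hLf : 1 ≤ (Lf S Finset.univ v).card)
    (hhub : ∀ m ∈ Finset.univ, m ≠ v → 3 ≤ (Nl S Finset.univ m).card →
      2 * (beh S Finset.univ v m).card ≤ k)
    (hu₀ : u₀ ∈ Fk S Finset.univ v q) (hq : 2 ≤ q)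
    (hF : ∀ j, (Fk S Finset.univ v j).card ≤ (Fk S Finset.univ v q).card + 1) : Good S k v := by
  have hc := card_Lf_add_card_Nl (T := S) Finset.univ v
  have h2 : 2 ≤ (nb S Finset.univ v).card := by omega
  have hbeh : ∀ u ∈ Fk S Finset.univ v q, (beh S Finset.univ v u).card = q + 1 := fun u hu =>
    card_beh_of_mem_Fk hS (conv_univ hS) (Finset.mem_univ _) h2 hu
  obtain ⟨hu1, hu2, hu3⟩ := TreeStat.mem_Fk.1 hu₀
  have hle := card_Lf_add_card_Lf_le hS (s := Finset.univ) (TreeStat.mem_Nl.1 hu1).1.2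
  rw [Finset.card_univ, hcard, hu2] at hle
  have hOm := card_nb_le_Om (Finset.mem_univ v) hNl
  refine Or.inl ⟨((Nl S Finset.univ v).erase u₀).val.map fun n => (beh S Finset.univ v n).card,
    (Fk S Finset.univ v q).card, (Intr S Finset.univ).card,
    k - (Lf S Finset.univ v).card - q, Om S Finset.univ - (Lf S Finset.univ v).card,
    (Lf S Finset.univ v).card - 1, q - 1, ?_, by omega, Finset.card_pos.2 ⟨u₀, hu₀⟩,
    by omega, Finset.card_le_card fun u hu => ?_⟩
  · intro h0
    have := congrArg Multiset.card h0
    rw [Multiset.card_map, Finset.card_val, Finset.card_erase_of_mem hu1,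
      Multiset.card_zero] at this
    omega
  · obtain ⟨hw1, hw2, hw3⟩ := TreeStat.mem_Fk.1 hu
    refine Finset.mem_filter.2 ⟨Finset.mem_univ _, conv_univ hS, Finset.mem_univ _,
      ⟨hw1, hw3, ?_, hhub, fun j => ?_, rfl⟩, by omega, by omega, ?_, ?_, by omega⟩
    · have e1 := Sz_eq_cons hw1
      rw [Sz_eq_cons hu1, hbeh u hu, hbeh u₀ hu₀, Multiset.cons_inj_right] at e1
      exact e1.symm
    · exact (Finset.card_le_card (Finset.erase_subset _ _)).trans (hF j)
    · rw [hbeh u hu]; omega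
    · rw [Finset.card_univ]; omega

lemma good_of_small_fork (hS : S.IsTree) {k : ℕ} (hcard : Fintype.card W = k) {v : W}
    (hNl : 2 ≤ (Nl S Finset.univ v).card) (hLf : 2 ≤ (Lf S Finset.univ v).card)
    (hhub : ∀ m ∈ Finset.univ, m ≠ v → 3 ≤ (Nl S Finset.univ m).card →
      2 * (beh S Finset.univ v m).card ≤ k)
    (hF1 : 1 ≤ (Fk S Finset.univ v 1).card)
    (hF2 : (Fk S Finset.univ v 2).card ≤ (Fk S Finset.univ v 1).card) : Good S k v := by
  have hc := card_Lf_add_card_Nl (T := S) Finset.univ v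
  have h2 : 2 ≤ (nb S Finset.univ v).card := by omega
  obtain ⟨u₀, hu₀⟩ := Finset.card_pos.1 hF1
  have hu1 := (TreeStat.mem_Fk.1 hu₀).1
  have hOm := card_nb_le_Om (Finset.mem_univ v) hNl
  have hle : (nb S Finset.univ v).card ≤ k := by
    rw [← hcard]
    exact Finset.card_le_univ _
  have hι : 1 ≤ (Intr S Finset.univ).card :=
    Finset.card_pos.2 ⟨v, Finset.mem_filter.2 ⟨Finset.mem_univ _, by omega⟩⟩
  refine Or.inr ⟨((Nl S Finset.univ v).erase u₀).val.map fun n => (beh S Finset.univ v n).card,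
    (Intr S Finset.univ).card - 1, k - (Lf S Finset.univ v).card - 2,
    (Lf S Finset.univ v).card - 2, Om S Finset.univ - (Lf S Finset.univ v).card,
    (Fk S Finset.univ v 1).card, ?_, by omega, hF1,
    ⟨⟨conv_univ hS, Finset.mem_univ _, h2, ?_, hhub⟩, by omega, ?_, by omega⟩,
    ⟨hNl, by omega⟩, rfl, hF2⟩
  · rw [Multiset.card_map, Finset.card_val, Finset.card_erase_of_mem hu1]
    omega
  · rw [Sz_eq_cons hu1,
      card_beh_of_mem_Fk hS (conv_univ hS) (Finset.mem_univ _) h2 hu₀]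
  · rw [Finset.card_univ]; omega

lemma good_of_two_leaves (hS : S.IsTree) {k : ℕ} (hcard : Fintype.card W = k) {v u : W}
    (hNl : 2 ≤ (Nl S Finset.univ v).card) (hLf : 2 ≤ (Lf S Finset.univ v).card)
    (hhub : ∀ m ∈ Finset.univ, m ≠ v → 3 ≤ (Nl S Finset.univ m).card →
      2 * (beh S Finset.univ v m).card ≤ k)
    (hu : IsFork S v u) : Good S k v := by
  have hc := card_Lf_add_card_Nl (T := S) Finset.univ v
  obtain ⟨h1, h1'⟩ := hu.mem_Fk hS (by omega)
  have h0 : Fk S Finset.univ v 0 = ∅ := by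
    refine Finset.eq_empty_of_forall_notMem fun x hx => ?_
    obtain ⟨hx1, hx2, hx3⟩ := TreeStat.mem_Fk.1 hx
    have := card_Lf_add_card_Nl (T := S) Finset.univ x
    exact (TreeStat.mem_Nl.1 hx1).2 (by omega)
  have hbig : ∀ j, (Fk S Finset.univ v j).Nonempty → j ∈ Finset.range (Fintype.card W + 1) := by
    rintro j ⟨x, hx⟩
    rw [← (TreeStat.mem_Fk.1 hx).2.1, Finset.mem_range]
    exact Nat.lt_succ_of_le (Finset.card_le_univ _)
  obtain ⟨q, -, hq⟩ := Finset.exists_max_image (Finset.range (Fintype.card W + 1))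
    (fun j => (Fk S Finset.univ v j).card) ⟨0, by simp⟩
  have hmax : ∀ j, (Fk S Finset.univ v j).card ≤ (Fk S Finset.univ v q).card := by
    intro j
    rcases (Fk S Finset.univ v j).eq_empty_or_nonempty with h | h
    · rw [h]; simp
    · exact hq j (hbig j h)
  have hpos : 1 ≤ (Fk S Finset.univ v q).card := (Finset.card_pos.2 ⟨u, h1⟩).trans_le (hmax _)
  obtain ⟨w, hw⟩ := Finset.card_pos.1 hpos
  have hq0 : q ≠ 0 := by
    rintro rfl
    rw [h0] at hpos
    simp at hpos
  rcases Nat.lt_or_ge q 2 with h | h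
  · obtain rfl : q = 1 := by omega
    exact good_of_small_fork hS hcard hNl hLf hhub hpos (hmax 2)
  · exact good_of_large_fork hS hcard hNl (by omega) hhub hw h fun j =>
      (hmax j).trans (Nat.le_succ _)

/-- Every vertex other than `v` lies behind a neighbour of `v`; an internal one lies behind
a non-leaf neighbour. -/
lemma exists_mem_Nl (hS : S.IsTree) {v w : W} (hw : w ∈ Intr S Finset.univ) (hwv : w ≠ v) :
    ∃ x ∈ Nl S Finset.univ v, w ∈ beh S Finset.univ v x := by
  obtain ⟨x, hx, hd⟩ := exists_adj_dist_succ hS (Ne.symm hwv)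
  have hb : Geod S v x w := (geod_of_adj_iff hx).2 hd
  refine ⟨x, ?_, mem_beh.2 ⟨Finset.mem_univ _, hb⟩⟩
  rw [← nontrivialBranch_iff hS]
  refine ⟨hx, fun h => ?_⟩
  have hwx : w ∈ branchSet S v x := (mem_branchSet hS hx).2 hb
  rw [h, Set.mem_singleton_iff] at hwx
  subst hwx
  have : w ∈ Nl S Finset.univ v :=
    TreeStat.mem_Nl.2 ⟨⟨Finset.mem_univ _, hx⟩, (Finset.mem_filter.1 hw).2⟩
  exact ((nontrivialBranch_iff hS).2 this).2 h

lemma _root_.IsFork.eq_of_mem_beh (hS : S.IsTree) {v u w : W} (hu : IsFork S v u)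
    (hw : w ∈ Intr S Finset.univ) (hb : w ∈ beh S Finset.univ v u) : w = u := by
  by_contra hne
  have := hu.2 w (by rw [branchSet_eq_beh hS hu.1.1]; exact hb) hne
  rw [ndeg_eq] at this
  exact (Finset.mem_filter.1 hw).2 this

lemma two_le_card_Nl (hS : S.IsTree) {v u : W} (hu : IsFork S v u)
    (h3 : 3 ≤ (Intr S Finset.univ).card) : 2 ≤ (Nl S Finset.univ v).card := by
  have hu' := (nontrivialBranch_iff hS).1 hu.1
  by_contra hlt
  have hsub : Intr S Finset.univ ⊆ {v, u} := by
    intro w hw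
    rw [Finset.mem_insert, Finset.mem_singleton]
    by_contra! hne
    obtain ⟨x, hx, hb⟩ := exists_mem_Nl hS hw hne.1
    obtain rfl := Finset.card_le_one.1 (by omega) x hx u hu'
    exact hne.2 (hu.eq_of_mem_beh hS hw hb)
  have := (Finset.card_le_card hsub).trans Finset.card_le_two
  omega

lemma good_of_large_order (hS : S.IsTree) {k : ℕ} (hcard : Fintype.card W = k) {v u : W}
    (hcat : ∀ m, (Nl S Finset.univ m).card ≤ 2)
    (hNl : 2 ≤ (Nl S Finset.univ v).card) (hLf : 1 ≤ (Lf S Finset.univ v).card)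
    (hu : IsFork S v u) (ho : 2 ≤ (Lf S Finset.univ u).card) : Good S k v := by
  have hc := card_Lf_add_card_Nl (T := S) Finset.univ v
  have hu' := (hu.mem_Fk hS (by omega)).1
  refine good_of_large_fork hS hcard hNl hLf (fun m _ _ h => ?_) hu' ho fun j => ?_
  · have := hcat m
    omega
  · have h1 : (Fk S Finset.univ v j).card ≤ (Nl S Finset.univ v).card :=
      Finset.card_le_card (Finset.filter_subset _ _)
    have h2 : 1 ≤ _ := Finset.card_pos.2 ⟨u, hu'⟩
    have := hcat v
    omega

/-- A vertex of a caterpillar with three internal vertices that has a fork and a leaf has a fork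
of order at least two or at least two leaves. -/
lemma exists_large_order (hS : S.IsTree) (hcard : 17 ≤ Fintype.card W) {v u : W}
    (hcat : ∀ m, (Nl S Finset.univ m).card ≤ 2) (hι : (Intr S Finset.univ).card = 3)
    (hu : IsFork S v u) (hLf : (Lf S Finset.univ v).card = 1) :
    ∃ x, IsFork S v x ∧ 2 ≤ (Lf S Finset.univ x).card := by
  have hNl := two_le_card_Nl hS hu hι.ge
  have hc := card_Lf_add_card_Nl (T := S) Finset.univ v
  have h2 : 2 ≤ (nb S Finset.univ v).card := by omega
  have hu' := (nontrivialBranch_iff hS).1 hu.1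
  have hvI : v ∈ Intr S Finset.univ := Finset.mem_filter.2 ⟨Finset.mem_univ _, by omega⟩
  have hsub : insert v (Nl S Finset.univ v) ⊆ Intr S Finset.univ := by
    intro x hx
    rcases Finset.mem_insert.1 hx with rfl | hx
    · exact hvI
    · exact Finset.mem_filter.2 ⟨Finset.mem_univ _, (TreeStat.mem_Nl.1 hx).2⟩
  have hNl2 : (Nl S Finset.univ v).card = 2 := le_antisymm (hcat v) hNl
  have heq : insert v (Nl S Finset.univ v) = Intr S Finset.univ :=
    Finset.eq_of_subset_of_card_le hsub (by
      rw [Finset.card_insert_of_notMem notMem_Nl_self, hNl2, hι])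
  have hfork : ∀ x ∈ Nl S Finset.univ v, IsFork S v x := by
    intro x hx
    refine ⟨(nontrivialBranch_iff hS).2 hx, fun w hw hwx => ?_⟩
    have hadj := (TreeStat.mem_Nl.1 hx).1.2
    rw [ndeg_eq]
    by_contra h1
    have hwI : w ∈ insert v (Nl S Finset.univ v) :=
      heq ▸ Finset.mem_filter.2 ⟨Finset.mem_univ _, h1⟩
    have hd := (geod_of_adj_iff hadj).1 ((mem_branchSet hS hadj).1 hw)
    rcases Finset.mem_insert.1 hwI with rfl | hwN
    · rw [S.dist_self] at hd
      omega
    · have h3 := dist_eq_one_iff_adj.2 (TreeStat.mem_Nl.1 hwN).1.2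
      exact hwx (hS.1.dist_eq_zero_iff.1 (by omega)).symm
  by_contra! hcon
  have hcover : (Finset.univ : Finset W) ⊆ insert v (Lf S Finset.univ v) ∪
      (Nl S Finset.univ v).biUnion (beh S Finset.univ v) := by
    intro w _
    rw [Finset.mem_union, Finset.mem_insert, Finset.mem_biUnion]
    by_cases hwv : w = v
    · exact Or.inl (Or.inl hwv)
    obtain ⟨x, hx, hd⟩ := exists_adj_dist_succ hS (Ne.symm hwv)
    have hb : Geod S v x w := (geod_of_adj_iff hx).2 hd
    by_cases hxN : x ∈ Nl S Finset.univ v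
    · exact Or.inr ⟨x, hxN, mem_beh.2 ⟨Finset.mem_univ _, hb⟩⟩
    have hbr : branchSet S v x = {x} := by
      by_contra h
      exact hxN ((nontrivialBranch_iff hS).1 ⟨hx, h⟩)
    have hwx : w ∈ branchSet S v x := (mem_branchSet hS hx).2 hb
    rw [hbr, Set.mem_singleton_iff] at hwx
    subst hwx
    refine Or.inl (Or.inr (TreeStat.mem_Lf.2 ⟨⟨Finset.mem_univ _, hx⟩, ?_⟩))
    by_contra h
    exact hxN (TreeStat.mem_Nl.2 ⟨⟨Finset.mem_univ _, hx⟩, h⟩)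
  have hbeh : ∀ x ∈ Nl S Finset.univ v, (beh S Finset.univ v x).card ≤ 2 := by
    intro x hx
    have h3 := hcon x (hfork x hx)
    have h4 := card_beh_of_mem_Fk hS (conv_univ hS) (Finset.mem_univ v) h2
      ((hfork x hx).mem_Fk hS h2).1
    omega
  have hfin := (Finset.card_le_card hcover).trans (Finset.card_union_le _ _)
  have h5 := Finset.card_biUnion_le_card_mul _ _ 2 hbeh
  have h6 := Finset.card_insert_le v (Lf S Finset.univ v)
  rw [Finset.card_univ] at hfin
  rw [hNl2] at h5
  omega

lemma good_of_cond (hS : S.IsTree) {k : ℕ} (hk : 17 ≤ k) (hcard : Fintype.card W = k) {v : W}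
    (hcond :
      (¬ IsCaterpillar S ∧ IsHub S v ∧ (∃ u, IsFork S v u) ∧
        2 ≤ {u | S.Adj v u ∧ ndeg S u = 1}.ncard) ∨
      (IsCaterpillar S ∧ 4 ≤ {v | ndeg S v ≠ 1}.ncard ∧
        (∃ u, IsFork S v u ∧ 2 ≤ forkOrder S v u) ∧
        (∃ u, S.Adj v u ∧ ndeg S u = 1)) ∨
      (IsCaterpillar S ∧ {v | ndeg S v ≠ 1}.ncard = 3 ∧
        (∃ u, IsFork S v u) ∧ (∃ u, S.Adj v u ∧ ndeg S u = 1))) : Good S k v := by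
  have hleaf : (∃ u, S.Adj v u ∧ ndeg S u = 1) → 1 ≤ (Lf S Finset.univ v).card := by
    rintro ⟨u, hu⟩
    exact Finset.card_pos.2
      ⟨u, TreeStat.mem_Lf.2 ⟨⟨Finset.mem_univ _, hu.1⟩, by rw [← ndeg_eq, hu.2]⟩⟩
  have hcat : IsCaterpillar S → ∀ m, (Nl S Finset.univ m).card ≤ 2 := fun h m =>
    ncard_nontrivialBranch hS m ▸ h.2 m
  rw [ncard_leaf_neighbours, ncard_internal] at hcond
  rcases hcond with ⟨-, hhub, ⟨u, hu⟩, hLf⟩ | ⟨hc, hι, ⟨u, hu, ho⟩, hl⟩ | ⟨hc, hι, ⟨u, hu⟩, hl⟩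
  · have hNl : 3 ≤ (Nl S Finset.univ v).card := ncard_nontrivialBranch hS v ▸ hhub.1
    exact good_of_two_leaves hS hcard (by omega) hLf
      (fun m _ hmv hm => hcard ▸ hhub.card_beh_le hS hmv hm) hu
  · have hNl := two_le_card_Nl hS hu (by omega)
    have hc' := card_Lf_add_card_Nl (T := S) Finset.univ v
    rw [forkOrder_eq hS (by omega) hu] at ho
    exact good_of_large_order hS hcard (hcat hc) hNl (hleaf hl) hu ho
  · have hNl := two_le_card_Nl hS hu hι.ge
    rcases Nat.lt_or_ge (Lf S Finset.univ v).card 2 with h | h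
    · have h1 := hleaf hl
      obtain ⟨x, hx, hx2⟩ := exists_large_order hS (hcard ▸ hk) (hcat hc) hι hu (by omega)
      exact good_of_large_order hS hcard (hcat hc) hNl h1 hx hx2
    · refine good_of_two_leaves hS hcard hNl h (fun m _ _ hm => ?_) hu
      have := hcat hc m
      omega

end Source

section Density

open scoped Classical

variable {V W : Type*} [Fintype V] [Fintype W] {T : SimpleGraph V} {S : SimpleGraph W}

omit [Fintype V] in
lemma conv_copy (hT : T.IsTree) (hS : S.IsTree) {f : S ↪g T}
    (h : Nonempty (T.induce (copy f : Set V) ≃g S)) : Conv T (copy f) := by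
  obtain ⟨φ⟩ := h
  exact (conv_iff_connected hT _).2 (φ.connected_iff.2 hS.1)

lemma card_copies_le (hT : T.IsTree) (hS : S.IsTree) {k : ℕ} (hk : 17 ≤ k)
    {r₁ r₂ : V} (hr : k + 2 ≤ T.dist r₁ r₂) {v : W} (hv : Good S k v) :
    (Finset.univ.filter fun s : Finset V => Nonempty (T.induce (s : Set V) ≃g S)).card ≤
      140 * (devSet T k (Intr S Finset.univ).card (Om S Finset.univ)).card := by
  rcases hv with ⟨X, F, ι, n, ω, p, q, hX, hq, hF, hn, hcard⟩ |
    ⟨X, ι, n, p, ω, F, hX, hn, hF, h1, h2⟩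
  · obtain ⟨u, hu⟩ := Finset.card_pos.1 (hF.trans hcard)
    have hu := (Finset.mem_filter.1 hu).2
    rw [hu.frame.intr, hu.om]
    refine (card_le_of_large_fork hT hX hk hr hn hq hF fun s hs => ?_).trans
      (Nat.mul_le_mul_right _ (by norm_num))
    have hs := (Finset.mem_filter.1 hs).2
    obtain ⟨f, rfl⟩ := exists_eq_copy hs
    have hc := conv_copy hT hS hs
    refine ⟨f v, hcard.trans ?_⟩
    rw [← Finset.card_map f.toEmbedding]
    refine Finset.card_le_card fun x hx => ?_
    obtain ⟨y, hy, rfl⟩ := Finset.mem_map.1 hx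
    exact Finset.mem_filter.2 ⟨Finset.mem_univ _, (Finset.mem_filter.1 hy).2.map hT hS hc⟩
  · rw [h1.intr, h2.1.2, h1.lf]
    refine card_le_of_small_fork hT hX hk hr hn hF fun s hs => ?_
    have hs := (Finset.mem_filter.1 hs).2
    obtain ⟨f, rfl⟩ := exists_eq_copy hs
    exact ⟨f v, h1.map hT hS (conv_copy hT hS hs), h2.map⟩

lemma embCount_add_card_devSet_le (hT : T.IsTree) (hS : S.IsTree) {k : ℕ} :
    embCount T S k + (devSet T k (Intr S Finset.univ).card (Om S Finset.univ)).card ≤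
      subtreeCount T k := by
  rw [embCount, subtreeCount, ← Set.ncard_coe_finset, ← Set.ncard_union_eq]
  · refine Set.ncard_le_ncard ?_
    rintro s (⟨hs, ⟨φ⟩⟩ | hs)
    · exact ⟨hs, φ.connected_iff.2 hS.1⟩
    · have hs := mem_devSet.1 hs
      exact ⟨hs.2.1, (conv_iff_connected hT _).1 hs.1⟩
  · refine Set.disjoint_left.2 ?_
    rintro s ⟨-, hs⟩ hs'
    obtain ⟨f, rfl⟩ := exists_eq_copy hs
    have hs' := (mem_devSet.1 hs').2.2
    rw [Intr_map, Finset.card_map, Om_map] at hs'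
    simp at hs'

omit [Fintype W] in
lemma embCount_le (k : ℕ) : embCount T S k ≤
    (Finset.univ.filter fun s : Finset V => Nonempty (T.induce (s : Set V) ≃g S)).card := by
  rw [embCount, ← Set.ncard_coe_finset]
  exact Set.ncard_le_ncard fun s hs => by simpa using hs.2

end Density

end TreeStat

/-- Let k ≥ 17 and let S be a k-vertex tree with a vertex vS
satisfying one of the three listed conditions.  If T is a tree with radius at least 4k,
then d(S,T) ≤ 1 - 10^(-4). -/
theorem density_le_of_fork_conditions {V W : Type*} [Fintype V] [Fintype W]
    (k : ℕ) (hk : 17 ≤ k)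
    (S : SimpleGraph W) (hS : S.IsTree) (hcard : Fintype.card W = k)
    (vS : W)
    (hcond :
      (¬ IsCaterpillar S ∧ IsHub S vS ∧ (∃ u, IsFork S vS u) ∧
        2 ≤ {u | S.Adj vS u ∧ ndeg S u = 1}.ncard) ∨
      (IsCaterpillar S ∧ 4 ≤ {v | ndeg S v ≠ 1}.ncard ∧
        (∃ u, IsFork S vS u ∧ 2 ≤ forkOrder S vS u) ∧
        (∃ u, S.Adj vS u ∧ ndeg S u = 1)) ∨
      (IsCaterpillar S ∧ {v | ndeg S v ≠ 1}.ncard = 3 ∧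
        (∃ u, IsFork S vS u) ∧ (∃ u, S.Adj vS u ∧ ndeg S u = 1)))
    (T : SimpleGraph V) (hT : T.IsTree)
    (hrad : ∀ x : V, ∃ w : V, 4 * k ≤ T.dist x w) :
    density S T ≤ 1 - (1 / 10 : ℝ) ^ 4 := by
  obtain ⟨r₁⟩ := hT.1.nonempty
  obtain ⟨r₂, hr⟩ := hrad r₁
  have h1 := (TreeStat.embCount_le k).trans (TreeStat.card_copies_le hT hS hk
    (by omega : k + 2 ≤ T.dist r₁ r₂) (TreeStat.good_of_cond hS hk hcard hcond))
  have h2 := TreeStat.embCount_add_card_devSet_le hT hS (k := k)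
  rw [density, hcard]
  rcases Nat.eq_zero_or_pos (subtreeCount T k) with h0 | h0
  · rw [h0]
    norm_num
  · have h3 : 141 * embCount T S k ≤ 140 * subtreeCount T k := by omega
    rw [div_le_iff₀ (by exact_mod_cast h0)]
    have h3 : (141 : ℝ) * embCount T S k ≤ 140 * subtreeCount T k := by exact_mod_cast h3
    have h4 : (0 : ℝ) < subtreeCount T k := by exact_mod_cast h0
    norm_num
    linarith
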